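/- Let D and D′ be domains in ℝ^n, n ≥ 3, let φ:(0,∞)→(0,∞) be nondecreasing with ∫_{t_*}^∞ (t/φ(t))^{1/(n−2)} dt < ∞ for some t_* ∈ (0,∞), and let f:D→D′ be a homeomorphism of finite distortion of class W^{1,φ}_loc. If for some p ∈ (n, n + 1/(n−2)) one has limsup_{ε→0} ⨍_{B(x_0,ε)} K_p(x,f)^{(n−1)/(p−n+1)} dm(x) < ∞ for every x_0 ∈ D, then f is finitely Lipschitz, i.e. L(x,f) = limsup_{y→x} |f(y)−f(x)|/|y−x| < ∞ for all x ∈ D. -/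

import Mathlib

open MeasureTheory Metric Set Filter
open scoped ENNReal NNReal Topology RealInnerProductSpace Classical

noncomputable section

abbrev Eucl (n : ℕ) : Type := EuclideanSpace ℝ (Fin n)

/-- A `k`-dimensional surface in `ℝⁿ`: a continuous map defined on an open subset of the
one-point compactification of `ℝᵏ`. -/
structure Surface (n k : ℕ) where
  dom : Set (OnePoint (Eucl k))
  isOpen_dom : IsOpen dom
  toFun : OnePoint (Eucl k) → Eucl n
  continuousOn : ContinuousOn toFun dom

namespace Surface

variable {n k : ℕ}

/-- The multiplicity function `N(S,y)` of a surface. -/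
def mult (S : Surface n k) (y : Eucl n) : ℝ≥0∞ :=
  ((S.dom ∩ S.toFun ⁻¹' {y}).encard : ℕ∞)

/-- The integral `∫_S ρ dA = ∫ ρ(y) N(S,y) dH^k(y)` of `ρ` over the surface `S`. -/
def sint (S : Surface n k) (ρ : Eucl n → ℝ≥0∞) : ℝ≥0∞ :=
  ∫⁻ y, ρ y * S.mult y ∂(μH[(k : ℝ)] : Measure (Eucl n))

end Surface

/-- Admissible functions for a family of `k`-surfaces. -/
def surfAdm {n : ℕ} (k : ℕ) (Γ : Set (Surface n k)) : Set (Eucl n → ℝ≥0∞) :=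
  {ρ | Measurable ρ ∧ ∀ S ∈ Γ, 1 ≤ S.sint fun y => ρ y ^ k}

/-- The `p`-modulus of a family of `k`-surfaces. -/
def surfModulus {n : ℕ} (p : ℝ) (k : ℕ) (Γ : Set (Surface n k)) : ℝ≥0∞ :=
  ⨅ ρ ∈ surfAdm k Γ, ∫⁻ x, ρ x ^ p

/-- Extensively `p`-admissible functions: admissibility may fail on a subfamily of
`p`-modulus zero. -/
def extAdm {n : ℕ} (p : ℝ) (k : ℕ) (Γ : Set (Surface n k)) : Set (Eucl n → ℝ≥0∞) :=
  {ρ | Measurable ρ ∧ surfModulus p k {S ∈ Γ | ¬ 1 ≤ S.sint fun y => ρ y ^ k} = 0}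

/-- The family of the (injectively parametrized, nonempty) surfaces `S(x₀,r) ∩ D`,
`r ∈ I`. -/
def sphereFam {n : ℕ} (D : Set (Eucl n)) (x₀ : Eucl n) (I : Set ℝ) :
    Set (Surface n (n - 1)) :=
  {S | ∃ r ∈ I, S.dom.Nonempty ∧ Set.InjOn S.toFun S.dom ∧
      S.toFun '' S.dom = sphere x₀ r ∩ D}

/-- The image of a family of surfaces under a map `f`. -/
def imageFam {n k : ℕ} (f : Eucl n → Eucl n) (Γ : Set (Surface n k)) :
    Set (Surface n k) :=
  {S' | ∃ S ∈ Γ, S'.dom = S.dom ∧ Set.EqOn S'.toFun (f ∘ S.toFun) S.dom}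

/-- The spherical ring `R(x₀,a,b)`. -/
def ringA {n : ℕ} (x₀ : Eucl n) (a b : ℝ) : Set (Eucl n) :=
  {x | a < dist x x₀ ∧ dist x x₀ < b}

/-- `‖Q‖_α(r) = (∫_{D ∩ S(x₀,r)} Q^α dA)^{1/α}`. -/
def sphNorm {n : ℕ} (D : Set (Eucl n)) (x₀ : Eucl n) (Q : Eucl n → ℝ≥0∞)
    (α : ℝ) (r : ℝ) : ℝ≥0∞ :=
  (∫⁻ x in D ∩ sphere x₀ r, Q x ^ α ∂(μH[((n : ℝ) - 1)] : Measure (Eucl n))) ^ (1 / α)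

/-- `f` is a lower `Q`-homeomorphism w.r.t. the `p`-modulus at `x₀`. -/
def IsLowerQHomeoAt {n : ℕ} (D : Set (Eucl n)) (f : Eucl n → Eucl n)
    (Q : Eucl n → ℝ≥0∞) (p : ℝ) (x₀ : Eucl n) (d₀ : ℝ≥0∞) : Prop :=
  ∀ ε ε₀ : ℝ, 0 < ε → ε < ε₀ → ENNReal.ofReal ε₀ < d₀ →
    (⨅ ρ ∈ extAdm p (n - 1) (sphereFam D x₀ (Ioo ε ε₀)),
        ∫⁻ x in ringA x₀ ε ε₀, ρ x ^ p / Q x) ≤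
      surfModulus p (n - 1) (imageFam f (sphereFam D x₀ (Ioo ε ε₀)))

/-- `f` is a homeomorphism of `D` onto `D'`. -/
structure IsHomeoOn {n : ℕ} (f : Eucl n → Eucl n) (D D' : Set (Eucl n)) : Prop where
  continuousOn : ContinuousOn f D
  injOn : Set.InjOn f D
  image_eq : f '' D = D'
  isOpenMapOn : ∀ U : Set (Eucl n), U ⊆ D → IsOpen U → IsOpen (f '' U)

/-- `Df` is the weak (Sobolev) derivative of `f` on `D`, and `f ∈ W^{1,1}_loc(D)`. -/
def IsWeakDerivOn {n m : ℕ} (D : Set (Eucl n)) (f : Eucl n → Eucl m)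
    (Df : Eucl n → Eucl n →L[ℝ] Eucl m) : Prop :=
  LocallyIntegrableOn f D volume ∧ LocallyIntegrableOn Df D volume ∧
  ∀ ψ : Eucl n → ℝ, ContDiff ℝ (⊤ : ℕ∞) ψ → HasCompactSupport ψ → tsupport ψ ⊆ D →
    ∀ v : Eucl n, ∫ x, ψ x • Df x v = - ∫ x, fderiv ℝ ψ x v • f x

/-- The Frobenius norm `|∇f| = (Σ_{i,j} (∂f_i/∂x_j)²)^{1/2}` of a linear map. -/
def frobNorm {n m : ℕ} (A : Eucl n →L[ℝ] Eucl m) : ℝ :=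
  Real.sqrt (∑ i : Fin m, ∑ j : Fin n, (A (EuclideanSpace.single j 1) i) ^ 2)

/-- The Orlicz–Sobolev class `W^{1,φ}_loc(D)` (with explicit weak derivative `Df`). -/
def MemOrliczSobolevOn {n m : ℕ} (φ : ℝ → ℝ) (D : Set (Eucl n))
    (f : Eucl n → Eucl m) (Df : Eucl n → Eucl n →L[ℝ] Eucl m) : Prop :=
  IsWeakDerivOn D f Df ∧
  ∀ K : Set (Eucl n), K ⊆ D → IsCompact K →
    (∫⁻ x in K, ENNReal.ofReal (φ (frobNorm (Df x)))) < ⊤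

/-- `φ` is nondecreasing and positive on `(0,∞)`. -/
def NondecPos (φ : ℝ → ℝ) : Prop :=
  (∀ s t : ℝ, 0 < s → s ≤ t → φ s ≤ φ t) ∧ ∀ t : ℝ, 0 < t → 0 < φ t

/-- The Calderón-type condition `∫_{t₀}^∞ (t/φ(t))^{1/(n-2)} dt < ∞`. -/
def CalderonCond (n : ℕ) (φ : ℝ → ℝ) : Prop :=
  ∃ t₀ : ℝ, 0 < t₀ ∧
    IntegrableOn (fun t => (t / φ t) ^ (1 / ((n : ℝ) - 2))) (Ioi t₀) volume

/-- `f` (with a.e. derivative `Df`) has finite distortion on `D`. -/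
def HasFiniteDistortionOn {n : ℕ} (D : Set (Eucl n))
    (Df : Eucl n → Eucl n →L[ℝ] Eucl n) : Prop :=
  ∃ K : Eucl n → ℝ, AEMeasurable K (volume.restrict D) ∧
    ∀ᵐ x ∂volume.restrict D, 1 ≤ K x ∧ ‖Df x‖ ^ n ≤ K x * (Df x).det

/-- The distortion `K_p(x,f)` for a map with derivative `Df`. -/
def distortionKp {n : ℕ} (p : ℝ) (Df : Eucl n → Eucl n →L[ℝ] Eucl n)
    (x : Eucl n) : ℝ≥0∞ :=
  if (Df x).det ≠ 0 then ENNReal.ofReal (‖Df x‖ ^ p / (Df x).det)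
  else if Df x = 0 then 1 else ⊤

/-- The multiplicity function of a curve `γ : [0,1] → ℝⁿ`. -/
def curveMult {n : ℕ} (γ : ℝ → Eucl n) (y : Eucl n) : ℝ≥0∞ :=
  (({t ∈ Icc (0:ℝ) 1 | γ t = y}).encard : ℕ∞)

/-- The line integral `∫_γ ρ ds = ∫ ρ(y) N(γ,y) dH¹(y)`. -/
def curveInt {n : ℕ} (γ : ℝ → Eucl n) (ρ : Eucl n → ℝ≥0∞) : ℝ≥0∞ :=
  ∫⁻ y, ρ y * curveMult γ y ∂(μH[(1 : ℝ)] : Measure (Eucl n))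

/-- The family of curves joining `A` and `B` in `G`. -/
def curveJoin {n : ℕ} (A B G : Set (Eucl n)) : Set (ℝ → Eucl n) :=
  {γ | ContinuousOn γ (Icc 0 1) ∧ γ 0 ∈ A ∧ γ 1 ∈ B ∧ Set.MapsTo γ (Icc 0 1) G}

/-- The `q`-modulus of a family of curves. -/
def curveModulus {n : ℕ} (q : ℝ) (Γ : Set (ℝ → Eucl n)) : ℝ≥0∞ :=
  ⨅ ρ ∈ {ρ : Eucl n → ℝ≥0∞ | Measurable ρ ∧ ∀ γ ∈ Γ, 1 ≤ curveInt γ ρ},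
    ∫⁻ x, ρ x ^ q

/-- The `q`-capacity of the condenser `(A,C)`, via the modulus of joining curves. -/
def condenserCap {n : ℕ} (q : ℝ) (A C : Set (Eucl n)) : ℝ≥0∞ :=
  curveModulus q (curveJoin (frontier A) (frontier C) (A \ C))

/-- `L(x₀,f) = limsup_{x→x₀} |f(x)-f(x₀)|/|x-x₀|`. -/
def LAt {n : ℕ} (f : Eucl n → Eucl n) (x₀ : Eucl n) : ℝ≥0∞ :=
  limsup (fun x => edist (f x) (f x₀) / edist x x₀) (𝓝[≠] x₀)

/-- `k_p(x₀) = limsup_{ε→0} (⨍_{B(x₀,ε)} K_p(x,f)^{(n-1)/(p-n+1)} dm)^{(p-n+1)/(n-1)}`. -/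
def kpAt {n : ℕ} (p : ℝ) (Df : Eucl n → Eucl n →L[ℝ] Eucl n) (x₀ : Eucl n) : ℝ≥0∞ :=
  limsup (fun ε : ℝ =>
      ((∫⁻ x in ball x₀ ε, distortionKp p Df x ^ (((n:ℝ)-1)/(p-(n:ℝ)+1))) /
        volume (ball x₀ ε)) ^ ((p-(n:ℝ)+1)/((n:ℝ)-1)))
    (𝓝[>] (0:ℝ))

/-- `f` is absolutely continuous on `S` w.r.t. `d`-dimensional Hausdorff measure. -/
def ACOnSet {n m : ℕ} (f : Eucl n → Eucl m) (S : Set (Eucl n)) (d : ℝ) : Prop :=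
  ∀ ε : ℝ, 0 < ε → ∃ δ : ℝ, 0 < δ ∧ ∀ A : Set (Eucl n), A ⊆ S →
    (μH[d] : Measure (Eucl n)) A < ENNReal.ofReal δ →
      (μH[d] : Measure (Eucl m)) (f '' A) < ENNReal.ofReal ε

/-- `f` is locally absolutely continuous on `S` w.r.t. `H^d`. -/
def LocACOnSet {n m : ℕ} (f : Eucl n → Eucl m) (S : Set (Eucl n)) (d : ℝ) : Prop :=
  ∀ x ∈ S, ∃ V ∈ 𝓝 x, ACOnSet f (S ∩ V) d

/-- The Luzin (N)-property of `f` on `S` w.r.t. `d`-dimensional Hausdorff measure. -/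
def LusinNOn {n m : ℕ} (f : Eucl n → Eucl m) (S : Set (Eucl n)) (d : ℝ) : Prop :=
  ∀ A : Set (Eucl n), A ⊆ S → (μH[d] : Measure (Eucl n)) A = 0 →
    (μH[d] : Measure (Eucl m)) (f '' A) = 0

end

theorem det_rank_one_inv {n : ℕ} (M : Matrix (Fin n) (Fin n) ℝ) (hM : M.det ≠ 0) (u v : Fin n → ℝ) :
    (M + Matrix.vecMulVec u v).det = M.det + v ⬝ᵥ (M.adjugate.mulVec u) := by
  have h := Matrix.det_add_replicateCol_mul_replicateRow (ι := Unit) (A := M) (isUnit_iff_ne_zero.2 hM) u v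
  have e : Matrix.replicateCol Unit u * Matrix.replicateRow Unit v = Matrix.vecMulVec u v := by
    ext i j; simp [Matrix.mul_apply, Matrix.vecMulVec_apply]
  rw [e] at h
  rw [h, Matrix.inv_def, Ring.inverse_eq_inv']
  simp [Matrix.mul_apply, Matrix.mulVec, dotProduct, Matrix.replicateRow_apply]
  rw [mul_add, mul_one]
  congr 1
  rw [Finset.mul_sum]
  simp_rw [Finset.sum_mul, Finset.mul_sum]
  rw [Finset.sum_comm]
  refine Finset.sum_congr rfl fun i _ => Finset.sum_congr rfl fun j _ => ?_
  field_simp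

theorem det_rank_one {n : ℕ} (M : Matrix (Fin n) (Fin n) ℝ) (u v : Fin n → ℝ) :
    (M + Matrix.vecMulVec u v).det = M.det + v ⬝ᵥ (M.adjugate.mulVec u) := by
  let Mt : ℝ → Matrix (Fin n) (Fin n) ℝ := fun t => M + t • 1
  have hc : Continuous Mt := by fun_prop
  have hne : ∀ᶠ t in 𝓝[≠] (0:ℝ), (Mt t).det ≠ 0 := by
    have hfin : {t : ℝ | ((-M).charpoly).IsRoot t}.Finite :=
      Polynomial.finite_setOfPred_isRoot (Matrix.charpoly_monic _).ne_zero
    have : ∀ᶠ t in 𝓝[≠] (0:ℝ), t ∉ {t : ℝ | ((-M).charpoly).IsRoot t} \ {0} := by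
      have h1 : IsClosed ({t : ℝ | ((-M).charpoly).IsRoot t} \ {0}) := (hfin.subset sdiff_subset).isClosed
      exact nhdsWithin_le_nhds (h1.isOpen_compl.mem_nhds (by simp))
    filter_upwards [this, self_mem_nhdsWithin] with t ht h0 hdet
    apply ht
    refine ⟨?_, h0⟩
    simp only [Set.mem_ofPred_eq, Polynomial.IsRoot.def, Matrix.eval_charpoly]
    rw [← hdet]
    congr 1
    simp only [Mt]
    ext i j
    simp [Matrix.scalar_apply, Matrix.diagonal_apply, Matrix.one_apply, add_comm]
  have h1 : Tendsto (fun t => (Mt t + Matrix.vecMulVec u v).det) (𝓝[≠] 0) (𝓝 ((Mt 0 + Matrix.vecMulVec u v).det)) :=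
    ((hc.add continuous_const).matrix_det.tendsto 0).mono_left nhdsWithin_le_nhds
  have h2 : Tendsto (fun t => (Mt t).det + v ⬝ᵥ ((Mt t).adjugate.mulVec u)) (𝓝[≠] 0)
      (𝓝 ((Mt 0).det + v ⬝ᵥ ((Mt 0).adjugate.mulVec u))) := by
    have : Continuous (fun t => (Mt t).det + v ⬝ᵥ ((Mt t).adjugate.mulVec u)) := by
      refine hc.matrix_det.add (Continuous.dotProduct continuous_const ?_)
      exact Continuous.matrix_mulVec hc.matrix_adjugate continuous_const
    exact (this.tendsto 0).mono_left nhdsWithin_le_nhds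
  have h3 := tendsto_nhds_unique (h1.congr' (hne.mono fun t ht => det_rank_one_inv _ ht u v)) h2
  simpa [Mt] using h3

section AdjL
variable {E : Type*} [NormedAddCommGroup E] [NormedSpace ℝ E] [FiniteDimensional ℝ E]

noncomputable def matL (A : E →L[ℝ] E) :
    Matrix (Fin (Module.finrank ℝ E)) (Fin (Module.finrank ℝ E)) ℝ :=
  LinearMap.toMatrix (Module.finBasis ℝ E) (Module.finBasis ℝ E) (A : E →ₗ[ℝ] E)

/-- Adjugate of a linear map. -/
noncomputable def adjL (A : E →L[ℝ] E) : E →L[ℝ] E :=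
  LinearMap.toContinuousLinearMap (Matrix.toLin (Module.finBasis ℝ E) (Module.finBasis ℝ E) (matL A).adjugate)

theorem matL_adjL (A : E →L[ℝ] E) : matL (adjL A) = (matL A).adjugate := by
  simp [matL, adjL]

theorem det_matL (A : E →L[ℝ] E) : (matL A).det = A.det := by
  simp [matL, ContinuousLinearMap.det]

theorem matL_injective : Function.Injective (matL (E := E)) := by
  intro A B h
  have := (LinearMap.toMatrix _ _).injective h
  exact ContinuousLinearMap.coe_injective this

theorem matL_comp (A B : E →L[ℝ] E) : matL (A.comp B) = matL A * matL B := by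
  unfold matL
  rw [← LinearMap.toMatrix_comp]; rfl

theorem matL_smul (s : ℝ) (B : E →L[ℝ] E) : matL (s • B) = s • matL B := by
  simp [matL]

theorem matL_id : matL (ContinuousLinearMap.id ℝ E) = 1 := by
  simp [matL]

theorem comp_adjL (A : E →L[ℝ] E) (v : E) : A (adjL A v) = A.det • v := by
  have : A.comp (adjL A) = A.det • ContinuousLinearMap.id ℝ E := by
    apply matL_injective
    rw [matL_comp, matL_adjL, Matrix.mul_adjugate, det_matL, matL_smul, matL_id]
  exact congrArg (fun T => T v) this

theorem det_add_smulRight (A : E →L[ℝ] E) (ξ : E →L[ℝ] ℝ) (v : E) :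
    (A + ξ.smulRight v).det = A.det + ξ (adjL A v) := by
  have e : matL (A + ξ.smulRight v) = matL A + Matrix.vecMulVec ((Module.finBasis ℝ E).repr v) (fun j => ξ (Module.finBasis ℝ E j)) := by
    ext i j
    simp [matL, LinearMap.toMatrix_apply, Matrix.vecMulVec_apply, mul_comm]
  rw [← det_matL, e, det_rank_one, det_matL]
  congr 1
  have hv : adjL A v = ∑ j, ((matL A).adjugate.mulVec ((Module.finBasis ℝ E).repr v) j) • (Module.finBasis ℝ E j) := by
    simp only [adjL, LinearMap.coe_toContinuousLinearMap', Matrix.toLin_apply]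
  rw [hv, map_sum]
  simp [dotProduct, mul_comm]

theorem continuous_matL : Continuous (matL (E := E)) := by
  refine continuous_matrix fun i j => ?_
  have : (fun A : E →L[ℝ] E => matL A i j) = fun A => (Module.finBasis ℝ E).coord i (A (Module.finBasis ℝ E j)) := by
    ext A; simp [matL, LinearMap.toMatrix_apply]
  rw [this]
  exact (LinearMap.continuous_of_finiteDimensional _).comp (by fun_prop)

theorem continuous_adjL : Continuous (adjL (E := E)) := by
  have : Continuous fun M : Matrix (Fin (Module.finrank ℝ E)) (Fin (Module.finrank ℝ E)) ℝ =>
    LinearMap.toContinuousLinearMap (Matrix.toLin (Module.finBasis ℝ E) (Module.finBasis ℝ E) M) :=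
    LinearMap.continuous_of_finiteDimensional
      ((LinearMap.toContinuousLinearMap (𝕜 := ℝ) (E := E) (F' := E)).toLinearMap ∘ₗ
        (Matrix.toLin (Module.finBasis ℝ E) (Module.finBasis ℝ E)).toLinearMap)
  exact this.comp continuous_matL.matrix_adjugate

theorem adjL_smul (r : ℝ) (A : E →L[ℝ] E) : adjL (r • A) = r ^ (Module.finrank ℝ E - 1) • adjL A := by
  apply matL_injective
  rw [matL_smul, matL_adjL, matL_smul, Matrix.adjugate_smul, matL_adjL]
  simp

theorem continuous_detL : Continuous (fun A : E →L[ℝ] E => A.det) := by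
  simp_rw [← det_matL]; exact continuous_matL.matrix_det

end AdjL

section M1b
variable {E : Type*} [NormedAddCommGroup E] [NormedSpace ℝ E] [FiniteDimensional ℝ E]

theorem exists_adjL_bound (E : Type*) [NormedAddCommGroup E] [NormedSpace ℝ E] [FiniteDimensional ℝ E] : ∃ C : ℝ, 0 ≤ C ∧ ∀ A : E →L[ℝ] E, ‖adjL A‖ ≤ C * ‖A‖ ^ (Module.finrank ℝ E - 1) := by
  obtain ⟨C, hC⟩ := (isCompact_closedBall (0 : E →L[ℝ] E) 1).exists_bound_of_continuousOn
    (continuous_adjL (E := E)).continuousOn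
  have hC0 : 0 ≤ C := (norm_nonneg _).trans (hC 0 (by simp))
  refine ⟨C, hC0, fun A => ?_⟩
  have key : ∃ B : E →L[ℝ] E, ‖B‖ ≤ 1 ∧ A = ‖A‖ • B := by
    by_cases h : A = 0
    · exact ⟨0, by simp, by subst h; exact (smul_zero _).symm⟩
    · have : ‖A‖ ≠ 0 := norm_ne_zero_iff.2 h
      refine ⟨‖A‖⁻¹ • A, ?_, ?_⟩
      · rw [norm_smul, norm_inv, norm_norm, inv_mul_cancel₀ this]
      · rw [smul_smul, mul_inv_cancel₀ this, one_smul]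
  obtain ⟨B, hB, hA⟩ := key
  have h1 : adjL A = ‖A‖ ^ (Module.finrank ℝ E - 1) • adjL B := by
    conv_lhs => rw [hA]
    rw [adjL_smul]
  rw [h1, norm_smul, norm_pow, norm_norm, mul_comm]
  gcongr
  exact hC B (by simpa using hB)

theorem det_pos_of_norm_lt (M : E →L[ℝ] E) (s : ℝ) (h : ‖M‖ < s) :
    0 < (s • ContinuousLinearMap.id ℝ (E) + M).det := by
  have hs : 0 < s := (norm_nonneg _).trans_lt h
  let g : ℝ → ℝ := fun t => (s • ContinuousLinearMap.id ℝ (E) + t • M).det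
  have hg : Continuous g := continuous_detL.comp (by fun_prop)
  have hne : ∀ t ∈ Icc (0:ℝ) 1, g t ≠ 0 := by
    intro t ht h0
    have hni : ¬ Function.Injective (s • ContinuousLinearMap.id ℝ (E) + t • M) := by
      intro hi
      have : LinearMap.det ((s • ContinuousLinearMap.id ℝ (E) + t • M : E →L[ℝ] E) : E →ₗ[ℝ] E) ≠ 0 := by
        have := (LinearEquiv.ofInjectiveEndo _ hi).isUnit_det'
        exact this.ne_zero
      exact this h0
    apply hni
    rw [injective_iff_map_eq_zero]
    intro v hv
    by_contra hv0
    have hv1 : 0 < ‖v‖ := norm_pos_iff.2 hv0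
    have e : s • v = -(t • M v) := by
      have : s • v + t • M v = 0 := by simpa using hv
      exact eq_neg_of_add_eq_zero_left this
    have e2 : s * ‖v‖ ≤ ‖M‖ * ‖v‖ := by
      calc s * ‖v‖ = ‖s • v‖ := by rw [norm_smul, Real.norm_of_nonneg hs.le]
        _ = t * ‖M v‖ := by rw [e, norm_neg, norm_smul, Real.norm_of_nonneg ht.1]
        _ ≤ 1 * (‖M‖ * ‖v‖) := mul_le_mul ht.2 (M.le_opNorm v) (norm_nonneg _) zero_le_one
        _ = _ := one_mul _
    nlinarith
  have h0 : 0 < g 0 := by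
    simp [g, ContinuousLinearMap.det, hs]
  by_contra hcon
  have hcon' : g 1 ≤ 0 := by simpa [g] using hcon
  obtain ⟨t, ht, hgt⟩ := intermediate_value_Icc' (zero_le_one) hg.continuousOn ⟨hcon', h0.le⟩
  exact hne t ht hgt

theorem perturb_bijective (F : E → E) (C : ℝ≥0) (hF : LipschitzWith C F) (s : ℝ) (hs : (C:ℝ) < s) :
    Function.Bijective (fun x => s • x + F x) := by
  have hs0 : 0 < s := C.2.trans_lt hs
  have key : ∀ y, ContractingWith (C / s.toNNReal) (fun x => s⁻¹ • (y - F x)) := by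
    intro y
    constructor
    · rw [div_lt_one (by simpa using hs0)]
      exact Real.lt_toNNReal_iff_coe_lt.2 hs
    · refine LipschitzWith.of_dist_le_mul fun a b => ?_
      rw [dist_smul₀, dist_sub_left, norm_inv, Real.norm_of_nonneg hs0.le]
      have := hF.dist_le_mul a b
      push_cast
      rw [Real.coe_toNNReal _ hs0.le, div_eq_inv_mul, mul_assoc]
      gcongr
  have eqv : ∀ x y, s • x + F x = y ↔ Function.IsFixedPt (fun x => s⁻¹ • (y - F x)) x := by
    intro x y
    rw [Function.IsFixedPt, inv_smul_eq_iff₀ hs0.ne', sub_eq_iff_eq_add, eq_comm]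
  constructor
  · intro a b hab
    have ha := (eqv a _).1 rfl
    have hb := (eqv b _).1 hab.symm
    exact (key _).fixedPoint_unique' ha hb
  · intro y
    exact ⟨(key y).fixedPoint, (eqv _ _).2 (key y).fixedPoint_isFixedPt⟩

theorem det_interp (E : Type*) [NormedAddCommGroup E] [NormedSpace ℝ E] [FiniteDimensional ℝ E] (c : ℝ) : ∃ b : ℕ → ℝ, (∀ M : E →L[ℝ] E,
    M.det = ∑ i ∈ Finset.range (Module.finrank ℝ E + 1), b i * ((c + i) • ContinuousLinearMap.id ℝ (E) + M).det) := by
  refine ⟨fun i => (Lagrange.basis (Finset.range (Module.finrank ℝ E + 1)) (fun j : ℕ => c + j) i).eval 0, fun M => ?_⟩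
  let P := (-(matL M)).charpoly
  have hP : ∀ s, P.eval s = (s • ContinuousLinearMap.id ℝ (E) + M).det := by
    intro s
    rw [Matrix.eval_charpoly, ← det_matL]
    have e : matL (s • ContinuousLinearMap.id ℝ E + M) = s • 1 + matL M := by
      rw [← matL_id, ← matL_smul]; simp [matL]
    rw [e]
    congr 1
    ext i j
    simp [Matrix.diagonal_apply, Matrix.one_apply]
  have hdeg : P.degree < (Finset.range (Module.finrank ℝ E + 1)).card := by
    rw [Matrix.charpoly_degree_eq_dim]
    simp; exact_mod_cast Nat.lt_succ_self _
  have h := Lagrange.eq_interpolate (s := Finset.range (Module.finrank ℝ E + 1)) (v := fun j : ℕ => c + j)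
    (by intro a _ b _ h; have h' : c + (a:ℝ) = c + b := h; exact_mod_cast add_left_cancel h') hdeg
  have h2 : P.eval 0 = M.det := by rw [hP]; simp
  rw [← h2, h, Lagrange.interpolate_apply, Polynomial.eval_finsetSum]
  refine Finset.sum_congr rfl fun i _ => ?_
  rw [Polynomial.eval_mul, Polynomial.eval_C, ← hP, mul_comm]

theorem det_smul_id (s : ℝ) : (s • ContinuousLinearMap.id ℝ (E)).det = s ^ (Module.finrank ℝ E) := by
  simp [ContinuousLinearMap.det]

end M1b

section M2a
variable {E : Type*} [NormedAddCommGroup E] [NormedSpace ℝ E] [FiniteDimensional ℝ E] [MeasureSpace E] [BorelSpace E]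
  [(volume : Measure E).IsAddHaarMeasure]

theorem integral_det_fderiv_eq_zero (hn : 0 < Module.finrank ℝ E) (F : E → E) (hF : ContDiff ℝ 1 F)
    (hc : HasCompactSupport F) : ∫ x, (fderiv ℝ F x).det = 0 := by
  have hcD : Continuous (fderiv ℝ F) := hF.continuous_fderiv one_ne_zero
  obtain ⟨C0, hC0⟩ := (hc.fderiv (𝕜 := ℝ)).exists_bound_of_continuous hcD
  set C : ℝ≥0 := C0.toNNReal
  have hCb : ∀ x, ‖fderiv ℝ F x‖ ≤ C := fun x => (hC0 x).trans (Real.le_coe_toNNReal _)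
  have hLip : LipschitzWith C F :=
    lipschitzWith_of_nnnorm_fderiv_le (hF.differentiable one_ne_zero) (fun x => by exact_mod_cast hCb x)
  obtain ⟨r, hr0, hr⟩ : ∃ r > 0, tsupport F ⊆ ball 0 r := by
    obtain ⟨r, hr⟩ := hc.isBounded.subset_ball 0
    exact ⟨max r 1, by positivity, hr.trans (ball_subset_ball (le_max_left _ _))⟩
  have hFout : ∀ x, x ∉ ball (0 : E) r → F x = 0 := fun x hx =>
    image_eq_zero_of_notMem_tsupport fun h => hx (hr h)
  have hDout : ∀ x, x ∉ ball (0 : E) r → fderiv ℝ F x = 0 := fun x hx =>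
    image_eq_zero_of_notMem_tsupport fun h => hx (hr (tsupport_fderiv_subset ℝ h))
  have hdet0 : (0 : E →L[ℝ] E).det = 0 := by
    have := det_smul_id (E := E) 0
    rw [zero_smul, zero_pow hn.ne'] at this
    exact this
  have key : ∀ s : ℝ, (C:ℝ) < s → ∫ x in ball (0 : E) r, (s • ContinuousLinearMap.id ℝ (E) + fderiv ℝ F x).det
      = s ^ (Module.finrank ℝ E) * (volume (ball (0 : E) r)).toReal := by
    intro s hs
    have hs0 : 0 < s := C.2.trans_lt hs
    have hbij := perturb_bijective F C hLip s hs
    have himg : (fun x => s • x + F x) '' ball (0 : E) r = ball 0 (s * r) := by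
      have hcompl : (fun x => s • x + F x) '' (ball (0 : E) r)ᶜ = (ball 0 (s * r))ᶜ := by
        ext y
        constructor
        · rintro ⟨x, hx, rfl⟩
          have := hFout x hx
          simp only [this, add_zero, mem_compl_iff, mem_ball_zero_iff, not_lt, norm_smul, Real.norm_of_nonneg hs0.le] at hx ⊢
          gcongr
        · intro hy
          have hx : s⁻¹ • y ∈ (ball (0 : E) r)ᶜ := by
            simp only [mem_compl_iff, mem_ball_zero_iff, not_lt, norm_smul, norm_inv, Real.norm_of_nonneg hs0.le] at hy ⊢
            rwa [le_inv_mul_iff₀ hs0]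
          refine ⟨s⁻¹ • y, hx, ?_⟩
          simp [hFout _ hx, smul_smul, hs0.ne']
      rw [← compl_inj_iff, ← image_compl_eq hbij, hcompl]
    have hder : ∀ x ∈ ball (0 : E) r, HasFDerivWithinAt (fun x => s • x + F x)
        (s • ContinuousLinearMap.id ℝ (E) + fderiv ℝ F x) (ball 0 r) x := by
      intro x _
      exact (((hasFDerivAt_id x).const_smul s).add ((hF.differentiable one_ne_zero x).hasFDerivAt)).hasFDerivWithinAt
    have hcv := integral_image_eq_integral_abs_det_fderiv_smul volume measurableSet_ball hder hbij.1.injOn (fun _ => (1:ℝ))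
    rw [himg] at hcv
    simp only [smul_eq_mul, mul_one, integral_const] at hcv
    have e1 : ∫ x in ball (0 : E) r, (s • ContinuousLinearMap.id ℝ (E) + fderiv ℝ F x).det =
      ∫ x in ball (0 : E) r, |(s • ContinuousLinearMap.id ℝ (E) + fderiv ℝ F x).det| := by
      refine integral_congr_ae (Eventually.of_forall fun x => ?_)
      exact (abs_of_pos (det_pos_of_norm_lt _ _ ((hCb x).trans_lt hs))).symm
    rw [e1, ← hcv, Measure.real, Measure.restrict_apply_univ, Measure.addHaar_ball_mul_of_pos _ _ hs0,
      Measure.addHaar_ball_center, ENNReal.toReal_mul, ENNReal.toReal_ofReal (by positivity)]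
  obtain ⟨b, hb⟩ := det_interp E (C + 1)
  have hsplit : ∫ x, (fderiv ℝ F x).det = ∫ x in ball (0 : E) r, (fderiv ℝ F x).det := by
    refine (setIntegral_eq_integral_of_forall_compl_eq_zero fun x hx => ?_).symm
    rw [hDout x hx, hdet0]
  rw [hsplit]
  have hint : ∀ s : ℝ, IntegrableOn (fun x => (s • ContinuousLinearMap.id ℝ (E) + fderiv ℝ F x).det) (ball (0 : E) r) := by
    intro s
    have : Continuous (fun x => (s • ContinuousLinearMap.id ℝ (E) + fderiv ℝ F x).det) :=
      continuous_detL.comp (by fun_prop)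
    exact (this.continuousOn.integrableOn_compact (isCompact_closedBall 0 r)).mono_set ball_subset_closedBall
  simp_rw [fun x => hb (fderiv ℝ F x)]
  rw [integral_finsetSum _ fun i _ => (hint _).const_mul _]
  simp_rw [integral_const_mul]
  have h0 := hb 0
  rw [hdet0] at h0
  simp_rw [add_zero, det_smul_id] at h0
  have : ∀ i ∈ Finset.range (Module.finrank ℝ E + 1), b i * ∫ x in ball (0 : E) r, (((C:ℝ) + 1 + i) • ContinuousLinearMap.id ℝ (E) + fderiv ℝ F x).det
      = (b i * ((C:ℝ) + 1 + i) ^ (Module.finrank ℝ E)) * (volume (ball (0 : E) r)).toReal := by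
    intro i _
    rw [key _ (by linarith [(Nat.cast_nonneg i : (0:ℝ) ≤ i)]), mul_assoc]
  rw [Finset.sum_congr rfl this, ← Finset.sum_mul, ← h0, zero_mul]

theorem integral_fderiv_adjL_eq_zero (hn : 0 < Module.finrank ℝ E) (F : E → E) (hF : ContDiff ℝ 1 F)
    (hc : HasCompactSupport F) (w : E → ℝ) (hw : ContDiff ℝ 1 w) (hwc : HasCompactSupport w) (v : E) :
    ∫ x, fderiv ℝ w x (adjL (fderiv ℝ F x) v) = 0 := by
  have h1 := integral_det_fderiv_eq_zero hn F hF hc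
  have h2 := integral_det_fderiv_eq_zero hn (fun x => F x + w x • v) (hF.add (hw.smul contDiff_const))
    (hc.add (hwc.smul_right))
  have hcD : Continuous (fderiv ℝ F) := hF.continuous_fderiv one_ne_zero
  have hcw : Continuous (fderiv ℝ w) := hw.continuous_fderiv one_ne_zero
  have e : ∀ x, fderiv ℝ (fun x => F x + w x • v) x = fderiv ℝ F x + (fderiv ℝ w x).smulRight v := by
    intro x
    exact ((hF.differentiable one_ne_zero x).hasFDerivAt.add
      ((hw.differentiable one_ne_zero x).hasFDerivAt.smul_const v)).fderiv
  simp_rw [e, det_add_smulRight] at h2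
  have hdet0 : (0 : E →L[ℝ] E).det = 0 := by
    have := det_smul_id (E := E) 0
    rw [zero_smul, zero_pow hn.ne'] at this
    exact this
  rw [integral_add, h1, zero_add] at h2
  · exact h2
  · refine (continuous_detL.comp hcD).integrable_of_hasCompactSupport ?_
    exact (hc.fderiv (𝕜 := ℝ)).comp_left (g := fun A : E →L[ℝ] E => A.det) hdet0
  · refine Continuous.integrable_of_hasCompactSupport ?_ ?_
    · exact hcw.clm_apply ((continuous_adjL.comp hcD).clm_apply continuous_const)
    · refine (hwc.fderiv (𝕜 := ℝ)).mono ?_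
      intro x hx
      contrapose hx
      simp only [Function.mem_support, not_not] at hx ⊢
      simp [hx]

end M2a

section M2b
variable {E : Type*} [NormedAddCommGroup E] [NormedSpace ℝ E] [FiniteDimensional ℝ E] [MeasureSpace E] [BorelSpace E]
  [(volume : Measure E).IsAddHaarMeasure]

/-- The integrand of `UD`. -/
noncomputable def UDi (f : E → E) (G : E → E →L[ℝ] E) (Φ : E → ℝ) (η : E → ℝ) (y x : E) : E →L[ℝ] ℝ :=
  η (y - f x) • (fderiv ℝ Φ x).comp (adjL (G x))

noncomputable def UD (f : E → E) (G : E → E →L[ℝ] E) (Φ : E → ℝ) (η : E → ℝ) (y : E) : E →L[ℝ] ℝ :=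
  ∫ x, UDi f G Φ η y x

theorem UDi_smooth_cont (F : E → E) (hF : ContDiff ℝ 1 F)
    (Φ : E → ℝ) (hΦ : ContDiff ℝ 1 Φ) (η : E → ℝ) (hη : Continuous η) (y : E) :
    Continuous (UDi F (fderiv ℝ F) Φ η y) := by
  have hcD : Continuous (fderiv ℝ F) := hF.continuous_fderiv one_ne_zero
  have hcw : Continuous (fderiv ℝ Φ) := hΦ.continuous_fderiv one_ne_zero
  have := continuous_adjL.comp hcD
  unfold UDi
  exact (hη.comp (continuous_const.sub hF.continuous)).smul (hcw.clm_comp this)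

theorem UDi_smooth_integrable (F : E → E) (hF : ContDiff ℝ 1 F)
    (Φ : E → ℝ) (hΦ : ContDiff ℝ 1 Φ) (hΦc : HasCompactSupport Φ) (η : E → ℝ) (hη : Continuous η) (y : E) :
    Integrable (UDi F (fderiv ℝ F) Φ η y) := by
  refine (UDi_smooth_cont F hF Φ hΦ η hη y).integrable_of_hasCompactSupport ?_
  refine (hΦc.fderiv (𝕜 := ℝ)).mono ?_
  intro x hx
  contrapose hx
  simp only [Function.mem_support, not_not] at hx ⊢
  simp [UDi, hx]

theorem UD_smooth_apply (hn : 0 < Module.finrank ℝ E) (F : E → E) (hF : ContDiff ℝ 1 F)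
    (hc : HasCompactSupport F) (Φ : E → ℝ) (hΦ : ContDiff ℝ 1 Φ) (hΦc : HasCompactSupport Φ)
    (η : E → ℝ) (hη : ContDiff ℝ 1 η) (y v : E) :
    ∫ x, (Φ x * (fderiv ℝ F x).det) * fderiv ℝ η (y - F x) v = UD F (fderiv ℝ F) Φ η y v := by
  have hcD : Continuous (fderiv ℝ F) := hF.continuous_fderiv one_ne_zero
  have hcη : Continuous (fderiv ℝ η) := hη.continuous_fderiv one_ne_zero
  have hηF : ContDiff ℝ 1 (fun x => η (y - F x)) := hη.comp (contDiff_const.sub hF)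
  have h := integral_fderiv_adjL_eq_zero hn F hF hc (fun x => Φ x * η (y - F x)) (hΦ.mul hηF) hΦc.mul_right v
  have e : ∀ x, fderiv ℝ (fun x => Φ x * η (y - F x)) x (adjL (fderiv ℝ F x) v)
      = UDi F (fderiv ℝ F) Φ η y x v - (Φ x * (fderiv ℝ F x).det) * fderiv ℝ η (y - F x) v := by
    intro x
    have h1 : HasFDerivAt (fun x => η (y - F x)) ((fderiv ℝ η (y - F x)).comp (-(fderiv ℝ F x))) x := by
      have := (hF.differentiable one_ne_zero x).hasFDerivAt.const_sub y
      exact ((hη.differentiable one_ne_zero (y - F x)).hasFDerivAt).comp x this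
    rw [((hΦ.differentiable one_ne_zero x).hasFDerivAt.fun_mul h1).fderiv]
    simp [UDi, comp_adjL]
    ring
  simp_rw [e] at h
  have i1 := (UDi_smooth_integrable F hF Φ hΦ hΦc η hη.continuous y)
  rw [integral_sub (i1.apply_continuousLinearMap v), sub_eq_zero] at h
  · rw [← h, UD, ContinuousLinearMap.integral_apply i1]
  · refine Continuous.integrable_of_hasCompactSupport ?_ (hΦc.mul_right.mul_right)
    exact (hΦ.continuous.mul (continuous_detL.comp hcD)).mul
      ((hcη.comp (continuous_const.sub hF.continuous)).clm_apply continuous_const)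

theorem UD_smooth_hasFDerivAt (hn : 0 < Module.finrank ℝ E) (F : E → E) (hF : ContDiff ℝ 1 F)
    (hc : HasCompactSupport F) (Φ : E → ℝ) (hΦ : ContDiff ℝ 1 Φ) (hΦc : HasCompactSupport Φ)
    (η : E → ℝ) (hη : ContDiff ℝ 1 η) (hηc : HasCompactSupport η) (y : E) :
    HasFDerivAt (fun y => ∫ x, (Φ x * (fderiv ℝ F x).det) * η (y - F x)) (UD F (fderiv ℝ F) Φ η y) y := by
  have hcD : Continuous (fderiv ℝ F) := hF.continuous_fderiv one_ne_zero
  have hcη : Continuous (fderiv ℝ η) := hη.continuous_fderiv one_ne_zero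
  have hdet : Continuous fun x => (fderiv ℝ F x).det := continuous_detL.comp hcD
  obtain ⟨C, hC⟩ := (hηc.fderiv (𝕜 := ℝ)).exists_bound_of_continuous hcη
  have hΦJ : Integrable (fun x => Φ x * (fderiv ℝ F x).det) :=
    (hΦ.continuous.mul hdet).integrable_of_hasCompactSupport hΦc.mul_right
  have hc2 : ∀ y, Continuous fun x => (Φ x * (fderiv ℝ F x).det) • fderiv ℝ η (y - F x) := fun y =>
    (hΦ.continuous.mul hdet).smul (hcη.comp (continuous_const.sub hF.continuous))
  have key := hasFDerivAt_integral_of_dominated_of_fderiv_le (𝕜 := ℝ) (μ := (volume : Measure E)) (s := univ) (x₀ := y)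
    (F := fun y x => (Φ x * (fderiv ℝ F x).det) * η (y - F x))
    (F' := fun y x => (Φ x * (fderiv ℝ F x).det) • fderiv ℝ η (y - F x))
    (bound := fun x => ‖Φ x * (fderiv ℝ F x).det‖ * C) univ_mem ?_ ?_ ?_ ?_ ?_ ?_
  · have e : UD F (fderiv ℝ F) Φ η y = ∫ x, (Φ x * (fderiv ℝ F x).det) • fderiv ℝ η (y - F x) := by
      ext v
      have : Integrable fun x => (Φ x * (fderiv ℝ F x).det) • fderiv ℝ η (y - F x) :=
        (hc2 y).integrable_of_hasCompactSupport (hΦc.mul_right.smul_right)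
      rw [ContinuousLinearMap.integral_apply this, ← UD_smooth_apply hn F hF hc Φ hΦ hΦc η hη]
      rfl
    rw [e]; exact key
  · exact Eventually.of_forall fun y => ((hΦ.continuous.mul hdet).mul
      (hη.continuous.comp (continuous_const.sub hF.continuous))).aestronglyMeasurable
  · exact ((hΦ.continuous.mul hdet).mul
      (hη.continuous.comp (continuous_const.sub hF.continuous))).integrable_of_hasCompactSupport hΦc.mul_right.mul_right
  · exact (hc2 y).aestronglyMeasurable
  · refine Eventually.of_forall fun x z _ => ?_
    rw [norm_smul]
    gcongr
    exact hC _
  · exact hΦJ.norm.mul_const C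
  · refine Eventually.of_forall fun x z _ => ?_
    have h1 : HasFDerivAt (fun z => z - F x) (ContinuousLinearMap.id ℝ E) z := (hasFDerivAt_id z).sub_const (F x)
    have h2 := ((hη.differentiable one_ne_zero (z - F x)).hasFDerivAt).comp z h1
    exact h2.const_mul _

end M2b

theorem gdct {α F : Type*} [MeasurableSpace α] {μ : Measure α} [NormedAddCommGroup F] (h : ℕ → α → F) (h0 : α → F)
    (H : ℕ → α → ℝ) (H0 : α → ℝ) (hm : ∀ k, AEStronglyMeasurable (h k) μ) (hm0 : AEStronglyMeasurable h0 μ)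
    (hH : ∀ k, Integrable (H k) μ) (hH0 : Integrable H0 μ) (hb : ∀ k, ∀ᵐ x ∂μ, ‖h k x‖ ≤ H k x)
    (hHn : ∀ᵐ x ∂μ, 0 ≤ H0 x)
    (hb0 : ∀ᵐ x ∂μ, ‖h0 x‖ ≤ H0 x) (hl : ∀ᵐ x ∂μ, Tendsto (fun k => h k x) atTop (𝓝 (h0 x)))
    (hHl : ∀ᵐ x ∂μ, Tendsto (fun k => H k x) atTop (𝓝 (H0 x)))
    (hI : Tendsto (fun k => ∫ x, H k x ∂μ) atTop (𝓝 (∫ x, H0 x ∂μ))) :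
    Tendsto (fun k => ∫ x, ‖h k x - h0 x‖ ∂μ) atTop (𝓝 0) := by
  have hp : Tendsto (fun k => ∫ x, max (H0 x - H k x) 0 ∂μ) atTop (𝓝 (∫ x, 0 ∂μ)) := by
    refine tendsto_integral_of_dominated_convergence H0 ?_ hH0 ?_ ?_
    · intro k
      exact ((hH0.sub (hH k)).aestronglyMeasurable).sup aestronglyMeasurable_const
    · intro k
      filter_upwards [hb k, hHn] with x hx hx0
      have : 0 ≤ H k x := (norm_nonneg _).trans hx
      rw [Real.norm_of_nonneg (le_max_right _ _)]
      exact max_le (by linarith) hx0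
    · filter_upwards [hHl] with x hx
      have := ((tendsto_const_nhds (x := H0 x)).sub hx).max (tendsto_const_nhds (x := (0:ℝ)))
      simpa using this
  have hsch : Tendsto (fun k => ∫ x, |H k x - H0 x| ∂μ) atTop (𝓝 0) := by
    have e : ∀ k, ∫ x, |H k x - H0 x| ∂μ = (∫ x, H k x ∂μ) - (∫ x, H0 x ∂μ) + 2 * ∫ x, max (H0 x - H k x) 0 ∂μ := by
      intro k
      have j1 : Integrable (fun x => H k x - H0 x) μ := (hH k).sub hH0
      have j2 : Integrable (fun x => 2 * max (H0 x - H k x) 0) μ := (((hH0.sub (hH k)).pos_part)).const_mul 2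
      rw [← integral_sub (hH k) hH0, ← integral_const_mul, ← integral_add j1 j2]
      · congr 1; ext x
        rcases le_total (H0 x) (H k x) with hx | hx
        · rw [abs_of_nonneg (by linarith), max_eq_right (by linarith)]; ring
        · rw [abs_of_nonpos (by linarith), max_eq_left (by linarith)]; ring
    simp_rw [e]
    have := (hI.sub_const (∫ x, H0 x ∂μ)).add (hp.const_mul 2)
    simpa using this
  have hmin : Tendsto (fun k => ∫ x, min ‖h k x - h0 x‖ (2 * H0 x) ∂μ) atTop (𝓝 (∫ x, 0 ∂μ)) := by
    refine tendsto_integral_of_dominated_convergence (fun x => 2 * H0 x) ?_ (hH0.const_mul 2) ?_ ?_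
    · intro k
      exact ((hm k).sub hm0).norm.inf (hH0.aestronglyMeasurable.const_mul 2)
    · intro k
      filter_upwards [hHn] with x hx0
      rw [Real.norm_of_nonneg (le_min (norm_nonneg _) (by linarith))]
      exact min_le_right _ _
    · filter_upwards [hl, hHn] with x hx hx0
      have h1 : Tendsto (fun k => ‖h k x - h0 x‖) atTop (𝓝 0) := by
        have := (hx.sub_const (h0 x)).norm
        simpa using this
      have := h1.min (tendsto_const_nhds (x := 2 * H0 x))
      rwa [min_eq_left (by linarith)] at this
  have hsum := hmin.add hsch
  simp only [integral_zero, add_zero] at hsum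
  have hint : ∀ k, Integrable (fun x => ‖h k x - h0 x‖) μ := by
    intro k
    refine ((hH k).add hH0).mono' ((hm k).sub hm0).norm ?_
    filter_upwards [hb k, hb0] with x hx hx0
    rw [norm_norm]
    exact (norm_sub_le _ _).trans (add_le_add hx hx0)
  refine squeeze_zero (fun k => integral_nonneg fun x => norm_nonneg _) (fun k => ?_) hsum
  have i1 : Integrable (fun x => min ‖h k x - h0 x‖ (2 * H0 x)) μ := (hint k).inf (hH0.const_mul 2)
  have i2 : Integrable (fun x => |H k x - H0 x|) μ := ((hH k).sub hH0).abs
  rw [← integral_add i1 i2]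
  refine integral_mono_ae (hint k) (i1.add i2) ?_
  filter_upwards [hb k, hb0] with x hx hx0
  have h1 : ‖h k x - h0 x‖ ≤ H k x + H0 x := (norm_sub_le _ _).trans (add_le_add hx hx0)
  have h2 := le_abs_self (H k x - H0 x)
  have h3 := abs_nonneg (H k x - H0 x)
  rcases le_total ‖h k x - h0 x‖ (2 * H0 x) with h4 | h4
  · rw [min_eq_left h4]; linarith
  · rw [min_eq_right h4]; linarith

section M3a
variable {E : Type*} [NormedAddCommGroup E] [NormedSpace ℝ E] [FiniteDimensional ℝ E] [MeasureSpace E] [BorelSpace E]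
  [(volume : Measure E).IsAddHaarMeasure]
variable {F : Type*} [NormedAddCommGroup F] [NormedSpace ℝ F] [CompleteSpace F]
variable {F' : Type*} [NormedAddCommGroup F'] [NormedSpace ℝ F']

open ContinuousLinearMap in
noncomputable def mol (φ : ContDiffBump (0 : E)) (g : E → F) : E → F :=
  convolution (φ.normed volume) g (lsmul ℝ ℝ) volume

theorem mol_apply (φ : ContDiffBump (0 : E)) (g : E → F) (x : E) :
    mol φ g x = ∫ z, φ.normed volume (x - z) • g z := by
  unfold mol; rw [convolution_lsmul_swap]

theorem mol_cont (φ : ContDiffBump (0 : E)) (g : E → F) (hg : LocallyIntegrable g) : Continuous (mol φ g) :=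
  φ.hasCompactSupport_normed.continuous_convolution_left _ φ.continuous_normed hg

theorem mol_contDiff (φ : ContDiffBump (0 : E)) (g : E → F) (hg : LocallyIntegrable g) : ContDiff ℝ 1 (mol φ g) :=
  φ.hasCompactSupport_normed.contDiff_convolution_left (n := 1) _ φ.contDiff_normed hg

theorem mol_integrable (φ : ContDiffBump (0 : E)) (g : E → F) (hg : Integrable g) : Integrable (mol φ g) :=
  Integrable.integrable_convolution _ φ.integrable_normed hg

theorem mol_integral (φ : ContDiffBump (0 : E)) (g : E → F) (hg : Integrable g) : ∫ x, mol φ g x = ∫ x, g x := by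
  unfold mol
  rw [integral_convolution _ φ.integrable_normed hg, φ.integral_normed]
  simp

theorem mol_integrand (φ : ContDiffBump (0 : E)) (g : E → F) (hg : Integrable g) (x : E) :
    Integrable fun z => φ.normed volume (x - z) • g z := by
  obtain ⟨C, hC⟩ := (φ.hasCompactSupport_normed (μ := volume)).exists_bound_of_continuous φ.continuous_normed
  refine hg.bdd_smul C ?_ ?_
  · exact (φ.continuous_normed.comp (continuous_const.sub continuous_id)).aestronglyMeasurable
  · exact Eventually.of_forall fun z => hC _

theorem mol_jensen (φ : ContDiffBump (0 : E)) (g : E → F) (hg : Integrable g) (m : ℕ)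
    (hgm : Integrable fun x => ‖g x‖ ^ m) (x : E) :
    ‖mol φ g x‖ ^ m ≤ mol φ (fun x => ‖g x‖ ^ m) x := by
  have hφ0 : ∀ z, 0 ≤ φ.normed volume (x - z) := fun z => φ.nonneg_normed _
  have h1 : ‖mol φ g x‖ ≤ ∫ z, φ.normed volume (x - z) • ‖g z‖ := by
    rw [mol_apply]
    refine (norm_integral_le_integral_norm _).trans_eq ?_
    congr 1; ext z
    rw [norm_smul, Real.norm_of_nonneg (hφ0 z)]; rfl
  let ν : Measure E := volume.withDensity fun z => ENNReal.ofReal (φ.normed volume (x - z))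
  have hmeas : Measurable fun z => ENNReal.ofReal (φ.normed volume (x - z)) :=
    (φ.continuous_normed.comp (continuous_const.sub continuous_id)).measurable.ennreal_ofReal
  have hν : IsProbabilityMeasure ν := by
    constructor
    rw [withDensity_apply _ MeasurableSet.univ, Measure.restrict_univ, ← ofReal_integral_eq_lintegral_ofReal]
    · rw [integral_sub_left_eq_self (fun z => φ.normed volume z), φ.integral_normed, ENNReal.ofReal_one]
    · exact φ.integrable_normed.comp_sub_left x
    · exact Eventually.of_forall hφ0
  have hi : ∀ h : E → ℝ, ∫ z, h z ∂ν = ∫ z, φ.normed volume (x - z) • h z := by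
    intro h
    rw [integral_withDensity_eq_integral_toReal_smul hmeas (by simp)]
    congr 1; ext z
    rw [ENNReal.toReal_ofReal (hφ0 z)]
  have hii : ∀ h : E → ℝ, Integrable h → Integrable h ν := by
    intro h hh
    rw [integrable_withDensity_iff_integrable_smul' hmeas (by simp)]
    refine (mol_integrand φ h hh x).congr (Eventually.of_forall fun z => ?_)
    simp only [ENNReal.toReal_ofReal (hφ0 z)]
  have h2 := (convexOn_pow (𝕜 := ℝ) m).map_integral_le (μ := ν) (f := fun z => ‖g z‖) (continuous_pow m).continuousOn
    isClosed_Ici (Eventually.of_forall fun z => norm_nonneg _) (hii _ hg.norm) (hii _ hgm)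
  rw [hi] at h2
  calc ‖mol φ g x‖ ^ m ≤ (∫ z, φ.normed volume (x - z) • ‖g z‖) ^ m := by gcongr
    _ ≤ _ := h2
    _ = _ := by rw [hi, mol_apply]

/-- A standard sequence of bumps. -/
noncomputable def bseq (k : ℕ) : ContDiffBump (0 : E) where
  rIn := 1 / (k + 1) / 2
  rOut := 1 / (k + 1)
  rIn_pos := by positivity
  rIn_lt_rOut := by
    have : (0:ℝ) < 1 / (k + 1) := by positivity
    linarith

theorem bseq_rOut (k : ℕ) : (bseq (E := E) k).rOut = 1 / (k + 1) := rfl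

theorem bseq_tendsto : Tendsto (fun k => (bseq (E := E) k).rOut) atTop (𝓝 0) :=
  tendsto_one_div_add_atTop_nhds_zero_nat

theorem mol_ae (g : E → F) (hg : LocallyIntegrable g) :
    ∀ᵐ x, Tendsto (fun k => mol (bseq k) g x) atTop (𝓝 (g x)) := by
  refine ContDiffBump.ae_convolution_tendsto_right_of_locallyIntegrable (K := 2) bseq_tendsto ?_ hg
  refine Eventually.of_forall fun k => ?_
  simp only [bseq]; linarith

theorem mol_L1 (g : E → F) (hg : Integrable g) (m : ℕ) (hgm : Integrable fun x => ‖g x‖ ^ m)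
    (T : F → F') (hT : Continuous T) (C : ℝ) (hC0 : 0 ≤ C) (hTC : ∀ A, ‖T A‖ ≤ C * ‖A‖ ^ m) :
    Tendsto (fun k => ∫ x, ‖T (mol (bseq k) g x) - T (g x)‖) atTop (𝓝 0) := by
  refine gdct (fun k x => T (mol (bseq k) g x)) (fun x => T (g x))
    (fun k x => C * mol (bseq k) (fun x => ‖g x‖ ^ m) x) (fun x => C * ‖g x‖ ^ m) ?_ ?_ ?_ ?_ ?_ ?_ ?_ ?_ ?_ ?_
  · exact fun k => (hT.comp (mol_cont _ _ hg.locallyIntegrable)).aestronglyMeasurable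
  · exact hT.comp_aestronglyMeasurable hg.aestronglyMeasurable
  · exact fun k => (mol_integrable _ _ hgm).const_mul C
  · exact hgm.const_mul C
  · refine fun k => Eventually.of_forall fun x => (hTC _).trans ?_
    gcongr
    exact mol_jensen _ g hg m hgm x
  · exact Eventually.of_forall fun x => by positivity
  · exact Eventually.of_forall fun x => hTC _
  · filter_upwards [mol_ae g hg.locallyIntegrable] with x hx
    exact (hT.tendsto _).comp hx
  · filter_upwards [mol_ae _ hgm.locallyIntegrable] with x hx
    exact hx.const_mul C
  · simp_rw [integral_const_mul, fun k => mol_integral (bseq k) _ hgm]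
    exact tendsto_const_nhds

end M3a

section M3b
universe u
variable {E : Type u} [NormedAddCommGroup E] [NormedSpace ℝ E] [FiniteDimensional ℝ E] [MeasureSpace E] [BorelSpace E]
  [(volume : Measure E).IsAddHaarMeasure]

theorem ind_int {F : Type*} [NormedAddCommGroup F] (g : E → F) {K : Set E} (hK : MeasurableSet K)
    (hg : IntegrableOn g K) : Integrable (K.indicator g) := hg.integrable_indicator hK

/-- abstract weak derivative -/
structure WD (D : Set E) (f : E → E) (G : E → E →L[ℝ] E) : Prop where
  op : IsOpen D
  cont : ContinuousOn f D
  li : LocallyIntegrableOn G D volume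
  wk : ∀ ψ : E → ℝ, ContDiff ℝ (⊤ : ℕ∞) ψ → HasCompactSupport ψ → tsupport ψ ⊆ D →
    ∀ v : E, ∫ x, ψ x • G x v = - ∫ x, fderiv ℝ ψ x v • f x

theorem WD.intOn {D : Set E} {f : E → E} {G : E → E →L[ℝ] E} (h : WD D f G) {K : Set E} (hK : IsCompact K)
    (hKD : K ⊆ D) : IntegrableOn G K := h.li.integrableOn_compact_subset hKD hK

theorem WD.intOnf {D : Set E} {f : E → E} {G : E → E →L[ℝ] E} (h : WD D f G) {K : Set E} (hK : IsCompact K)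
    (hKD : K ⊆ D) : IntegrableOn f K := (h.cont.mono hKD).integrableOn_compact hK

theorem fderiv_mol {D : Set E} {f : E → E} {G : E → E →L[ℝ] E} (h : WD D f G) {K : Set E} (hK : IsCompact K)
    (hKD : K ⊆ D) (φ : ContDiffBump (0 : E)) (x : E) (hx : closedBall x φ.rOut ⊆ K) :
    fderiv ℝ (mol φ (K.indicator f)) x = mol φ (K.indicator G) x := by
  have hfi : Integrable (K.indicator f) := (h.intOnf hK hKD).integrable_indicator hK.measurableSet
  have hGi : Integrable (K.indicator G) := ind_int G hK.measurableSet (h.intOn hK hKD)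
  have hd := (φ.hasCompactSupport_normed (μ := volume)).hasFDerivAt_convolution_left
    (ContinuousLinearMap.lsmul ℝ ℝ : ℝ →L[ℝ] E →L[ℝ] E) (φ.contDiff_normed (n := 1)) hfi.locallyIntegrable x
  have hd' := hd.fderiv
  unfold mol
  rw [hd']
  set ψ : E → ℝ := fun z => φ.normed volume (x - z) with hψ
  have hψs : ContDiff ℝ (⊤ : ℕ∞) ψ := φ.contDiff_normed.comp (contDiff_const.sub contDiff_id)
  have hψt : tsupport ψ ⊆ closedBall x φ.rOut := by
    refine closure_minimal ?_ isClosed_closedBall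
    intro z hz
    have : x - z ∈ Function.support (φ.normed volume) := hz
    rw [φ.support_normed_eq] at this
    rw [mem_closedBall, dist_comm, dist_eq_norm]
    rw [mem_ball_zero_iff] at this
    exact this.le
  have hψc : HasCompactSupport ψ := HasCompactSupport.of_support_subset_isCompact (isCompact_closedBall x φ.rOut)
    ((subset_tsupport _).trans hψt)
  have hψd : ∀ z v, fderiv ℝ ψ z v = - fderiv ℝ (φ.normed volume) (x - z) v := by
    intro z v
    have h1 : HasFDerivAt (φ.normed volume) (fderiv ℝ (φ.normed volume) (x - z)) (x - z) :=
      ((φ.contDiff_normed (n := 1)).differentiable one_ne_zero _).hasFDerivAt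
    have h2 : HasFDerivAt (fun z : E => x - z) (-ContinuousLinearMap.id ℝ E) z := (hasFDerivAt_id z).const_sub x
    have h3 : HasFDerivAt ψ _ z := h1.comp z h2
    rw [h3.fderiv]
    simp
  ext v
  have e1 : (convolution (fderiv ℝ (φ.normed volume)) (K.indicator f)
      (ContinuousLinearMap.precompL E (ContinuousLinearMap.lsmul ℝ ℝ : ℝ →L[ℝ] E →L[ℝ] E)) volume x) v
      = ∫ z, fderiv ℝ (φ.normed volume) (x - z) v • K.indicator f z := by
    have : ConvolutionExistsAt (fderiv ℝ (φ.normed volume)) (K.indicator f) x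
        (ContinuousLinearMap.precompL E (ContinuousLinearMap.lsmul ℝ ℝ : ℝ →L[ℝ] E →L[ℝ] E)) volume :=
      ((φ.hasCompactSupport_normed (μ := volume)).fderiv (𝕜 := ℝ)).convolutionExists_left _
        ((φ.contDiff_normed (n := 1)).continuous_fderiv one_ne_zero) hfi.locallyIntegrable x
    rw [convolution_eq_swap, ContinuousLinearMap.integral_apply]
    · rfl
    · exact this.integrable_swap
  have e2 : (convolution (φ.normed volume) (K.indicator G) (ContinuousLinearMap.lsmul ℝ ℝ) volume x) v
      = ∫ z, ψ z • K.indicator G z v := by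
    have := mol_apply φ (K.indicator G) x
    unfold mol at this
    rw [this, ContinuousLinearMap.integral_apply (mol_integrand φ _ hGi x)]
    rfl
  rw [e1, e2]
  have e3 : ∀ z, ψ z • K.indicator G z v = ψ z • G z v := by
    intro z
    by_cases hz : z ∈ K
    · rw [indicator_of_mem hz]
    · have : ψ z = 0 := image_eq_zero_of_notMem_tsupport fun h' => hz (hx (hψt h'))
      rw [this, zero_smul, zero_smul]
  have e4 : ∀ z, fderiv ℝ (φ.normed volume) (x - z) v • K.indicator f z = - (fderiv ℝ ψ z v • f z) := by
    intro z
    rw [← neg_smul, hψd, neg_neg]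
    by_cases hz : z ∈ K
    · rw [indicator_of_mem hz]
    · have : fderiv ℝ ψ z = 0 := image_eq_zero_of_notMem_tsupport fun h' => hz (hx (hψt (tsupport_fderiv_subset ℝ h')))
      have h2 := hψd z v
      rw [this] at h2
      have h3 : fderiv ℝ (φ.normed volume) (x - z) v = 0 := by
        rw [← neg_eq_zero, ← h2]; rfl
      rw [h3, zero_smul, zero_smul]
  simp_rw [e3, e4]
  rw [h.wk ψ hψs hψc ((hψt.trans hx).trans hKD) v, integral_neg]

theorem exists_approx {D : Set E} {f : E → E} {G : E → E →L[ℝ] E} (h : WD D f G) {K S : Set E} (hK : IsCompact K)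
    (hKD : K ⊆ D) (hS : IsCompact S) (hSK : S ⊆ interior K) :
    ∃ F : ℕ → E → E, (∀ k, ContDiff ℝ 1 (F k)) ∧ (∀ k, HasCompactSupport (F k)) ∧
      TendstoUniformlyOn F f atTop S ∧
      (∀ (F' : Type u) [NormedAddCommGroup F'] [NormedSpace ℝ F'] (m : ℕ) (T : (E →L[ℝ] E) → F') (C : ℝ),
        IntegrableOn (fun x => ‖G x‖ ^ m) K → m ≠ 0 → Continuous T →
        0 ≤ C → (∀ A, ‖T A‖ ≤ C * ‖A‖ ^ m) → Tendsto (fun k => ∫ x in S, ‖T (fderiv ℝ (F k) x) - T (G x)‖) atTop (𝓝 0)) := by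
  have hfi : Integrable (K.indicator f) := (h.intOnf hK hKD).integrable_indicator hK.measurableSet
  have hGi : Integrable (K.indicator G) := ind_int G hK.measurableSet (h.intOn hK hKD)
  obtain ⟨δ, hδ, hδK⟩ := hS.exists_cthickening_subset_open isOpen_interior hSK
  have hball : ∀ x ∈ S, ∀ r ≤ δ, closedBall x r ⊆ K := fun x hx r hr =>
    ((closedBall_subset_closedBall hr).trans (closedBall_subset_cthickening hx δ)).trans (hδK.trans interior_subset)
  have hev : ∀ᶠ k in atTop, (bseq (E := E) k).rOut ≤ δ := (bseq_tendsto (E := E)).eventually_le_const hδ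
  obtain ⟨N, hN⟩ := eventually_atTop.1 hev
  refine ⟨fun k => mol (bseq (k + N)) (K.indicator f), fun k => mol_contDiff _ _ hfi.locallyIntegrable, fun k => ?_, ?_, ?_⟩
  · unfold mol
    exact HasCompactSupport.convolution _ ((bseq (k + N)).hasCompactSupport_normed)
      (HasCompactSupport.of_support_subset_isCompact hK support_indicator_subset)
  · rw [Metric.tendstoUniformlyOn_iff]
    intro ε hε
    have huc := hK.uniformContinuousOn_of_continuous (h.cont.mono hKD)
    rw [Metric.uniformContinuousOn_iff] at huc
    obtain ⟨d, hd, hd'⟩ := huc (ε / 2) (half_pos hε)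
    have hev2 : ∀ᶠ k in atTop, (bseq (E := E) (k + N)).rOut ≤ d :=
      ((bseq_tendsto (E := E)).comp (tendsto_add_atTop_nat N)).eventually_le_const hd
    filter_upwards [hev2] with k hk x hx
    have hxK : x ∈ K := hball x hx 0 hδ.le (by simp)
    have := (bseq (E := E) (k + N)).dist_normed_convolution_le (μ := volume) (g := K.indicator f) (x₀ := x) (ε := ε / 2)
      hfi.aestronglyMeasurable (by
        intro z hz
        have hzK : z ∈ K := hball x hx _ (hN (k + N) (by omega)) (ball_subset_closedBall hz)
        rw [indicator_of_mem hzK, indicator_of_mem hxK]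
        exact (hd' z hzK x hxK (lt_of_lt_of_le hz hk)).le)
    rw [indicator_of_mem hxK, dist_comm] at this
    exact this.trans_lt (by linarith)
  · intro F' _ _ m T C hGm hm hT hC0 hTC
    have hi : Integrable (fun x => ‖K.indicator G x‖ ^ m) := by
      have h1 := ind_int (fun x => ‖G x‖ ^ m) hK.measurableSet hGm
      refine h1.congr (Eventually.of_forall fun x => ?_)
      by_cases hx : x ∈ K
      · simp only [indicator_of_mem hx]
      · simp only [indicator_of_notMem hx, norm_zero, zero_pow hm]
    have hi2 : ∀ k, Integrable (fun x => T (mol (bseq k) (K.indicator G) x)) := fun k => by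
      refine ((mol_integrable (bseq k) _ hi).const_mul C).mono'
        (hT.comp (mol_cont _ _ hGi.locallyIntegrable)).aestronglyMeasurable ?_
      refine Eventually.of_forall fun x => (hTC _).trans ?_
      gcongr
      exact mol_jensen _ _ hGi m hi x
    have hi3 : Integrable (fun x => T (K.indicator G x)) := by
      refine (hi.const_mul C).mono' (hT.comp_aestronglyMeasurable hGi.aestronglyMeasurable) ?_
      exact Eventually.of_forall fun x => hTC _
    have h0 := (mol_L1 (K.indicator G) hGi m hi T hT C hC0 hTC).comp (tendsto_add_atTop_nat N)
    refine squeeze_zero (fun k => integral_nonneg fun x => norm_nonneg _) (fun k => ?_) h0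
    have e : ∫ x in S, ‖T (fderiv ℝ (mol (bseq (k + N)) (K.indicator f)) x) - T (G x)‖ =
        ∫ x in S, ‖T (mol (bseq (k + N)) (K.indicator G) x) - T (K.indicator G x)‖ := by
      refine setIntegral_congr_fun hS.measurableSet fun x hx => ?_
      have hxK : x ∈ K := hball x hx 0 hδ.le (by simp)
      rw [fderiv_mol h hK hKD _ x (hball x hx _ (hN (k + N) (by omega))), indicator_of_mem hxK]
    simp only [Function.comp]
    rw [e]
    have hi4 : Integrable (fun x => ‖T (mol (bseq (k + N)) (K.indicator G) x) - T (K.indicator G x)‖) :=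
      ((hi2 (k + N)).sub hi3).norm
    exact setIntegral_le_integral hi4 (Eventually.of_forall fun x => norm_nonneg _)
end M3b

section M3c
universe u
variable {E : Type u} [NormedAddCommGroup E] [NormedSpace ℝ E] [FiniteDimensional ℝ E] [MeasureSpace E] [BorelSpace E]
  [(volume : Measure E).IsAddHaarMeasure]

theorem int_of_supp {F : Type*} [NormedAddCommGroup F] (g : E → F) {S : Set E} (hs : ∀ x ∉ S, g x = 0)
    (hg : IntegrableOn g S) : Integrable g :=
  (integrableOn_iff_integrable_of_support_subset fun x hx => by
    by_contra h'; exact hx (hs x h')).1 hg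

structure GD (D : Set E) (f : E → E) (G : E → E →L[ℝ] E) (K : Set E) : Prop extends WD D f G where
  dim : 2 ≤ Module.finrank ℝ E
  cpt : IsCompact K
  sub : K ⊆ D
  int : IntegrableOn (fun x => ‖G x‖ ^ (Module.finrank ℝ E - 1)) K

structure Tst (K : Set E) (Φ : E → ℝ) : Prop where
  cd : ContDiff ℝ 1 Φ
  cs : HasCompactSupport Φ
  ts : tsupport Φ ⊆ interior K

theorem GD.adj_int {D : Set E} {f : E → E} {G : E → E →L[ℝ] E} {K : Set E} (h : GD D f G K) :
    IntegrableOn (fun x => adjL (G x)) K := by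
  obtain ⟨C, hC0, hC⟩ := exists_adjL_bound E
  exact (h.int.const_mul C).mono' (continuous_adjL.comp_aestronglyMeasurable
    (h.toWD.intOn h.cpt h.sub).aestronglyMeasurable) (Eventually.of_forall fun x => hC _)

theorem UDi_zero (f : E → E) (G : E → E →L[ℝ] E) (Φ : E → ℝ) (η : E → ℝ) (y x : E) (hx : x ∉ tsupport Φ) :
    UDi f G Φ η y x = 0 := by
  have : fderiv ℝ Φ x = 0 := image_eq_zero_of_notMem_tsupport fun h' => hx (tsupport_fderiv_subset ℝ h')
  unfold UDi
  rw [this]; simp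

theorem UD_eq_set (f : E → E) (G : E → E →L[ℝ] E) (Φ : E → ℝ) (η : E → ℝ) (y : E) {S : Set E} (hS : tsupport Φ ⊆ S) :
    UD f G Φ η y = ∫ x in S, UDi f G Φ η y x := by
  unfold UD
  rw [setIntegral_eq_integral_of_forall_compl_eq_zero]
  exact fun x hx => UDi_zero _ _ _ _ _ _ fun h => hx (hS h)

theorem GD.UDi_meas {D : Set E} {f : E → E} {G : E → E →L[ℝ] E} {K : Set E} (h : GD D f G K) {Φ : E → ℝ} (hΦ : Tst K Φ)
    {η : E → ℝ} (hη : Continuous η) (y : E) : AEStronglyMeasurable (UDi f G Φ η y) (volume.restrict (tsupport Φ)) := by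
  have hSK : tsupport Φ ⊆ K := hΦ.ts.trans interior_subset
  have m1 : AEStronglyMeasurable f (volume.restrict (tsupport Φ)) :=
    ((h.cont.mono (hSK.trans h.sub)).aestronglyMeasurable_of_isCompact hΦ.cs hΦ.cs.measurableSet)
  have m2 : AEStronglyMeasurable (fun x => η (y - f x)) (volume.restrict (tsupport Φ)) :=
    (hη.comp (continuous_const.sub continuous_id)).comp_aestronglyMeasurable m1
  have m3 : AEStronglyMeasurable (fun x => adjL (G x)) (volume.restrict (tsupport Φ)) :=
    (h.adj_int.mono_set hSK).aestronglyMeasurable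
  have m4 : AEStronglyMeasurable (fderiv ℝ Φ) (volume.restrict (tsupport Φ)) :=
    (hΦ.cd.continuous_fderiv one_ne_zero).aestronglyMeasurable
  have hcc : Continuous fun p : (E →L[ℝ] ℝ) × (E →L[ℝ] E) => p.1.comp p.2 := by fun_prop
  exact m2.smul (hcc.comp_aestronglyMeasurable (m4.prodMk m3))

theorem UDi_norm_le (f : E → E) (G : E → E →L[ℝ] E) (Φ : E → ℝ) (η : E → ℝ) (y x : E) :
    ‖UDi f G Φ η y x‖ ≤ |η (y - f x)| * (‖fderiv ℝ Φ x‖ * ‖adjL (G x)‖) := by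
  unfold UDi
  rw [norm_smul, Real.norm_eq_abs]
  gcongr
  exact ContinuousLinearMap.opNorm_comp_le _ _

theorem Tst.dbound {K : Set E} {Φ : E → ℝ} (hΦ : Tst K Φ) : ∃ C, 0 ≤ C ∧ ∀ x, ‖fderiv ℝ Φ x‖ ≤ C := by
  obtain ⟨C, hC⟩ := (hΦ.cs.fderiv (𝕜 := ℝ)).exists_bound_of_continuous (hΦ.cd.continuous_fderiv one_ne_zero)
  exact ⟨C, (norm_nonneg _).trans (hC 0), hC⟩

theorem GD.UDi_int {D : Set E} {f : E → E} {G : E → E →L[ℝ] E} {K : Set E} (h : GD D f G K) {Φ : E → ℝ} (hΦ : Tst K Φ)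
    {η : E → ℝ} (hη : Continuous η) (hηc : HasCompactSupport η) (y : E) : IntegrableOn (UDi f G Φ η y) (tsupport Φ) := by
  obtain ⟨C, hC0, hC⟩ := hΦ.dbound
  obtain ⟨M, hM⟩ := hηc.exists_bound_of_continuous hη
  have hM0 : 0 ≤ M := (norm_nonneg _).trans (hM 0)
  have hSK : tsupport Φ ⊆ K := hΦ.ts.trans interior_subset
  refine ((h.adj_int.mono_set hSK).norm.const_mul (M * C)).mono' (h.UDi_meas hΦ hη y) (Eventually.of_forall fun x => ?_)
  refine (UDi_norm_le _ _ _ _ _ _).trans ?_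
  rw [mul_assoc]
  exact mul_le_mul (hM _) (by gcongr; exact hC x) (by positivity) hM0

theorem GD.UDi_int' {D : Set E} {f : E → E} {G : E → E →L[ℝ] E} {K : Set E} (h : GD D f G K) {Φ : E → ℝ} (hΦ : Tst K Φ)
    {η : E → ℝ} (hη : Continuous η) (hηc : HasCompactSupport η) (y : E) : Integrable (UDi f G Φ η y) := by
  exact int_of_supp _ (fun x hx => UDi_zero _ _ _ _ _ _ hx) (h.UDi_int hΦ hη hηc y)

theorem GD.UD_cont {D : Set E} {f : E → E} {G : E → E →L[ℝ] E} {K : Set E} (h : GD D f G K) {Φ : E → ℝ} (hΦ : Tst K Φ)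
    {η : E → ℝ} (hη : Continuous η) (hηc : HasCompactSupport η) : Continuous (UD f G Φ η) := by
  obtain ⟨C, hC0, hC⟩ := hΦ.dbound
  obtain ⟨M, hM⟩ := hηc.exists_bound_of_continuous hη
  have hM0 : 0 ≤ M := (norm_nonneg _).trans (hM 0)
  have hSK : tsupport Φ ⊆ K := hΦ.ts.trans interior_subset
  have e : UD f G Φ η = fun y => ∫ x in tsupport Φ, UDi f G Φ η y x := by
    ext1 y; exact UD_eq_set _ _ _ _ _ subset_rfl
  rw [e]
  refine continuous_of_dominated (bound := fun x => (M * C) * ‖adjL (G x)‖) (fun y => h.UDi_meas hΦ hη y)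
    (fun y => Eventually.of_forall fun x => ?_) ((h.adj_int.mono_set hSK).norm.const_mul (M * C))
    (Eventually.of_forall fun x => ?_)
  · refine (UDi_norm_le _ _ _ _ _ _).trans ?_
    rw [mul_assoc]
    exact mul_le_mul (hM _) (by gcongr; exact hC x) (by positivity) hM0
  · unfold UDi
    exact (hη.comp (continuous_id.sub continuous_const)).smul continuous_const

theorem exists_far {S : Set E} (hS : IsCompact S) (hd : 2 ≤ Module.finrank ℝ E) : ∃ y, y ∉ S := by
  by_contra hcon
  push Not at hcon
  have hu : S = univ := eq_univ_of_forall hcon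
  have : Nontrivial E := Module.nontrivial_of_finrank_pos (R := ℝ) (by omega)
  exact noncompact_univ E (hu ▸ hS)

theorem GD.exists_u {D : Set E} {f : E → E} {G : E → E →L[ℝ] E} {K : Set E} (h : GD D f G K) {Φ : E → ℝ} (hΦ : Tst K Φ)
    {η : E → ℝ} (hη : ContDiff ℝ 1 η) (hηc : HasCompactSupport η) :
    ∃ u : E → ℝ, (∀ y, HasFDerivAt u (UD f G Φ η y) y) ∧
      ∀ y, (∀ x ∈ tsupport Φ, y - f x ∉ tsupport η) → u y = 0 := by
  obtain ⟨C, hC0, hC⟩ := hΦ.dbound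
  obtain ⟨M, hM⟩ := hηc.exists_bound_of_continuous hη.continuous
  have hM0 : 0 ≤ M := (norm_nonneg _).trans (hM 0)
  have hSK : tsupport Φ ⊆ K := hΦ.ts.trans interior_subset
  obtain ⟨L, hL⟩ := hη.lipschitzWith_of_hasCompactSupport hηc one_ne_zero
  obtain ⟨Ca, hCa0, hCa⟩ := exists_adjL_bound E
  obtain ⟨F, hF1, hFc, hFu, hFT⟩ := exists_approx h.toWD h.cpt h.sub hΦ.cs hΦ.ts
  have hA := hFT _ (Module.finrank ℝ E - 1) adjL Ca h.int (by have := h.dim; omega) continuous_adjL hCa0 hCa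
  set S := tsupport Φ with hS
  set I := ∫ x in S, ‖adjL (G x)‖ with hI
  have hI0 : 0 ≤ I := integral_nonneg fun x => norm_nonneg _
  have hadj : IntegrableOn (fun x => adjL (G x)) S := h.adj_int.mono_set hSK
  have hadjF : ∀ k, IntegrableOn (fun x => adjL (fderiv ℝ (F k) x)) S := fun k =>
    (continuous_adjL.comp ((hF1 k).continuous_fderiv one_ne_zero)).continuousOn.integrableOn_compact hΦ.cs
  -- uniform convergence of derivatives
  have hunif : TendstoUniformly (fun k => UD (F k) (fderiv ℝ (F k)) Φ η) (UD f G Φ η) atTop := by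
    rw [Metric.tendstoUniformly_iff]
    intro ε hε
    have h1 : ∀ᶠ k in atTop, M * C * ∫ x in S, ‖adjL (fderiv ℝ (F k) x) - adjL (G x)‖ < ε / 2 := by
      have := hA.const_mul (M * C)
      rw [mul_zero] at this
      exact this.eventually_lt_const (half_pos hε)
    set e2 := ε / (2 * (L * C * I + 1)) with he2
    have hpos : 0 < L * C * I + 1 := by positivity
    have he2p : 0 < e2 := by positivity
    filter_upwards [h1, Metric.tendstoUniformlyOn_iff.1 hFu e2 he2p] with k hk1 hk2 y
    rw [dist_comm, dist_eq_norm, UD_eq_set f G Φ η y subset_rfl, UD_eq_set (F k) _ Φ η y subset_rfl,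
      ← integral_sub (UDi_smooth_integrable (F k) (hF1 k) Φ hΦ.cd hΦ.cs η hη.continuous y).integrableOn
        (h.UDi_int hΦ hη.continuous hηc y)]
    have hd : ∀ x ∈ S, ‖UDi (F k) (fderiv ℝ (F k)) Φ η y x - UDi f G Φ η y x‖ ≤
        M * C * ‖adjL (fderiv ℝ (F k) x) - adjL (G x)‖ + L * e2 * C * ‖adjL (G x)‖ := by
      intro x hx
      have e : UDi (F k) (fderiv ℝ (F k)) Φ η y x - UDi f G Φ η y x =
          η (y - F k x) • (fderiv ℝ Φ x).comp (adjL (fderiv ℝ (F k) x) - adjL (G x)) +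
          (η (y - F k x) - η (y - f x)) • (fderiv ℝ Φ x).comp (adjL (G x)) := by
        unfold UDi
        rw [ContinuousLinearMap.comp_sub, smul_sub, sub_smul]; abel
      rw [e]
      refine (norm_add_le _ _).trans (add_le_add ?_ ?_)
      · rw [norm_smul, mul_assoc]
        refine mul_le_mul (hM _) ((ContinuousLinearMap.opNorm_comp_le _ _).trans ?_) (norm_nonneg _) hM0
        gcongr
        exact hC x
      · rw [norm_smul, mul_assoc]
        have h3 : ‖η (y - F k x) - η (y - f x)‖ ≤ L * e2 := by
          have := hL.dist_le_mul (y - F k x) (y - f x)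
          rw [dist_eq_norm] at this
          refine this.trans ?_
          gcongr
          rw [dist_sub_left, dist_comm]
          exact (hk2 x hx).le
        refine mul_le_mul h3 ((ContinuousLinearMap.opNorm_comp_le _ _).trans ?_) (norm_nonneg _) (by positivity)
        gcongr
        exact hC x
    have i1 : IntegrableOn (fun x => M * C * ‖adjL (fderiv ℝ (F k) x) - adjL (G x)‖) S :=
      (((hadjF k).sub hadj).norm).const_mul _
    have i2 : IntegrableOn (fun x => L * e2 * C * ‖adjL (G x)‖) S := hadj.norm.const_mul _
    have h4 := norm_integral_le_of_norm_le (i1.add i2) ((ae_restrict_iff' hΦ.cs.measurableSet).2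
      (Eventually.of_forall fun x hx => hd x hx))
    refine h4.trans_lt ?_
    have : ∫ x in S, ((fun x => M * C * ‖adjL (fderiv ℝ (F k) x) - adjL (G x)‖) + (fun x => L * e2 * C * ‖adjL (G x)‖)) x
        = M * C * (∫ x in S, ‖adjL (fderiv ℝ (F k) x) - adjL (G x)‖) + (L * e2 * C) * I := by
      rw [← integral_const_mul, hI, ← integral_const_mul]
      exact integral_add i1 i2
    rw [this]
    have h5 : L * e2 * C * I ≤ ε / 2 := by
      have : L * e2 * C * I = (L * C * I) / (L * C * I + 1) * (ε / 2) := by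
        rw [he2]; field_simp
      rw [this]
      have : (L * C * I) / (L * C * I + 1) ≤ 1 := by
        rw [div_le_one hpos]; linarith
      nlinarith
    linarith
  set U : ℕ → E → ℝ := fun k y => ∫ x, (Φ x * (fderiv ℝ (F k) x).det) * η (y - F k x) with hU
  have hUd : ∀ k y, HasFDerivAt (U k) (UD (F k) (fderiv ℝ (F k)) Φ η y) y := fun k y =>
    UD_smooth_hasFDerivAt (by have := h.dim; omega) (F k) (hF1 k) (hFc k) Φ hΦ.cd hΦ.cs η hη hηc y
  -- vanishing
  have hfS : IsCompact (f '' S) := hΦ.cs.image_of_continuousOn (h.cont.mono (hSK.trans h.sub))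
  have hvan : ∀ y, (∀ x ∈ S, y - f x ∉ tsupport η) → ∀ᶠ k in atTop, U k y = 0 := by
    intro y hy
    have hcy : IsCompact ((fun z => y - z) '' (f '' S)) := hfS.image (continuous_const.sub continuous_id)
    have hsub : (fun z => y - z) '' (f '' S) ⊆ (tsupport η)ᶜ := by
      rintro _ ⟨_, ⟨x, hx, rfl⟩, rfl⟩; exact hy x hx
    obtain ⟨δ, hδ, hδs⟩ := hcy.exists_thickening_subset_open (isClosed_tsupport η).isOpen_compl hsub
    filter_upwards [Metric.tendstoUniformlyOn_iff.1 hFu δ hδ] with k hk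
    rw [hU]
    simp only
    rw [← integral_zero E ℝ]
    congr 1; ext x
    by_cases hx : x ∈ S
    · have : y - F k x ∈ thickening δ ((fun z => y - z) '' (f '' S)) := by
        rw [mem_thickening_iff]
        refine ⟨y - f x, ⟨f x, ⟨x, hx, rfl⟩, rfl⟩, ?_⟩
        rw [dist_sub_left, dist_comm]
        exact hk x hx
      rw [image_eq_zero_of_notMem_tsupport (hδs this), mul_zero]
    · rw [image_eq_zero_of_notMem_tsupport hx, zero_mul, zero_mul]
  obtain ⟨y0, hy0⟩ : ∃ y0, ∀ x ∈ S, y0 - f x ∉ tsupport η := by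
    obtain ⟨y0, hy0⟩ := exists_far (hfS.add hηc) h.dim
    refine ⟨y0, fun x hx hx' => hy0 ?_⟩
    exact ⟨f x, ⟨x, hx, rfl⟩, y0 - f x, hx', add_sub_cancel _ _⟩
  have hc0 : Cauchy (map (fun k => U k y0) atTop) := by
    have : Tendsto (fun k => U k y0) atTop (𝓝 0) := (tendsto_congr' (hvan y0 hy0)).2 tendsto_const_nhds
    exact this.cauchy_map
  have hc : ∀ y, ∃ l, Tendsto (fun k => U k y) atTop (𝓝 l) := by
    intro y
    have := cauchy_map_of_uniformCauchySeqOn_fderiv isOpen_univ isPreconnected_univ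
      (tendstoUniformlyOn_univ.2 hunif).uniformCauchySeqOn (fun k y _ => hUd k y) (mem_univ y0) (mem_univ y) hc0
    exact cauchy_map_iff_exists_tendsto.1 this
  choose u hu using hc
  refine ⟨u, fun y => hasFDerivAt_of_tendstoUniformly hunif hUd hu y, fun y hy => ?_⟩
  exact tendsto_nhds_unique (hu y) ((tendsto_congr' (hvan y hy)).2 tendsto_const_nhds)

end M3c

section M4a
universe u
variable {E : Type u} [NormedAddCommGroup E] [NormedSpace ℝ E] [FiniteDimensional ℝ E] [MeasureSpace E] [BorelSpace E]
  [(volume : Measure E).IsAddHaarMeasure]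

theorem vitaliV (S : Set E) (ν : Measure E) (γ : ℝ → ℝ≥0∞) (R : ℝ)
    (h : ∀ y ∈ S, ∃ r, 0 < r ∧ r ≤ R ∧ γ r ≤ ν (closedBall y r)) :
    ∃ (u : Set E) (r : E → ℝ), u ⊆ S ∧ u.Countable ∧ (∀ a ∈ u, 0 < r a ∧ r a ≤ R) ∧
      S ⊆ ⋃ a ∈ u, closedBall a (5 * r a) ∧ ∑' a : u, γ (r a) ≤ ν univ := by
  have h' : ∀ y, ∃ r, y ∈ S → 0 < r ∧ r ≤ R ∧ γ r ≤ ν (closedBall y r) := by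
    intro y
    by_cases hy : y ∈ S
    · obtain ⟨r, hr⟩ := h y hy; exact ⟨r, fun _ => hr⟩
    · exact ⟨0, fun h => absurd h hy⟩
  choose r hr using h'
  obtain ⟨u, huS, hud, hcov⟩ := Vitali.exists_disjoint_subfamily_covering_enlargement_closedBall S (fun y => y) r R
    (fun a ha => (hr a ha).2.1) 5 (by norm_num)
  have hcount : u.Countable := by
    refine hud.countable_of_nonempty_interior fun a ha => ?_
    have : ball a (r a) ⊆ interior (closedBall a (r a)) := ball_subset_interior_closedBall
    exact ⟨a, this (mem_ball_self (hr a (huS ha)).1)⟩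
  refine ⟨u, r, huS, hcount, fun a ha => ⟨(hr a (huS ha)).1, (hr a (huS ha)).2.1⟩, ?_, ?_⟩
  · intro y hy
    obtain ⟨b, hb, hb'⟩ := hcov y hy
    simp only [mem_iUnion]
    exact ⟨b, hb, hb' (mem_closedBall_self (hr y hy).1.le)⟩
  · calc ∑' a : u, γ (r a) ≤ ∑' a : u, ν (closedBall (a : E) (r a)) :=
        ENNReal.tsum_le_tsum fun a => (hr a (huS a.2)).2.2
      _ = ν (⋃ a ∈ u, closedBall a (r a)) := (measure_biUnion hcount hud fun a _ => isClosed_closedBall.measurableSet).symm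
      _ ≤ ν univ := measure_mono (subset_univ _)

/-- weak-type bound -/
theorem weak_type (S : Set E) (ν : Measure E) (R : ℝ) (κ : ℝ≥0∞) (hκ : κ ≠ 0) (hκ' : κ ≠ ⊤)
    (h : ∀ y ∈ S, ∃ r, 0 < r ∧ r ≤ R ∧ κ * volume (closedBall y r) ≤ ν (closedBall y r)) :
    volume S ≤ 5 ^ (Module.finrank ℝ E) / κ * ν univ := by
  obtain ⟨u, r, huS, hc, hur, hcov, hsum⟩ := vitaliV S ν (fun r => κ * volume (closedBall (0:E) r)) R (by
    intro y hy
    obtain ⟨r, h0, h1, h2⟩ := h y hy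
    exact ⟨r, h0, h1, by rwa [Measure.addHaar_closedBall_center] at h2⟩)
  have : Countable u := hc.to_subtype
  have hm : ∀ a ∈ u, volume (closedBall a (5 * r a)) = 5 ^ (Module.finrank ℝ E) / κ * (κ * volume (closedBall (0:E) (r a))) := by
    intro a ha
    rw [Measure.addHaar_closedBall_mul_of_pos _ _ (by norm_num), ← mul_assoc, ENNReal.div_mul_cancel hκ hκ',
      ENNReal.ofReal_pow (by norm_num), ENNReal.ofReal_ofNat]
  calc volume S ≤ volume (⋃ a ∈ u, closedBall a (5 * r a)) := measure_mono hcov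
    _ ≤ ∑' a : u, volume (closedBall (a : E) (5 * r a)) := by
        exact measure_biUnion_le _ hc _
    _ = ∑' a : u, 5 ^ (Module.finrank ℝ E) / κ * (κ * volume (closedBall (0:E) (r a))) := by
        congr 1; ext a; exact hm a a.2
    _ = 5 ^ (Module.finrank ℝ E) / κ * ∑' a : u, (κ * volume (closedBall (0:E) (r a))) := ENNReal.tsum_mul_left
    _ ≤ _ := by gcongr

theorem lintegral_comp_smul_sub_x (s : ℝ) (hs : 0 < s) (x : E) (g : E → ℝ≥0∞) (hg : Measurable g) :
    ∫⁻ z, g (x + s • (z - x)) = (ENNReal.ofReal (s ^ (Module.finrank ℝ E)))⁻¹ * ∫⁻ w, g w := by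
  rw [lintegral_sub_right_eq_self (fun z => g (x + s • z)) x]
  have h1 : ∫⁻ z, g (x + s • z) = ∫⁻ w, g (x + w) ∂(Measure.map (fun z : E => s • z) volume) := by
    exact (lintegral_map (f := fun w => g (x + w)) (hg.comp (measurable_const_add x)) (measurable_const_smul s)).symm
  have h2 := Measure.map_addHaar_smul (volume : Measure E) hs.ne'
  rw [h1]
  change ∫⁻ w, g (x + w) ∂(Measure.map (s • ·) volume) = _
  rw [h2, lintegral_smul_measure, lintegral_add_left_eq_self, smul_eq_mul, abs_of_pos (by positivity),
    ENNReal.ofReal_inv_of_pos (by positivity)]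

variable {F : Type*} [NormedAddCommGroup F] [NormedSpace ℝ F] [CompleteSpace F]

/-- Dilation lemma (lintegral version). -/
theorem dilation (h : E → F) (hh : ContDiff ℝ 1 h) (x : E) (ρ : ℝ) (hρ : 0 < ρ) :
    ∫⁻ z in closedBall x ρ, ‖h z - h x‖ₑ ≤ ENNReal.ofReal ρ * ∫⁻ s in Ioc (0:ℝ) 1,
      (ENNReal.ofReal (s ^ (Module.finrank ℝ E)))⁻¹ * ∫⁻ w in closedBall x (s * ρ), ‖fderiv ℝ h w‖ₑ := by
  have hcD : Continuous (fderiv ℝ h) := hh.continuous_fderiv one_ne_zero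
  have h1 : ∀ z ∈ closedBall x ρ, ‖h z - h x‖ₑ ≤ ENNReal.ofReal ρ * ∫⁻ s in Ioc (0:ℝ) 1, ‖fderiv ℝ h (x + s • (z - x))‖ₑ := by
    intro z hz
    have hd : ∀ s : ℝ, HasDerivAt (fun s : ℝ => h (x + s • (z - x))) (fderiv ℝ h (x + s • (z - x)) (z - x)) s := by
      intro s
      have h2 : HasDerivAt (fun s : ℝ => x + s • (z - x)) (z - x) s := by
        simpa using ((hasDerivAt_id s).smul_const (z - x)).const_add x
      exact ((hh.differentiable one_ne_zero _).hasFDerivAt).comp_hasDerivAt s h2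
    have hci : Continuous fun s : ℝ => fderiv ℝ h (x + s • (z - x)) (z - x) := by fun_prop
    have h3 := intervalIntegral.integral_eq_sub_of_hasDerivAt (a := 0) (b := 1) (fun s _ => hd s) (hci.intervalIntegrable 0 1)
    have h4 : h z - h x = ∫ s in Ioc (0:ℝ) 1, fderiv ℝ h (x + s • (z - x)) (z - x) := by
      rw [← intervalIntegral.integral_of_le zero_le_one, h3]; simp
    rw [h4, ← lintegral_const_mul' _ _ ENNReal.ofReal_ne_top]
    refine (enorm_integral_le_lintegral_enorm _).trans (lintegral_mono fun s => ?_)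
    refine (ContinuousLinearMap.le_opENorm _ _).trans ?_
    rw [mul_comm]
    gcongr
    rw [← ofReal_norm, ← dist_eq_norm]
    exact ENNReal.ofReal_le_ofReal hz
  calc ∫⁻ z in closedBall x ρ, ‖h z - h x‖ₑ
      ≤ ∫⁻ z in closedBall x ρ, ENNReal.ofReal ρ * ∫⁻ s in Ioc (0:ℝ) 1, ‖fderiv ℝ h (x + s • (z - x))‖ₑ :=
        setLIntegral_mono' isClosed_closedBall.measurableSet h1
    _ = ENNReal.ofReal ρ * ∫⁻ z in closedBall x ρ, ∫⁻ s in Ioc (0:ℝ) 1, ‖fderiv ℝ h (x + s • (z - x))‖ₑ :=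
        lintegral_const_mul' _ _ ENNReal.ofReal_ne_top
    _ = ENNReal.ofReal ρ * ∫⁻ s in Ioc (0:ℝ) 1, ∫⁻ z in closedBall x ρ, ‖fderiv ℝ h (x + s • (z - x))‖ₑ := by
        rw [lintegral_lintegral_swap]
        refine Continuous.aemeasurable ?_
        refine Continuous.enorm ?_
        fun_prop
    _ ≤ _ := by
        refine mul_le_mul_right ?_ _
        refine setLIntegral_mono' measurableSet_Ioc fun s hs => ?_
        have hs0 : 0 < s := hs.1
        have e : ∫⁻ z in closedBall x ρ, ‖fderiv ℝ h (x + s • (z - x))‖ₑ =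
            ∫⁻ z, (closedBall x (s * ρ)).indicator (fun w => ‖fderiv ℝ h w‖ₑ) (x + s • (z - x)) := by
          rw [← lintegral_indicator isClosed_closedBall.measurableSet]
          congr 1; ext z
          have : z ∈ closedBall x ρ ↔ x + s • (z - x) ∈ closedBall x (s * ρ) := by
            rw [mem_closedBall, mem_closedBall, dist_eq_norm, dist_eq_norm, add_sub_cancel_left, norm_smul,
              Real.norm_of_nonneg hs0.le]
            exact (mul_le_mul_iff_right₀ hs0).symm
          by_cases hz : z ∈ closedBall x ρ
          · rw [indicator_of_mem hz, indicator_of_mem (this.1 hz)]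
          · rw [indicator_of_notMem hz, indicator_of_notMem (fun h' => hz (this.2 h'))]
        rw [e]
        have e2 := lintegral_comp_smul_sub_x (E := E) s hs0 x ((closedBall x (s * ρ)).indicator (fun w => ‖fderiv ℝ h w‖ₑ))
          ((hcD.enorm.measurable).indicator isClosed_closedBall.measurableSet)
        rw [e2, lintegral_indicator isClosed_closedBall.measurableSet]
end M4a

section M4b
universe u
variable {E : Type u} [NormedAddCommGroup E] [NormedSpace ℝ E] [FiniteDimensional ℝ E] [MeasureSpace E] [BorelSpace E]
  [(volume : Measure E).IsAddHaarMeasure]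
variable {F : Type*} [NormedAddCommGroup F] [NormedSpace ℝ F] [CompleteSpace F]

theorem dilation_bound (h : E → F) (hh : ContDiff ℝ 1 h) (x : E) (ρ : ℝ) (hρ : 0 < ρ) (T : ℝ≥0∞)
    (hT : ∀ r, 0 < r → r ≤ ρ → ∫⁻ w in closedBall x r, ‖fderiv ℝ h w‖ₑ ≤ T * volume (closedBall x r)) :
    ∫⁻ z in closedBall x ρ, ‖h z - h x‖ₑ ≤ ENNReal.ofReal ρ * T * volume (closedBall x ρ) := by
  refine (dilation h hh x ρ hρ).trans ?_
  rw [mul_assoc]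
  refine mul_le_mul_right ?_ _
  have : ∀ s ∈ Ioc (0:ℝ) 1, (ENNReal.ofReal (s ^ (Module.finrank ℝ E)))⁻¹ * ∫⁻ w in closedBall x (s * ρ), ‖fderiv ℝ h w‖ₑ
      ≤ T * volume (closedBall x ρ) := by
    intro s hs
    have hs0 : 0 < s := hs.1
    refine (mul_le_mul_right (hT (s * ρ) (by positivity) (by nlinarith [hs.2])) _).trans_eq ?_
    have hp : ENNReal.ofReal (s ^ (Module.finrank ℝ E)) ≠ 0 := by
      rw [Ne, ENNReal.ofReal_eq_zero, not_le]; positivity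
    rw [Measure.addHaar_closedBall_mul_of_pos _ _ hs0, Measure.addHaar_closedBall_center volume x ρ, mul_left_comm T, ← mul_assoc,
      ENNReal.inv_mul_cancel hp ENNReal.ofReal_ne_top, one_mul]
  refine (setLIntegral_mono' measurableSet_Ioc this).trans_eq ?_
  rw [setLIntegral_const, Real.volume_Ioc]; simp

theorem pair_bound (h : E → F) (hh : ContDiff ℝ 1 h) (x y : E) (T : ℝ≥0∞)
    (hx : ∀ r, 0 < r → r ≤ dist x y → ∫⁻ w in closedBall x r, ‖fderiv ℝ h w‖ₑ ≤ T * volume (closedBall x r))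
    (hy : ∀ r, 0 < r → r ≤ dist x y → ∫⁻ w in closedBall y r, ‖fderiv ℝ h w‖ₑ ≤ T * volume (closedBall y r)) :
    ‖h x - h y‖ₑ ≤ 2 ^ (Module.finrank ℝ E + 1) * T * ENNReal.ofReal (dist x y) := by
  rcases eq_or_ne x y with rfl | hne
  · simp
  set ρ := dist x y with hρ
  have hρ0 : 0 < ρ := dist_pos.2 hne
  set B := closedBall (midpoint ℝ x y) (ρ / 2) with hB
  have b1 : B ⊆ closedBall x ρ := by
    refine closedBall_subset_closedBall' ?_
    rw [dist_midpoint_left, ← hρ]; norm_num; linarith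
  have b2 : B ⊆ closedBall y ρ := by
    refine closedBall_subset_closedBall' ?_
    rw [dist_midpoint_right, ← hρ]; norm_num; linarith
  have hv : ∀ z : E, volume (closedBall z ρ) = 2 ^ (Module.finrank ℝ E) * volume B := by
    intro z
    rw [Measure.addHaar_closedBall_center volume z ρ, hB, Measure.addHaar_closedBall_center volume _ (ρ / 2)]
    have : ρ = 2 * (ρ / 2) := by ring
    nth_rw 1 [this]
    rw [Measure.addHaar_closedBall_mul_of_pos _ _ (by norm_num), ENNReal.ofReal_pow (by norm_num), ENNReal.ofReal_ofNat]
  have hB0 : volume B ≠ 0 := (measure_closedBall_pos volume _ (by positivity)).ne'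
  have hBt : volume B ≠ ⊤ := measure_closedBall_lt_top.ne
  have key : ‖h x - h y‖ₑ * volume B ≤ 2 ^ (Module.finrank ℝ E + 1) * T * ENNReal.ofReal ρ * volume B := by
    calc ‖h x - h y‖ₑ * volume B = ∫⁻ z in B, ‖h x - h y‖ₑ := (setLIntegral_const _ _).symm
      _ ≤ ∫⁻ z in B, (‖h z - h x‖ₑ + ‖h z - h y‖ₑ) := by
          refine lintegral_mono fun z => ?_
          have : h x - h y = -(h z - h x) + (h z - h y) := by abel
          rw [this]
          refine (enorm_add_le _ _).trans ?_
          rw [enorm_neg]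
      _ = (∫⁻ z in B, ‖h z - h x‖ₑ) + ∫⁻ z in B, ‖h z - h y‖ₑ := by
          refine lintegral_add_left ?_ _
          exact (hh.continuous.sub continuous_const).enorm.measurable
      _ ≤ ENNReal.ofReal ρ * T * volume (closedBall x ρ) + ENNReal.ofReal ρ * T * volume (closedBall y ρ) :=
          add_le_add ((lintegral_mono_set b1).trans (dilation_bound h hh x ρ hρ0 T hx))
            ((lintegral_mono_set b2).trans (dilation_bound h hh y ρ hρ0 T hy))
      _ = _ := by rw [hv, hv]; ring
  exact (ENNReal.mul_le_mul_iff_left hB0 hBt).1 key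

theorem lip_tail {f : E → F} (Fk : ℕ → E → F) (x y : E) (hx : Tendsto (fun k => Fk k x) atTop (𝓝 (f x)))
    (hy : Tendsto (fun k => Fk k y) atTop (𝓝 (f y))) (C : ℝ) (m : ℕ)
    (h : ∀ k ≥ m, ‖(Fk (k + 1) x - Fk k x) - (Fk (k + 1) y - Fk k y)‖ ≤ C * (1 / 2) ^ k) (k : ℕ) (hk : m ≤ k) :
    ‖(f x - f y) - (Fk k x - Fk k y)‖ ≤ 2 * C * (1 / 2) ^ k := by
  have hb : ∀ j, ‖(Fk (k + j) x - Fk (k + j) y) - (Fk k x - Fk k y)‖ ≤ 2 * C * (1 / 2) ^ k - 2 * C * (1 / 2) ^ (k + j) := by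
    intro j
    induction j with
    | zero => simp
    | succ j ih =>
      have e : (Fk (k + (j + 1)) x - Fk (k + (j + 1)) y) - (Fk k x - Fk k y) =
        ((Fk (k + j) x - Fk (k + j) y) - (Fk k x - Fk k y)) +
        ((Fk (k + j + 1) x - Fk (k + j) x) - (Fk (k + j + 1) y - Fk (k + j) y)) := by
        rw [← add_assoc k j 1]; abel
      rw [e]
      refine (norm_add_le _ _).trans ((add_le_add ih (h (k + j) (by omega))).trans_eq ?_)
      rw [← add_assoc k j 1, pow_succ]; ring
  have hC : 0 ≤ C := by
    have := (norm_nonneg _).trans (h m le_rfl)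
    exact nonneg_of_mul_nonneg_left this (by positivity)
  have ht : Tendsto (fun j => ‖(Fk (k + j) x - Fk (k + j) y) - (Fk k x - Fk k y)‖) atTop (𝓝 ‖(f x - f y) - (Fk k x - Fk k y)‖) := by
    have hs : Tendsto (fun j => k + j) atTop atTop := tendsto_atTop_mono (fun j => Nat.le_add_left j k) tendsto_id
    exact (((hx.comp hs).sub (hy.comp hs)).sub_const _).norm
  refine le_of_tendsto ht (Eventually.of_forall fun j => (hb j).trans ?_)
  have : 0 ≤ 2 * C * (1 / 2 : ℝ) ^ (k + j) := by positivity
  linarith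
end M4b

section M4c
universe u
variable {E : Type u} [NormedAddCommGroup E] [NormedSpace ℝ E] [FiniteDimensional ℝ E] [MeasureSpace E] [BorelSpace E]
  [(volume : Measure E).IsAddHaarMeasure]

theorem ae_tendsto_of_summable {α F : Type*} [MeasurableSpace α] {μ : Measure α} [NormedAddCommGroup F] (g : ℕ → α → F) (g0 : α → F)
    (hm : ∀ k, AEStronglyMeasurable (fun x => g k x - g0 x) μ) (hs : ∑' k, ∫⁻ x, ‖g k x - g0 x‖ₑ ∂μ ≠ ⊤) :
    ∀ᵐ x ∂μ, Tendsto (fun k => g k x) atTop (𝓝 (g0 x)) := by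
  rw [← lintegral_tsum fun k => (hm k).enorm] at hs
  have := ae_lt_top' (AEMeasurable.tsum fun k => (hm k).enorm) hs
  filter_upwards [this] with x hx
  have h1 := ENNReal.tendsto_atTop_zero_of_tsum_ne_top hx.ne
  rw [tendsto_iff_edist_tendsto_0]
  simpa [edist_eq_enorm_sub] using h1

theorem approx_diff {D : Set E} {f : E → E} {G : E → E →L[ℝ] E} (h : WD D f G) (x0 : E) (R : ℝ) (hR : 0 < R)
    (hD : closedBall x0 (4 * R) ⊆ D) (ε : ℝ≥0∞) (hε : ε ≠ 0) :
    ∃ A ⊆ closedBall x0 R, MeasurableSet A ∧ volume (closedBall x0 R \ A) ≤ ε ∧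
      ∀ x ∈ A, HasFDerivWithinAt f (G x) A x := by
  set S := closedBall x0 (3 * R) with hS
  have hSc : IsCompact S := isCompact_closedBall _ _
  have hSK : S ⊆ interior (closedBall x0 (4 * R)) :=
    (closedBall_subset_ball (by linarith)).trans ball_subset_interior_closedBall
  have hSD : S ⊆ D := (hSK.trans interior_subset).trans hD
  obtain ⟨F, hF1, -, hFu, hFT⟩ := exists_approx h (isCompact_closedBall x0 (4 * R)) hD hSc hSK
  have hGK := h.intOn (isCompact_closedBall x0 (4 * R)) hD
  have hGS : IntegrableOn G S := h.intOn hSc hSD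
  have ha := hFT _ 1 (fun A => A) 1 (by simp only [pow_one]; exact hGK.norm) one_ne_zero continuous_id zero_le_one (by simp)
  obtain ⟨σ, hσ, hσa⟩ := extraction_forall_of_eventually
    (P := fun n k => ∫ x in S, ‖fderiv ℝ (F k) x - G x‖ ≤ (1 / 4) ^ n)
    (fun n => ha.eventually_le_const (by positivity))
  set Fk : ℕ → E → E := fun k => F (σ k) with hFk
  have hFk1 : ∀ k, ContDiff ℝ 1 (Fk k) := fun k => hF1 _
  have hcD : ∀ k, Continuous (fderiv ℝ (Fk k)) := fun k => (hFk1 k).continuous_fderiv one_ne_zero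
  have hFklim : ∀ x ∈ S, Tendsto (fun k => Fk k x) atTop (𝓝 (f x)) := fun x hx =>
    (hFu.tendsto_at hx).comp hσ.tendsto_atTop
  have hint : ∀ k, IntegrableOn (fun x => fderiv ℝ (Fk k) x - G x) S := fun k =>
    ((hcD k).continuousOn.integrableOn_compact hSc).sub hGS
  have hl : ∀ k, ∫⁻ x in S, ‖fderiv ℝ (Fk k) x - G x‖ₑ ≤ (1 / 4) ^ k := by
    intro k
    rw [← ofReal_integral_norm_eq_lintegral_enorm (hint k)]
    refine (ENNReal.ofReal_le_ofReal (hσa k)).trans_eq ?_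
    rw [ENNReal.ofReal_pow (by norm_num), ENNReal.ofReal_div_of_pos (by norm_num)]; simp
  set hk : ℕ → E → E := fun k x => Fk (k + 1) x - Fk k x with hhk
  have hk1 : ∀ k, ContDiff ℝ 1 (hk k) := fun k => (hFk1 (k + 1)).sub (hFk1 k)
  have hkd : ∀ k x, fderiv ℝ (hk k) x = fderiv ℝ (Fk (k + 1)) x - fderiv ℝ (Fk k) x := fun k x =>
    fderiv_fun_sub ((hFk1 (k + 1)).differentiable one_ne_zero x) ((hFk1 k).differentiable one_ne_zero x)
  have hkl : ∀ k, ∫⁻ x in S, ‖fderiv ℝ (hk k) x‖ₑ ≤ 2 * (1 / 4) ^ k := by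
    intro k
    calc ∫⁻ x in S, ‖fderiv ℝ (hk k) x‖ₑ ≤ ∫⁻ x in S, (‖fderiv ℝ (Fk (k + 1)) x - G x‖ₑ + ‖fderiv ℝ (Fk k) x - G x‖ₑ) := by
          refine lintegral_mono fun x => ?_
          have : fderiv ℝ (hk k) x = (fderiv ℝ (Fk (k + 1)) x - G x) + -(fderiv ℝ (Fk k) x - G x) := by
            rw [hkd]; abel
          rw [this]
          refine (enorm_add_le _ _).trans ?_
          rw [enorm_neg]
      _ = _ := lintegral_add_left' (hint (k + 1)).aestronglyMeasurable.enorm _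
      _ ≤ (1 / 4) ^ (k + 1) + (1 / 4) ^ k := add_le_add (hl _) (hl _)
      _ ≤ 2 * (1 / 4) ^ k := by
          rw [two_mul]; gcongr ?_ + _
          refine pow_le_pow_right_of_le_one' ?_ (by omega)
          rw [one_div]; exact ENNReal.inv_le_one.2 (by norm_num)
  set bad : ℕ → Set E := fun k => {x ∈ closedBall x0 R | ∃ r, 0 < r ∧ r ≤ 2 * R ∧
    (1 / 2) ^ k * volume (closedBall x r) ≤ ∫⁻ w in closedBall x r, ‖fderiv ℝ (hk k) w‖ₑ} with hbad
  have hbv : ∀ k, volume (bad k) ≤ (5 ^ (Module.finrank ℝ E) * 2) * (1 / 2) ^ k := by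
    intro k
    have := weak_type (bad k) ((volume.restrict S).withDensity fun w => ‖fderiv ℝ (hk k) w‖ₑ) (2 * R) ((1 / 2) ^ k)
      (by simp) (by simp) (by
        rintro x ⟨hx, r, hr0, hr1, hr⟩
        refine ⟨r, hr0, hr1, hr.trans ?_⟩
        rw [withDensity_apply _ isClosed_closedBall.measurableSet, Measure.restrict_restrict isClosed_closedBall.measurableSet,
          inter_eq_left.2]
        refine closedBall_subset_closedBall' ?_
        rw [mem_closedBall] at hx; linarith)
    refine this.trans ?_
    rw [withDensity_apply _ MeasurableSet.univ, Measure.restrict_univ]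
    refine (mul_le_mul_right (hkl k) _).trans_eq ?_
    rw [ENNReal.div_eq_inv_mul, one_div, one_div, ← ENNReal.inv_pow, inv_inv]
    have : ((4:ℝ≥0∞)⁻¹) ^ k = (2⁻¹) ^ k * (2⁻¹) ^ k := by
      rw [← mul_pow, ← ENNReal.mul_inv (by simp) (by simp)]; norm_num
    rw [this]
    have h2 : (2:ℝ≥0∞) ^ k * (2⁻¹) ^ k = 1 := by
      rw [← mul_pow, ENNReal.mul_inv_cancel (by simp) (by simp), one_pow]
    calc (2:ℝ≥0∞) ^ k * 5 ^ Module.finrank ℝ E * (2 * (2⁻¹ ^ k * 2⁻¹ ^ k)) =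
      (2 ^ k * 2⁻¹ ^ k) * (5 ^ Module.finrank ℝ E * 2 * 2⁻¹ ^ k) := by ring
      _ = _ := by rw [h2, one_mul, ENNReal.inv_pow]
  have hsum : ∑' k, volume (bad k) ≠ ⊤ := by
    refine ne_top_of_le_ne_top ?_ (ENNReal.tsum_le_tsum hbv)
    rw [ENNReal.tsum_mul_left, ENNReal.tsum_geometric]
    refine ENNReal.mul_ne_top (by finiteness) ?_
    simp
  have htail := ENNReal.tendsto_sum_nat_add _ hsum
  obtain ⟨m, hm⟩ := (htail.eventually_le_const (pos_iff_ne_zero.2 hε)).exists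
  have hae := ae_tendsto_of_summable (μ := volume.restrict S) (fun k => fderiv ℝ (Fk k)) G
    (fun k => (hint k).aestronglyMeasurable) (by
      refine ne_top_of_le_ne_top ?_ (ENNReal.tsum_le_tsum hl)
      rw [ENNReal.tsum_geometric]
      rw [Ne, ENNReal.inv_eq_top, tsub_eq_zero_iff_le, not_le, one_div]
      exact ENNReal.inv_lt_one.2 (by norm_num))
  rw [ae_restrict_iff' hSc.measurableSet, ae_iff] at hae
  set N := {x | ¬(x ∈ S → Tendsto (fun k => fderiv ℝ (Fk k) x) atTop (𝓝 (G x)))} with hN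
  set W := toMeasurable volume ((⋃ k, bad (k + m)) ∪ N) with hW
  have hWv : volume W ≤ ε := by
    rw [hW, measure_toMeasurable]
    refine (measure_union_le _ _).trans ?_
    rw [hae, add_zero]
    exact (measure_iUnion_le _).trans hm
  have hsubW : (⋃ k, bad (k + m)) ∪ N ⊆ W := subset_toMeasurable _ _
  have hBS : closedBall x0 R ⊆ S := closedBall_subset_closedBall (by linarith)
  refine ⟨closedBall x0 R \ W, sdiff_subset, isClosed_closedBall.measurableSet.diff (measurableSet_toMeasurable _ _), ?_, ?_⟩
  · rw [Set.sdiff_sdiff_right_self]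
    exact (measure_mono inter_subset_right).trans hWv
  have hgood : ∀ x ∈ closedBall x0 R \ W, ∀ k ≥ m, ∀ r, 0 < r → r ≤ 2 * R →
      ∫⁻ w in closedBall x r, ‖fderiv ℝ (hk k) w‖ₑ ≤ (1 / 2) ^ k * volume (closedBall x r) := by
    intro x hx k hkm r hr0 hr1
    by_contra hcon
    push Not at hcon
    apply hx.2
    refine hsubW (Or.inl (mem_iUnion.2 ⟨k - m, ?_⟩))
    rw [Nat.sub_add_cancel hkm]
    exact ⟨hx.1, r, hr0, hr1, hcon.le⟩
  intro x hx
  have hGx : Tendsto (fun k => fderiv ℝ (Fk k) x) atTop (𝓝 (G x)) := by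
    by_contra hcon
    exact hx.2 (hsubW (Or.inr fun h' => hcon (h' (hBS hx.1))))
  have hpair : ∀ y ∈ closedBall x0 R \ W, ∀ k ≥ m, ‖hk k y - hk k x‖ ≤
      (2 ^ (Module.finrank ℝ E + 1) * dist y x) * (1 / 2) ^ k := by
    intro y hy k hkm
    have hd : dist y x ≤ 2 * R := by
      have := dist_triangle_right y x x0
      have h1 := mem_closedBall.1 hx.1
      have h2 := mem_closedBall.1 hy.1
      linarith
    have := pair_bound (hk k) (hk1 k) y x ((1 / 2) ^ k) (fun r h0 h1 => hgood y hy k hkm r h0 (h1.trans hd))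
      (fun r h0 h1 => hgood x hx k hkm r h0 (h1.trans hd))
    have e : (2:ℝ≥0∞) ^ (Module.finrank ℝ E + 1) * (1 / 2) ^ k * ENNReal.ofReal (dist y x) =
        ENNReal.ofReal ((2 ^ (Module.finrank ℝ E + 1) * dist y x) * (1 / 2) ^ k) := by
      rw [ENNReal.ofReal_mul (by positivity), ENNReal.ofReal_mul (by positivity), ENNReal.ofReal_pow (by norm_num),
        ENNReal.ofReal_pow (by norm_num), ENNReal.ofReal_div_of_pos (by norm_num)]
      simp only [ENNReal.ofReal_ofNat, ENNReal.ofReal_one]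
      ring
    rw [e, ← ofReal_norm] at this
    exact (ENNReal.ofReal_le_ofReal_iff (by positivity)).1 this
  rw [hasFDerivWithinAt_iff_isLittleO, Asymptotics.isLittleO_iff]
  intro c hc
  have t1 : ∀ᶠ k in atTop, 2 * 2 ^ (Module.finrank ℝ E + 1) * (1 / 2 : ℝ) ^ k ≤ c / 3 := by
    have := (tendsto_pow_atTop_nhds_zero_of_lt_one (r := (1 / 2 : ℝ)) (by norm_num) (by norm_num)).const_mul (2 * 2 ^ (Module.finrank ℝ E + 1))
    rw [mul_zero] at this
    exact this.eventually_le_const (by positivity)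
  have t2 : ∀ᶠ k in atTop, ‖fderiv ℝ (Fk k) x - G x‖ ≤ c / 3 := by
    have := (tendsto_iff_norm_sub_tendsto_zero.1 hGx)
    exact this.eventually_le_const (by positivity)
  obtain ⟨k, hk1', hk2, hk3⟩ := (t1.and (t2.and (eventually_ge_atTop m))).exists
  have t3 := ((hFk1 k).differentiable one_ne_zero x).hasFDerivAt.isLittleO
  have t4 := (Asymptotics.isLittleO_iff.1 t3) (show 0 < c / 3 by positivity)
  have t5 : ∀ᶠ y in 𝓝[closedBall x0 R \ W] x, ‖Fk k y - Fk k x - fderiv ℝ (Fk k) x (y - x)‖ ≤ c / 3 * ‖y - x‖ :=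
    nhdsWithin_le_nhds t4
  filter_upwards [t5, self_mem_nhdsWithin] with y hy5 hyA
  have t6 := lip_tail Fk y x (hFklim y (hBS hyA.1)) (hFklim x (hBS hx.1)) (2 ^ (Module.finrank ℝ E + 1) * dist y x) m
    (fun j hj => hpair y hyA j hj) k hk3
  have e : f y - f x - G x (y - x) = ((f y - f x) - (Fk k y - Fk k x)) + (Fk k y - Fk k x - fderiv ℝ (Fk k) x (y - x)) +
      (fderiv ℝ (Fk k) x - G x) (y - x) := by
    rw [sub_apply]; abel
  rw [e]
  refine (norm_add₃_le).trans ?_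
  have t7 : ‖(fderiv ℝ (Fk k) x - G x) (y - x)‖ ≤ c / 3 * ‖y - x‖ :=
    (ContinuousLinearMap.le_opNorm _ _).trans (by gcongr)
  have t8 : 2 * (2 ^ (Module.finrank ℝ E + 1) * dist y x) * (1 / 2 : ℝ) ^ k ≤ c / 3 * ‖y - x‖ := by
    rw [dist_eq_norm]
    calc 2 * (2 ^ (Module.finrank ℝ E + 1) * ‖y - x‖) * (1 / 2 : ℝ) ^ k = (2 * 2 ^ (Module.finrank ℝ E + 1) * (1 / 2 : ℝ) ^ k) * ‖y - x‖ := by ring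
      _ ≤ _ := by gcongr
  linarith
end M4c

section M4d
universe u
variable {E : Type u} [NormedAddCommGroup E] [NormedSpace ℝ E] [FiniteDimensional ℝ E] [MeasureSpace E] [BorelSpace E]
  [(volume : Measure E).IsAddHaarMeasure]

theorem area_ineq {D : Set E} {f : E → E} {G : E → E →L[ℝ] E} (h : WD D f G) (hinj : InjOn f D) (x0 : E) (R : ℝ) (hR : 0 < R)
    (hD : closedBall x0 (4 * R) ⊆ D) (g : E → ℝ≥0∞) :
    ∫⁻ x in closedBall x0 R, ENNReal.ofReal |(G x).det| * g (f x) ≤ ∫⁻ y, g y := by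
  choose A hAsub hAm hAv hAd using fun m : ℕ => approx_diff h x0 R hR hD ((1:ℝ≥0∞) / (m + 1)) (by simp)
  set B := disjointed A with hB
  have hBA : ∀ m, B m ⊆ A m := fun m => disjointed_subset A m
  have hBm : ∀ m, MeasurableSet (B m) := fun m => MeasurableSet.disjointed hAm m
  have hBd : Pairwise (Function.onFun Disjoint B) := disjoint_disjointed A
  have hBD : ∀ m, B m ⊆ D := fun m => ((hBA m).trans (hAsub m)).trans ((closedBall_subset_closedBall (by linarith)).trans hD)
  have hnull : volume (closedBall x0 R \ ⋃ m, B m) = 0 := by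
    rw [hB, iUnion_disjointed]
    have hle : ∀ m : ℕ, volume (closedBall x0 R \ ⋃ m, A m) ≤ 1 / (m + 1) := fun m =>
      (measure_mono (sdiff_subset_sdiff_right (subset_iUnion A m))).trans (hAv m)
    have ht : Tendsto (fun m : ℕ => (1:ℝ≥0∞) / (m + 1)) atTop (𝓝 0) := by
      have := ENNReal.tendsto_inv_nat_nhds_zero.comp (tendsto_add_atTop_nat 1)
      refine this.congr fun m => ?_
      simp
    exact le_antisymm (ge_of_tendsto' ht hle) bot_le
  have hsub : (⋃ m, B m) ⊆ closedBall x0 R := iUnion_subset fun m => (hBA m).trans (hAsub m)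
  have hae : (closedBall x0 R : Set E) =ᵐ[volume] ⋃ m, B m := by
    exact EventuallyLE.antisymm (ae_le_set.2 hnull) (ae_le_set.2 (by rw [sdiff_eq_empty.2 hsub, measure_empty]))
  have hfd : ∀ m, ∀ x ∈ B m, HasFDerivWithinAt f (G x) (B m) x := fun m x hx => (hAd m x (hBA m hx)).mono (hBA m)
  rw [setLIntegral_congr hae, lintegral_iUnion hBm hBd]
  have hinjB : ∀ m, InjOn f (B m) := fun m => hinj.mono (hBD m)
  have e : ∀ m, ∫⁻ x in B m, ENNReal.ofReal |(G x).det| * g (f x) = ∫⁻ y in f '' B m, g y := fun m =>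
    (lintegral_image_eq_lintegral_abs_det_fderiv_mul volume (hBm m) (hfd m) (hinjB m) g).symm
  simp_rw [e]
  have hmi : ∀ m, MeasurableSet (f '' B m) := fun m => measurable_image_of_fderivWithin (hBm m) (hfd m) (hinjB m)
  rw [← lintegral_iUnion hmi]
  · exact setLIntegral_le_lintegral _ _
  · intro i j hij
    have := hBd hij
    refine disjoint_left.2 ?_
    rintro _ ⟨x, hx, rfl⟩ ⟨y, hy, hxy⟩
    have : y = x := hinj (hBD j hy) (hBD i hx) hxy
    subst this
    exact disjoint_left.1 (hBd hij) hx hy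
end M4d

section M5a
universe u
variable {E : Type u} [NormedAddCommGroup E] [NormedSpace ℝ E] [FiniteDimensional ℝ E] [MeasureSpace E] [BorelSpace E]
  [(volume : Measure E).IsAddHaarMeasure]

theorem mol_apply' (φ : ContDiffBump (0 : E)) (g : E → ℝ) (x : E) :
    mol φ g x = ∫ t, φ.normed volume t * g (x - t) := by
  unfold mol; rw [convolution_def]; rfl

theorem nrm_int (φ : ContDiffBump (0 : E)) (g : E → ℝ) (hg : Continuous g) :
    Integrable fun t => φ.normed volume t * g t := by
  refine Continuous.integrable_of_hasCompactSupport (by have := φ.continuous_normed (μ := volume); fun_prop) ?_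
  exact φ.hasCompactSupport_normed.mul_right

theorem mol_lip (φ : ContDiffBump (0 : E)) (g : E → ℝ) (C : ℝ≥0) (hg : LipschitzWith C g) :
    LipschitzWith C (mol φ g) := by
  refine LipschitzWith.of_dist_le_mul fun x y => ?_
  have hc := hg.continuous
  have i : ∀ x, Integrable fun t => φ.normed volume t * g (x - t) := fun x =>
    nrm_int φ (fun t => g (x - t)) (by fun_prop)
  rw [Real.dist_eq, mol_apply', mol_apply', ← integral_sub (i x) (i y), ← Real.norm_eq_abs]
  have := φ.integrable_normed (μ := volume)
  calc _ ≤ ∫ t, φ.normed volume t * (C * dist x y) := by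
        refine norm_integral_le_of_norm_le (this.mul_const _) (Eventually.of_forall fun t => ?_)
        rw [← mul_sub, norm_mul, Real.norm_of_nonneg (φ.nonneg_normed _)]
        refine mul_le_mul_of_nonneg_left ?_ (φ.nonneg_normed _)
        rw [← dist_eq_norm]
        exact (hg.dist_le_mul _ _).trans (by simp)
    _ = _ := by rw [integral_mul_const, φ.integral_normed, one_mul]

theorem exists_cutoff (x : E) (a b : ℝ) (ha : 0 ≤ a) (hab : a < b) :
    ∃ Φ : E → ℝ, ContDiff ℝ 1 Φ ∧ (∀ z, 0 ≤ Φ z ∧ Φ z ≤ 1) ∧ (∀ z ∈ closedBall x a, Φ z = 1) ∧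
      tsupport Φ ⊆ closedBall x b ∧ ∀ z, ‖fderiv ℝ Φ z‖ ≤ 2 / (b - a) := by
  set d := (b - a) / 4 with hd
  have hd0 : 0 < d := by simp only [hd]; linarith
  let h : E → ℝ := fun z => max 0 (min 1 ((b - d - ‖z - x‖) / (2 * d)))
  let φ : ContDiffBump (0 : E) := ⟨d / 2, d, by linarith, by linarith⟩
  have hφ : φ.rOut = d := rfl
  have hlip : LipschitzWith (Real.toNNReal (2 / (b - a))) h := by
    refine (LipschitzWith.const_min ?_ 1).const_max 0
    refine LipschitzWith.of_dist_le_mul fun z w => ?_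
    rw [Real.coe_toNNReal _ (by have : 0 < b - a := by linarith
                                positivity), Real.dist_eq, ← sub_div, abs_div, abs_of_pos (show 0 < 2 * d by positivity)]
    have e : 2 * d = (b - a) / 2 := by rw [hd]; ring
    rw [e, div_div_eq_mul_div, mul_div_assoc, mul_comm]
    have hba : 0 < b - a := by linarith
    refine mul_le_mul_of_nonneg_left ?_ (by positivity)
    have : b - d - ‖z - x‖ - (b - d - ‖w - x‖) = ‖w - x‖ - ‖z - x‖ := by ring
    rw [this]
    refine (abs_norm_sub_norm_le _ _).trans ?_
    rw [sub_sub_sub_cancel_right, ← dist_eq_norm, dist_comm]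
  have hcont := hlip.continuous
  have h01 : ∀ z, 0 ≤ h z ∧ h z ≤ 1 := fun z => ⟨le_max_left _ _, max_le zero_le_one (min_le_left _ _)⟩
  have h1 : ∀ z, ‖z - x‖ ≤ a + d → h z = 1 := by
    intro z hz
    have : 1 ≤ (b - d - ‖z - x‖) / (2 * d) := by
      rw [le_div_iff₀ (by positivity)]; simp only [hd] at *; linarith
    simp only [h, min_eq_left this]; simp
  have h0 : ∀ z, b - d ≤ ‖z - x‖ → h z = 0 := by
    intro z hz
    have : (b - d - ‖z - x‖) / (2 * d) ≤ 0 := div_nonpos_of_nonpos_of_nonneg (by linarith) (by positivity)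
    simp only [h]
    exact max_eq_left ((min_le_right _ _).trans this)
  have hli : LocallyIntegrable h := hcont.locallyIntegrable
  have i : ∀ x, Integrable fun t => φ.normed volume t * h (x - t) := fun x =>
    nrm_int φ (fun t => h (x - t)) (by fun_prop)
  have hz : ∀ z, z ∉ closedBall x b → mol φ h z = 0 := by
    intro z hz
    rw [mem_closedBall, dist_eq_norm, not_le] at hz
    have hzz : h z = 0 := h0 z (by linarith)
    have := φ.normed_convolution_eq_right (μ := volume) (g := h) (x₀ := z) fun w hw => by
      rw [hzz]
      rw [mem_ball, hφ, dist_eq_norm] at hw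
      refine h0 w ?_
      have := norm_sub_norm_le (z - x) (z - w)
      rw [sub_sub_sub_cancel_left, norm_sub_rev z w] at this
      linarith
    rw [hzz] at this
    exact this
  refine ⟨mol φ h, mol_contDiff φ h hli, fun z => ⟨?_, ?_⟩, fun z hz => ?_, ?_, fun z => ?_⟩
  · rw [mol_apply']
    exact integral_nonneg fun t => mul_nonneg (φ.nonneg_normed _) (h01 _).1
  · rw [mol_apply', ← φ.integral_normed (μ := volume)]
    refine integral_mono (i z) φ.integrable_normed fun t => ?_
    exact mul_le_of_le_one_right (φ.nonneg_normed _) (h01 _).2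
  · rw [mem_closedBall, dist_eq_norm] at hz
    have hzz : h z = 1 := h1 z (by linarith)
    have := φ.normed_convolution_eq_right (μ := volume) (g := h) (x₀ := z) fun w hw => by
      rw [hzz]
      rw [mem_ball, hφ, dist_eq_norm] at hw
      refine h1 w ?_
      have := norm_add_le (z - x) (w - z)
      rw [sub_add_sub_cancel'] at this
      linarith
    rw [hzz] at this
    exact this
  · refine closure_minimal (fun z hz' => ?_) isClosed_closedBall
    by_contra hcon
    exact hz' (hz z hcon)
  · have := norm_fderiv_le_of_lipschitz ℝ (mol_lip φ h _ hlip) (x₀ := z)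
    rwa [Real.coe_toNNReal _ (by have : 0 < b - a := by linarith
                                 positivity)] at this

noncomputable def eta (k : ℕ) : E → ℝ := (bseq (E := E) k).normed volume

theorem eta_cd (k : ℕ) : ContDiff ℝ 1 (eta (E := E) k) := ContDiffBump.contDiff_normed _
theorem eta_cs (k : ℕ) : HasCompactSupport (eta (E := E) k) := ContDiffBump.hasCompactSupport_normed _
theorem eta_nn (k : ℕ) (x : E) : 0 ≤ eta (E := E) k x := ContDiffBump.nonneg_normed _ _
theorem eta_int (k : ℕ) : ∫ x, eta (E := E) k x = 1 := ContDiffBump.integral_normed _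
theorem eta_ts (k : ℕ) : tsupport (eta (E := E) k) = closedBall 0 (1 / (k + 1)) := ContDiffBump.tsupport_normed_eq _ 

theorem eta_lint (k : ℕ) (w : E) : ∫⁻ x, ENNReal.ofReal (eta (E := E) k (x - w)) = 1 := by
  rw [lintegral_sub_right_eq_self (fun x => ENNReal.ofReal (eta (E := E) k x)) w]
  rw [← ofReal_integral_eq_lintegral_ofReal ((eta_cd k).continuous.integrable_of_hasCompactSupport (eta_cs k))
    (Eventually.of_forall (eta_nn k)), eta_int, ENNReal.ofReal_one]

def IsUU (f : E → E) (G : E → E →L[ℝ] E) (Φ : E → ℝ) (k : ℕ) (u : E → ℝ) : Prop :=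
  (∀ y, HasFDerivAt u (UD f G Φ (eta k) y) y) ∧ ∀ y, (∀ x ∈ tsupport Φ, y - f x ∉ tsupport (eta (E := E) k)) → u y = 0

noncomputable def UU (f : E → E) (G : E → E →L[ℝ] E) (Φ : E → ℝ) (k : ℕ) : E → ℝ :=
  if h : ∃ u, IsUU f G Φ k u then h.choose else 0

variable {D : Set E} {f : E → E} {G : E → E →L[ℝ] E} {K : Set E}

theorem GD.uu (h : GD D f G K) {Φ : E → ℝ} (hΦ : Tst K Φ) (k : ℕ) : IsUU f G Φ k (UU f G Φ k) := by
  have : ∃ u, IsUU f G Φ k u := h.exists_u hΦ (eta_cd k) (eta_cs k)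
  unfold UU
  rw [dif_pos this]
  exact this.choose_spec

theorem GD.fcpt (h : GD D f G K) {S : Set E} (hS : IsCompact S) (hSK : S ⊆ K) : IsCompact (f '' S) :=
  hS.image_of_continuousOn (h.cont.mono (hSK.trans h.sub))

/-- support set -/
theorem GD.uu_supp (h : GD D f G K) {Φ : E → ℝ} (hΦ : Tst K Φ) (k : ℕ) (y : E) (hy : y ∉ cthickening (1 / (k + 1)) (f '' tsupport Φ)) :
    UU f G Φ k y = 0 := by
  refine (h.uu hΦ k).2 y fun x hx hyx => hy ?_
  rw [eta_ts, mem_closedBall, dist_zero_right] at hyx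
  refine mem_cthickening_of_dist_le y (f x) _ _ (mem_image_of_mem _ hx) ?_
  rwa [dist_eq_norm]

theorem GD.uu_cs (h : GD D f G K) {Φ : E → ℝ} (hΦ : Tst K Φ) (k : ℕ) : HasCompactSupport (UU f G Φ k) :=
  HasCompactSupport.intro ((h.fcpt hΦ.cs (hΦ.ts.trans interior_subset)).cthickening (r := 1 / (k + 1)))
    fun y hy => h.uu_supp hΦ k y hy

theorem GD.uu_fd (h : GD D f G K) {Φ : E → ℝ} (hΦ : Tst K Φ) (k : ℕ) : fderiv ℝ (UU f G Φ k) = UD f G Φ (eta k) := by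
  ext1 y; exact ((h.uu hΦ k).1 y).fderiv

theorem GD.uu_cd (h : GD D f G K) {Φ : E → ℝ} (hΦ : Tst K Φ) (k : ℕ) : ContDiff ℝ 1 (UU f G Φ k) := by
  rw [contDiff_one_iff_fderiv, h.uu_fd hΦ]
  exact ⟨fun y => ((h.uu hΦ k).1 y).differentiableAt, h.UD_cont hΦ (eta_cd k).continuous (eta_cs k)⟩

theorem Tst.sub {Φ Ψ : E → ℝ} (hΦ : Tst K Φ) (hΨ : Tst K Ψ) : Tst K (fun x => Φ x - Ψ x) where
  cd := hΦ.cd.sub hΨ.cd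
  cs := hΦ.cs.sub hΨ.cs
  ts := (tsupport_sub Φ Ψ).trans (union_subset hΦ.ts hΨ.ts)

theorem GD.uu_sub (h : GD D f G K) {Φ Ψ : E → ℝ} (hΦ : Tst K Φ) (hΨ : Tst K Ψ) (k : ℕ) (y : E) :
    UU f G (fun x => Φ x - Ψ x) k y = UU f G Φ k y - UU f G Ψ k y := by
  have hΘ := hΦ.sub hΨ
  have hUD : ∀ y, UD f G (fun x => Φ x - Ψ x) (eta k) y = UD f G Φ (eta k) y - UD f G Ψ (eta k) y := by
    intro y
    unfold UD
    rw [← integral_sub (h.UDi_int' hΦ (eta_cd k).continuous (eta_cs k) y) (h.UDi_int' hΨ (eta_cd k).continuous (eta_cs k) y)]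
    congr 1; ext1 x
    unfold UDi
    rw [fderiv_fun_sub (hΦ.cd.differentiable one_ne_zero x) (hΨ.cd.differentiable one_ne_zero x), ContinuousLinearMap.sub_comp, smul_sub]
  set w : E → ℝ := fun y => UU f G (fun x => Φ x - Ψ x) k y - (UU f G Φ k y - UU f G Ψ k y) with hw
  have hw0 : ∀ y, HasFDerivAt w (0 : E →L[ℝ] ℝ) y := by
    intro y
    have := ((h.uu hΘ k).1 y).fun_sub (((h.uu hΦ k).1 y).fun_sub ((h.uu hΨ k).1 y))
    rwa [hUD, sub_self] at this
  have hcs : HasCompactSupport w := (h.uu_cs hΘ k).sub ((h.uu_cs hΦ k).sub (h.uu_cs hΨ k))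
  obtain ⟨z, hz⟩ := exists_far hcs h.dim
  have := is_const_of_fderiv_eq_zero (𝕜 := ℝ) (f := w) (fun y => (hw0 y).differentiableAt) (fun y => (hw0 y).fderiv) y z
  rw [image_eq_zero_of_notMem_tsupport hz] at this
  exact sub_eq_zero.1 this

/-- separation -/
theorem GD.sep (h : GD D f G K) (hinj : InjOn f D) {A B : Set E} (hA : IsCompact A) (hB : IsCompact B) (hAK : A ⊆ K) (hBK : B ⊆ K)
    (hd : Disjoint A B) : ∀ᶠ k : ℕ in atTop, ∀ a ∈ A, ∀ b ∈ B, f a - f b ∉ closedBall (0:E) (1 / (k + 1)) := by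
  have hdis : Disjoint (f '' A) (f '' B) := by
    rw [Set.disjoint_left]
    rintro _ ⟨a, ha, rfl⟩ ⟨b, hb, hab⟩
    have := hinj (h.sub (hBK hb)) (h.sub (hAK ha)) hab
    exact Set.disjoint_left.1 hd ha (this ▸ hb)
  obtain ⟨δ, hδ, hD⟩ := hdis.exists_thickenings (h.fcpt hA hAK) (h.fcpt hB hBK).isClosed
  filter_upwards [(tendsto_one_div_add_atTop_nhds_zero_nat (𝕜 := ℝ)).eventually_lt_const hδ] with k hk a ha b hb hab
  rw [mem_closedBall, dist_zero_right, ← dist_eq_norm] at hab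
  refine Set.disjoint_left.1 hD (self_subset_thickening hδ _ (mem_image_of_mem _ ha)) ?_
  exact mem_thickening_iff.2 ⟨f b, mem_image_of_mem _ hb, hab.trans_lt hk⟩

/-- locality -/
theorem GD.uu_loc (h : GD D f G K) (hinj : InjOn f D) {Φ Ψ : E → ℝ} (hΦ : Tst K Φ) (hΨ : Tst K Ψ) (x : E) (a b : ℝ) (hab : b < a)
    (haK : closedBall x b ⊆ K) (he : ∀ z ∈ ball x a, Φ z = Ψ z) :
    ∀ᶠ k : ℕ in atTop, ∀ z ∈ closedBall x b, UU f G Φ k (f z) = UU f G Ψ k (f z) := by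
  have hΘ := hΦ.sub hΨ
  have hts : tsupport (fun x => Φ x - Ψ x) ⊆ (ball x a)ᶜ := by
    refine closure_minimal (fun z hz hz' => hz ?_) isOpen_ball.isClosed_compl
    show Φ z - Ψ z = 0
    rw [he z hz', sub_self]
  have hd : Disjoint (closedBall x b) (tsupport (fun x => Φ x - Ψ x)) := by
    rw [Set.disjoint_left]
    intro z hz hz'
    exact hts hz' (closedBall_subset_ball hab hz)
  filter_upwards [h.sep hinj (isCompact_closedBall x b) hΘ.cs haK (hΘ.ts.trans interior_subset) hd] with k hk z hz
  have := (h.uu hΘ k).2 (f z) fun w hw => by rw [eta_ts]; exact hk z hz w hw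
  rw [h.uu_sub hΦ hΨ] at this
  exact sub_eq_zero.1 this

/-- constancy -/
theorem GD.uu_const (h : GD D f G K) (hinj : InjOn f D) (hop : ∀ U ⊆ D, IsOpen U → IsOpen (f '' U)) {Φ : E → ℝ} (hΦ : Tst K Φ)
    (x : E) (a b : ℝ) (hab : b < a) (hb : 0 < b)
    (haK : closedBall x b ⊆ K) (he : ∀ z ∈ ball x a, Φ z = 1) :
    ∀ᶠ k : ℕ in atTop, ∀ z ∈ ball x b, UU f G Φ k (f z) = UU f G Φ k (f x) := by
  have hd : Disjoint (closedBall x b) (tsupport Φ \ ball x a) := by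
    rw [Set.disjoint_left]
    intro z hz hz'
    exact hz'.2 (closedBall_subset_ball hab hz)
  filter_upwards [h.sep hinj (isCompact_closedBall x b) (hΦ.cs.diff isOpen_ball) haK
    (sdiff_subset.trans (hΦ.ts.trans interior_subset)) hd] with k hk z hz
  have hsub : ball x b ⊆ D := ball_subset_closedBall.trans (haK.trans h.sub)
  have hO := hop _ hsub isOpen_ball
  have hC : IsPreconnected (f '' ball x b) := (convex_ball x b).isPreconnected.image _ (h.cont.mono hsub)
  refine hO.is_const_of_fderiv_eq_zero hC ((h.uu_cd hΦ k).differentiable one_ne_zero).differentiableOn ?_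
    (mem_image_of_mem _ hz) (mem_image_of_mem _ (mem_ball_self hb))
  rintro _ ⟨w, hw, rfl⟩
  rw [h.uu_fd hΦ]
  show UD f G Φ (eta k) (f w) = 0
  unfold UD
  have : ∀ t, UDi f G Φ (eta k) (f w) t = 0 := by
    intro t
    by_cases ht : t ∈ tsupport Φ
    · by_cases hta : t ∈ ball x a
      · have : fderiv ℝ Φ t = 0 := by
          have : Φ =ᶠ[𝓝 t] fun _ => 1 := by
            filter_upwards [isOpen_ball.mem_nhds hta] with s hs using he s hs
          rw [this.fderiv_eq]; simp
        unfold UDi; rw [this]; simp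
      · have := hk w (ball_subset_closedBall hw) t ⟨ht, hta⟩
        rw [← eta_ts] at this
        unfold UDi
        rw [image_eq_zero_of_notMem_tsupport this, zero_smul]
    · exact UDi_zero _ _ _ _ _ _ ht
  simp [this]

end M5a

section M5b
universe u
variable {E : Type u} [NormedAddCommGroup E] [NormedSpace ℝ E] [FiniteDimensional ℝ E] [MeasureSpace E] [BorelSpace E]
  [(volume : Measure E).IsAddHaarMeasure]
variable {D : Set E} {f : E → E} {G : E → E →L[ℝ] E} {K : Set E}

theorem gns1 (hd : 2 ≤ Module.finrank ℝ E) : ∃ C : ℝ≥0, ∀ u : E → ℝ, ContDiff ℝ 1 u → HasCompactSupport u → ∀ A : Set E,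
    ∫⁻ y in A, ‖u y‖ₑ ≤ C * (∫⁻ y, ‖fderiv ℝ u y‖ₑ) * volume A ^ (1 / (Module.finrank ℝ E : ℝ)) := by
  set n := Module.finrank ℝ E with hn
  have hn1 : (1:ℝ≥0) < n := by exact_mod_cast (by omega : 1 < n)
  have hc := NNReal.HolderConjugate.conjExponent hn1
  set p := NNReal.conjExponent (n:ℝ≥0) with hp
  refine ⟨eLpNormLESNormFDerivOneConst (volume : Measure E) p, fun u hu hus A => ?_⟩
  have h1 := eLpNorm_le_eLpNorm_fderiv_one (volume : Measure E) hu hus (p := p) hc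
  have hp1 : (1:ℝ≥0∞) ≤ p := by exact_mod_cast hc.symm.lt.le
  have h2 := eLpNorm_le_eLpNorm_mul_rpow_measure_univ (μ := volume.restrict A) hp1 hu.continuous.aestronglyMeasurable
  rw [eLpNorm_one_eq_lintegral_enorm, Measure.restrict_apply_univ] at h2
  rw [eLpNorm_one_eq_lintegral_enorm] at h1
  refine h2.trans ?_
  have e : 1 / (1:ℝ≥0∞).toReal - 1 / ((p:ℝ≥0∞)).toReal = 1 / (n:ℝ) := by
    have := hc.coe.inv_add_inv_eq_one
    simp only [ENNReal.toReal_one, ENNReal.coe_toReal, NNReal.coe_natCast, one_div] at *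
    rw [inv_one]; linarith
  rw [e]
  gcongr
  exact (eLpNorm_mono_measure _ Measure.restrict_le_self).trans h1

theorem GD.fmeas (h : GD D f G K) {S : Set E} (hS : IsCompact S) (hSK : S ⊆ K) : AEStronglyMeasurable f (volume.restrict S) :=
    ((h.cont.mono (hSK.trans h.sub)).aestronglyMeasurable_of_isCompact hS hS.measurableSet)

/-- L1 bound of the gradient -/
theorem GD.grad_L1 (h : GD D f G K) {Φ : E → ℝ} (hΦ : Tst K Φ) (k : ℕ) :
    ∫⁻ y, ‖UD f G Φ (eta k) y‖ₑ ≤ ∫⁻ x in tsupport Φ, ‖fderiv ℝ Φ x‖ₑ * ‖adjL (G x)‖ₑ := by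
  set S := tsupport Φ with hS
  have hSK : S ⊆ K := hΦ.ts.trans interior_subset
  have m1 := h.fmeas hΦ.cs hSK
  have m3 : AEStronglyMeasurable (fun x => adjL (G x)) (volume.restrict S) := (h.adj_int.mono_set hSK).aestronglyMeasurable
  have m4 : AEStronglyMeasurable (fderiv ℝ Φ) (volume.restrict S) :=
    (hΦ.cd.continuous_fderiv one_ne_zero).aestronglyMeasurable
  have m5 : AEMeasurable (fun x => ‖fderiv ℝ Φ x‖ₑ * ‖adjL (G x)‖ₑ) (volume.restrict S) := m4.enorm.mul m3.enorm
  calc _ ≤ ∫⁻ y, ∫⁻ x in S, ENNReal.ofReal (eta k (y - f x)) * (‖fderiv ℝ Φ x‖ₑ * ‖adjL (G x)‖ₑ) := by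
        refine lintegral_mono fun y => ?_
        rw [UD_eq_set f G Φ _ y subset_rfl]
        refine (enorm_integral_le_lintegral_enorm _).trans (lintegral_mono fun x => ?_)
        have := UDi_norm_le f G Φ (eta k) y x
        rw [abs_of_nonneg (eta_nn k _)] at this
        rw [← ofReal_norm, ← ofReal_norm (fderiv ℝ Φ x), ← ofReal_norm (adjL (G x)), ← ENNReal.ofReal_mul (norm_nonneg _),
          ← ENNReal.ofReal_mul (eta_nn k _)]
        exact ENNReal.ofReal_le_ofReal this
    _ = ∫⁻ x in S, ∫⁻ y, ENNReal.ofReal (eta k (y - f x)) * (‖fderiv ℝ Φ x‖ₑ * ‖adjL (G x)‖ₑ) := by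
        refine lintegral_lintegral_swap (f := fun y x => ENNReal.ofReal (eta k (y - f x)) * (‖fderiv ℝ Φ x‖ₑ * ‖adjL (G x)‖ₑ)) ?_
        refine AEMeasurable.mul ?_ m5.comp_snd
        have : AEStronglyMeasurable (fun p : E × E => p.1 - f p.2) (volume.prod (volume.restrict S)) :=
          continuous_fst.aestronglyMeasurable.sub m1.comp_snd
        exact ((eta_cd k).continuous.comp_aestronglyMeasurable this).aemeasurable.ennreal_ofReal
    _ = _ := by
        refine lintegral_congr fun x => ?_
        have hm : Measurable fun y => ENNReal.ofReal (eta k (y - f x)) :=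
          ((eta_cd k).continuous.comp (continuous_id.sub continuous_const)).measurable.ennreal_ofReal
        rw [lintegral_mul_const _ hm,
          eta_lint, one_mul]

/-- pairing -/
theorem GD.pairing (h : GD D f G K) {Φ : E → ℝ} (hΦ : Tst K Φ) (k : ℕ) (ψ : E → ℝ) (hψ : ContDiff ℝ 1 ψ) (hψc : HasCompactSupport ψ)
    (v : E) : ∫ y, UU f G Φ k y * fderiv ℝ ψ y v =
      - ∫ x in tsupport Φ, fderiv ℝ Φ x (adjL (G x) v) * ∫ y, eta k (y - f x) * ψ y := by
  set S := tsupport Φ with hS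
  have hSK : S ⊆ K := hΦ.ts.trans interior_subset
  have hu := h.uu_cd hΦ k
  have hc1 : Continuous fun y => fderiv ℝ ψ y v := (hψ.continuous_fderiv one_ne_zero).clm_apply continuous_const
  have hc2 : Continuous fun y => fderiv ℝ (UU f G Φ k) y v := (hu.continuous_fderiv one_ne_zero).clm_apply continuous_const
  rw [integral_mul_fderiv_eq_neg_fderiv_mul_of_integrable
    ((hc2.mul hψ.continuous).integrable_of_hasCompactSupport hψc.mul_left)
    ((hu.continuous.mul hc1).integrable_of_hasCompactSupport (h.uu_cs hΦ k).mul_right)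
    ((hu.continuous.mul hψ.continuous).integrable_of_hasCompactSupport hψc.mul_left)
    (fun y _ => hu.differentiable one_ne_zero y) (fun y _ => hψ.differentiable one_ne_zero y)]
  congr 1
  have m1 := h.fmeas hΦ.cs hSK
  have m3 : AEStronglyMeasurable (fun x => adjL (G x) v) (volume.restrict S) :=
    (ContinuousLinearMap.apply ℝ E v).continuous.comp_aestronglyMeasurable (h.adj_int.mono_set hSK).aestronglyMeasurable
  obtain ⟨C, hC0, hC⟩ := hΦ.dbound
  obtain ⟨M, hM⟩ := (eta_cs (E := E) k).exists_bound_of_continuous (eta_cd k).continuous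
  have i1 : IntegrableOn (fun x => fderiv ℝ Φ x (adjL (G x) v)) S := by
    refine ((h.adj_int.mono_set hSK).norm.const_mul (C * ‖v‖)).mono' ?_ (Eventually.of_forall fun x => ?_)
    · have hcc : Continuous fun p : (E →L[ℝ] ℝ) × E => p.1 p.2 := by fun_prop
      exact hcc.comp_aestronglyMeasurable ((hΦ.cd.continuous_fderiv one_ne_zero).aestronglyMeasurable.prodMk m3)
    · calc _ ≤ ‖fderiv ℝ Φ x‖ * (‖adjL (G x)‖ * ‖v‖) := (ContinuousLinearMap.le_opNorm _ _).trans
            (by gcongr; exact ContinuousLinearMap.le_opNorm _ _)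
        _ ≤ C * (‖adjL (G x)‖ * ‖v‖) := by gcongr; exact hC x
        _ = _ := by ring
  have i2 : Integrable ψ := hψ.continuous.integrable_of_hasCompactSupport hψc
  have hprod : Integrable (fun p : E × E => eta k (p.1 - f p.2) * (ψ p.1 * fderiv ℝ Φ p.2 (adjL (G p.2) v)))
      (volume.prod (volume.restrict S)) := by
    have := i2.mul_prod i1
    refine this.bdd_mul (c := M) ?_ (Eventually.of_forall fun p => hM _)
    have : AEStronglyMeasurable (fun p : E × E => p.1 - f p.2) (volume.prod (volume.restrict S)) :=
      continuous_fst.aestronglyMeasurable.sub m1.comp_snd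
    exact (eta_cd k).continuous.comp_aestronglyMeasurable this
  have e1 : ∀ y, fderiv ℝ (UU f G Φ k) y v * ψ y = ∫ x in S, eta k (y - f x) * (ψ y * fderiv ℝ Φ x (adjL (G x) v)) := by
    intro y
    rw [h.uu_fd hΦ, UD_eq_set f G Φ _ y subset_rfl,
      ContinuousLinearMap.integral_apply (h.UDi_int hΦ (eta_cd k).continuous (eta_cs k) y), ← integral_mul_const]
    refine integral_congr_ae (Eventually.of_forall fun x => ?_)
    simp only [UDi, smul_apply, ContinuousLinearMap.comp_apply, smul_eq_mul]
    ring
  simp_rw [e1]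
  rw [integral_integral_swap hprod]
  refine integral_congr_ae (Eventually.of_forall fun x => ?_)
  simp only
  rw [← integral_const_mul]
  congr 1; ext1 y; ring

theorem eta_conv (k : ℕ) (ψ : E → ℝ) (hψ : ContDiff ℝ 1 ψ) (hψc : HasCompactSupport ψ) (L : ℝ) (hL0 : 0 ≤ L)
    (hL : ∀ x y, |ψ x - ψ y| ≤ L * ‖x - y‖) (w : E) :
    |(∫ y, eta k (y - w) * ψ y) - ψ w| ≤ L / (k + 1) := by
  have hi : Integrable fun y => eta k (y - w) := 
    ((eta_cd k).continuous.integrable_of_hasCompactSupport (eta_cs k)).comp_sub_right w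
  have hcont : Continuous fun y => eta k (y - w) := (eta_cd k).continuous.comp (continuous_id.sub continuous_const)
  have i1 : Integrable fun y => eta k (y - w) * ψ y := 
    (hcont.mul hψ.continuous).integrable_of_hasCompactSupport hψc.mul_left
  have e0 : ∫ y, eta k (y - w) = 1 := by
    rw [integral_sub_right_eq_self (eta k) w, eta_int]
  have e : ψ w = ∫ y, eta k (y - w) * ψ w := by rw [integral_mul_const, e0, one_mul]
  rw [e]
  rw [← integral_sub i1 (hi.mul_const _), ← Real.norm_eq_abs]
  calc _ ≤ ∫ y, eta k (y - w) * (L / (k + 1)) := by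
        refine norm_integral_le_of_norm_le (hi.mul_const _) (Eventually.of_forall fun y => ?_)
        rw [← mul_sub, norm_mul, Real.norm_of_nonneg (eta_nn k _)]
        by_cases hy : y - w ∈ tsupport (eta (E := E) k)
        · refine mul_le_mul_of_nonneg_left ?_ (eta_nn k _)
          rw [eta_ts, mem_closedBall, dist_zero_right] at hy
          refine (hL y w).trans ?_
          rw [div_eq_mul_one_div]
          gcongr
        · rw [image_eq_zero_of_notMem_tsupport hy]; simp
    _ = _ := by rw [integral_mul_const, e0, one_mul]

end M5b

section M6a
universe u
variable {E : Type u} [NormedAddCommGroup E] [NormedSpace ℝ E] [FiniteDimensional ℝ E] [MeasureSpace E] [BorelSpace E]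
  [(volume : Measure E).IsAddHaarMeasure]
variable {D : Set E} {f : E → E} {G : E → E →L[ℝ] E} {K : Set E}

theorem norm_lim (x : E) (h : ℝ → ℝ≥0∞) (L : ℝ≥0∞) (hL : L ≠ ⊤)
    (hh : Tendsto (fun r => h r / volume (closedBall x r)) (𝓝[>] 0) (𝓝 L)) :
    Tendsto (fun r : ℝ => (h r).toReal / r ^ Module.finrank ℝ E) (𝓝[>] 0) (𝓝 (L.toReal * volume.real (closedBall (0:E) 1))) := by
  have h1 := ((ENNReal.tendsto_toReal hL).comp hh).mul_const (volume.real (closedBall (0:E) 1))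
  refine h1.congr' ?_
  filter_upwards [self_mem_nhdsWithin] with r hr
  have hr' : 0 < r := hr
  simp only [Function.comp]
  rw [ENNReal.toReal_div, ← measureReal_def, Measure.addHaar_real_closedBall' _ _ hr'.le]
  have : 0 < volume.real (closedBall (0:E) 1) := by
    refine ENNReal.toReal_pos (measure_closedBall_pos _ _ one_pos).ne' measure_closedBall_lt_top.ne
  field_simp

theorem exists_mu (hK : IsCompact K) (hc : ContinuousOn f K) (hinj : InjOn f K) :
    ∃ μ : Measure E, IsFiniteMeasure μ ∧ ∀ B, MeasurableSet B → μ B = volume (f '' (K ∩ B)) := by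
  have hfK : IsCompact (f '' K) := hK.image_of_continuousOn hc
  rcases K.eq_empty_or_nonempty with hKe | ⟨z, hz⟩
  · refine ⟨0, inferInstance, fun B _ => by simp [hKe]⟩
  let g : E → E := fun y => if h : ∃ x ∈ K, f x = y then h.choose else z
  have hg : ∀ x ∈ K, g (f x) = x := by
    intro x hx
    have : ∃ x' ∈ K, f x' = f x := ⟨x, hx, rfl⟩
    simp only [g]; rw [dif_pos this]
    exact hinj this.choose_spec.1 hx this.choose_spec.2
  have hgn : ∀ y ∉ f '' K, g y = z := by
    intro y hy
    simp only [g]; rw [dif_neg]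
    rintro ⟨x, hx, rfl⟩; exact hy ⟨x, hx, rfl⟩
  have hgm : Measurable g := by
    refine measurable_of_isClosed fun F hF => ?_
    have h1 : MeasurableSet (f '' (K ∩ F)) :=
      ((hK.inter_right hF).image_of_continuousOn (hc.mono inter_subset_left)).measurableSet
    by_cases hzF : z ∈ F
    · have : g ⁻¹' F = f '' (K ∩ F) ∪ (f '' K)ᶜ := by
        ext y
        by_cases hy : y ∈ f '' K
        · obtain ⟨x, hx, rfl⟩ := hy
          simp only [mem_preimage, hg x hx, mem_union, mem_compl_iff, mem_image_of_mem f hx, not_true, or_false]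
          refine ⟨fun h => ⟨x, ⟨hx, h⟩, rfl⟩, ?_⟩
          rintro ⟨w, hw, hwx⟩
          rw [← hinj hw.1 hx hwx]; exact hw.2
        · simp only [mem_preimage, hgn y hy, hzF, mem_union, mem_compl_iff, hy, not_false_eq_true, or_true]
      rw [this]; exact h1.union hfK.measurableSet.compl
    · have : g ⁻¹' F = f '' (K ∩ F) := by
        ext y
        by_cases hy : y ∈ f '' K
        · obtain ⟨x, hx, rfl⟩ := hy
          simp only [mem_preimage, hg x hx]
          refine ⟨fun h => ⟨x, ⟨hx, h⟩, rfl⟩, ?_⟩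
          rintro ⟨w, hw, hwx⟩
          rw [← hinj hw.1 hx hwx]; exact hw.2
        · simp only [mem_preimage, hgn y hy, hzF, false_iff]
          rintro ⟨w, hw, rfl⟩; exact hy ⟨w, hw.1, rfl⟩
      rw [this]; exact h1
  refine ⟨(volume.restrict (f '' K)).map g, ?_, fun B hB => ?_⟩
  · have : IsFiniteMeasure (volume.restrict (f '' K)) := ⟨by rw [Measure.restrict_apply_univ]; exact hfK.measure_lt_top⟩
    infer_instance
  · rw [Measure.map_apply hgm hB, Measure.restrict_apply (hgm hB)]
    congr 1
    ext y
    constructor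
    · rintro ⟨h1, x, hx, rfl⟩
      rw [mem_preimage, hg x hx] at h1
      exact ⟨x, ⟨hx, h1⟩, rfl⟩
    · rintro ⟨x, ⟨hx, hxB⟩, rfl⟩
      exact ⟨by rwa [mem_preimage, hg x hx], x, hx, rfl⟩

theorem vol_ann (hK : IsCompact K) (hc : ContinuousOn f K) (hinj : InjOn f K) :
    ∀ᵐ x : E, ∃ m : ℝ, 0 ≤ m ∧ ∀ a b : ℝ, 0 < a → a < b → ∀ ε : ℝ, 0 < ε → ∀ᶠ r in 𝓝[>] (0:ℝ),
      volume (f '' (K ∩ (closedBall x (b * r) \ closedBall x (a * r)))) ≤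
        ENNReal.ofReal ((m * (b ^ Module.finrank ℝ E - a ^ Module.finrank ℝ E) + ε) * r ^ Module.finrank ℝ E) := by
  obtain ⟨μ, hμ, hμe⟩ := exists_mu hK hc hinj
  filter_upwards [Besicovitch.ae_tendsto_rnDeriv μ (volume : Measure E), μ.rnDeriv_lt_top volume] with x hx hx'
  set n := Module.finrank ℝ E
  have hl := norm_lim x _ _ hx'.ne hx
  set m := (μ.rnDeriv volume x).toReal * volume.real (closedBall (0:E) 1) with hm
  have hm0 : 0 ≤ m := by positivity
  refine ⟨m, hm0, fun a b ha hab ε hε => ?_⟩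
  have hb : 0 < b := ha.trans hab
  have hsc : ∀ c : ℝ, 0 < c → Tendsto (fun r : ℝ => (μ (closedBall x (c * r))).toReal / r ^ n) (𝓝[>] 0) (𝓝 (m * c ^ n)) := by
    intro c hcp
    have ht : Tendsto (fun r : ℝ => c * r) (𝓝[>] 0) (𝓝[>] 0) := by
      refine tendsto_nhdsWithin_iff.2 ⟨?_, ?_⟩
      · have : Tendsto (fun r : ℝ => c * r) (𝓝 0) (𝓝 (c * 0)) := (continuous_const.mul continuous_id).tendsto 0
        rw [mul_zero] at this
        exact this.mono_left nhdsWithin_le_nhds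
      · filter_upwards [self_mem_nhdsWithin] with r hr using mul_pos hcp hr
    refine ((hl.comp ht).mul_const (c ^ n)).congr' ?_
    filter_upwards [self_mem_nhdsWithin] with r hr
    have hr' : (0:ℝ) < r := hr
    simp only [Function.comp]
    rw [mul_pow]; field_simp; rfl
  have hlim := (hsc b hb).sub (hsc a ha)
  have hlt : m * b ^ n - m * a ^ n < m * (b ^ n - a ^ n) + ε := by linarith
  filter_upwards [hlim.eventually_lt_const hlt, self_mem_nhdsWithin] with r hr hr0
  have hr' : (0:ℝ) < r := hr0
  rw [← hμe _ (measurableSet_closedBall.diff measurableSet_closedBall),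
    measure_sdiff (closedBall_subset_closedBall (by nlinarith)) measurableSet_closedBall.nullMeasurableSet (measure_ne_top _ _)]
  rw [← ENNReal.ofReal_toReal (measure_ne_top μ (closedBall x (b * r))),
    ← ENNReal.ofReal_toReal (measure_ne_top μ (closedBall x (a * r))), ← ENNReal.ofReal_sub _ ENNReal.toReal_nonneg]
  refine ENNReal.ofReal_le_ofReal ?_
  rw [← sub_div, div_lt_iff₀ (by positivity)] at hr
  exact hr.le

theorem leb_pt {F : Type*} [NormedAddCommGroup F] (g : E → F) (hg : LocallyIntegrable g) :
    ∀ᵐ x, ∀ ε : ℝ, 0 < ε → ∀ᶠ r in 𝓝[>] (0:ℝ), ∫⁻ y in closedBall x r, ‖g y - g x‖ₑ ≤ ENNReal.ofReal (ε * r ^ Module.finrank ℝ E) := by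
  filter_upwards [(Besicovitch.vitaliFamily (volume : Measure E)).ae_tendsto_lintegral_enorm_sub_div hg] with x hx ε hε
  have h1 := hx.comp (Besicovitch.tendsto_filterAt volume x)
  have hv : volume (closedBall (0:E) 1) ≠ 0 := (measure_closedBall_pos _ _ one_pos).ne'
  have hv' : volume (closedBall (0:E) 1) ≠ ⊤ := measure_closedBall_lt_top.ne
  have hpos : 0 < ENNReal.ofReal ε / volume (closedBall (0:E) 1) := ENNReal.div_pos (by simpa using hε) hv'
  filter_upwards [h1.eventually_le_const hpos, self_mem_nhdsWithin] with r hr hr0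
  have hr' : (0:ℝ) < r := hr0
  simp only [Function.comp] at hr
  rw [ENNReal.div_le_iff (measure_closedBall_pos _ _ hr').ne' measure_closedBall_lt_top.ne, Measure.addHaar_closedBall' _ _ hr'.le,
    mul_comm (ENNReal.ofReal (r ^ _)), ← mul_assoc, ENNReal.div_mul_cancel hv hv', ← ENNReal.ofReal_mul hε.le] at hr
  exact hr

theorem dens_pt (A : Set E) (hA : MeasurableSet A) :
    ∀ᵐ x, x ∈ A → ∀ ε : ℝ, 0 < ε → ∀ᶠ r in 𝓝[>] (0:ℝ), volume (closedBall x r \ A) ≤ ENNReal.ofReal (ε * r ^ Module.finrank ℝ E) := by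
  filter_upwards [Besicovitch.ae_tendsto_measure_inter_div_of_measurableSet (volume : Measure E) hA.compl] with x hx hxA ε hε
  have hv : volume (closedBall (0:E) 1) ≠ 0 := (measure_closedBall_pos _ _ one_pos).ne'
  have hv' : volume (closedBall (0:E) 1) ≠ ⊤ := measure_closedBall_lt_top.ne
  have hpos : 0 < ENNReal.ofReal ε / volume (closedBall (0:E) 1) := ENNReal.div_pos (by simpa using hε) hv'
  have e : Aᶜ.indicator (1 : E → ℝ≥0∞) x = 0 := indicator_of_notMem (by simpa using hxA) _
  rw [e] at hx
  filter_upwards [hx.eventually_le_const hpos, self_mem_nhdsWithin] with r hr hr0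
  have hr' : (0:ℝ) < r := hr0
  rw [ENNReal.div_le_iff (measure_closedBall_pos _ _ hr').ne' measure_closedBall_lt_top.ne, Measure.addHaar_closedBall' _ _ hr'.le,
    mul_comm (ENNReal.ofReal (r ^ _)), ← mul_assoc, ENNReal.div_mul_cancel hv hv', ← ENNReal.ofReal_mul hε.le] at hr
  rwa [sdiff_eq, inter_comm]

/-- derivative not a.e. zero -/
theorem not_ae_zero (h : WD D f G) (hinj : InjOn f D) (hd : 2 ≤ Module.finrank ℝ E) (x0 : E) (R : ℝ) (hR : 0 < R) (hD : closedBall x0 R ⊆ D) :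
    ¬ ∀ᵐ x, x ∈ closedBall x0 R → G x = 0 := by
  intro h0
  set K := closedBall x0 R with hK
  have hKc : IsCompact K := isCompact_closedBall _ _
  have hGz : K.indicator G =ᵐ[volume] 0 := by
    filter_upwards [h0] with x hx
    by_cases hxK : x ∈ K
    · rw [indicator_of_mem hxK, hx hxK]; rfl
    · rw [indicator_of_notMem hxK]; rfl
  have hconst : ∀ φ : ContDiffBump (0 : E), φ.rOut ≤ R / 2 → ∀ x ∈ ball x0 (R / 2), mol φ (K.indicator f) x = mol φ (K.indicator f) x0 := by
    intro φ hφ x hx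
    refine isOpen_ball.is_const_of_fderiv_eq_zero (𝕜 := ℝ) (convex_ball x0 (R/2)).isPreconnected
      ((mol_contDiff φ _ (ind_int f hKc.measurableSet (h.intOnf hKc hD)).locallyIntegrable).differentiable one_ne_zero).differentiableOn ?_ hx
      (mem_ball_self (by linarith))
    intro z hz
    rw [fderiv_mol h hKc hD φ z, mol_apply]
    · show _ = (0 : E →L[ℝ] E)
      refine integral_eq_zero_of_ae ?_
      filter_upwards [hGz] with w hw
      rw [hw]; simp
    · intro w hw
      rw [mem_closedBall] at *
      rw [mem_ball] at hz
      have := dist_triangle w z x0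
      linarith
  have hae := mol_ae (K.indicator f) (ind_int f hKc.measurableSet (h.intOnf hKc hD)).locallyIntegrable
  have hev : ∀ᶠ k in atTop, (bseq (E := E) k).rOut ≤ R / 2 := bseq_tendsto.eventually_le_const (by linarith)
  -- two good points
  have hvol : volume (ball x0 (R / 2)) ≠ 0 := (measure_ball_pos _ _ (by linarith)).ne'
  obtain ⟨a, ha, ha'⟩ := Measure.exists_mem_of_measure_ne_zero_of_ae hvol (ae_restrict_of_ae hae)
  have hnt : Nontrivial E := Module.nontrivial_of_finrank_pos (R := ℝ) (by omega)
  have hvol2 : volume (ball x0 (R / 2) \ {a}) ≠ 0 := by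
    rw [measure_sdiff_null (measure_singleton a)]; exact hvol
  obtain ⟨b, hb, hb'⟩ := Measure.exists_mem_of_measure_ne_zero_of_ae hvol2 (ae_restrict_of_ae hae)
  have hsub : ball x0 (R / 2) ⊆ K := fun z hz => ball_subset_closedBall (ball_subset_ball (by linarith) hz)
  have hab : f a = f b := by
    rw [indicator_of_mem (hsub ha)] at ha'
    rw [indicator_of_mem (hsub hb.1)] at hb'
    refine tendsto_nhds_unique (ha'.congr' ?_) hb'
    filter_upwards [hev] with k hk
    rw [hconst _ hk a ha, hconst _ hk b hb.1]
  exact hb.2 (hinj (hD (hsub hb.1)) (hD (hsub ha)) hab.symm)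

end M6a

section M6b
universe u
variable {E : Type u} [NormedAddCommGroup E] [NormedSpace ℝ E] [FiniteDimensional ℝ E] [MeasureSpace E] [BorelSpace E]
  [(volume : Measure E).IsAddHaarMeasure]
variable {D : Set E} {f : E → E} {G : E → E →L[ℝ] E} {K : Set E}

structure BP (f : E → E) (G : E → E →L[ℝ] E) (K : Set E) (x1 : E) (A : Set E) (m : ℝ) : Prop where
  det : (G x1).det ≠ 0
  am : MeasurableSet A
  der : ∀ ε : ℝ, 0 < ε → ∀ᶠ r in 𝓝[>] (0:ℝ), ∀ x ∈ A ∩ closedBall x1 r, ‖f x - f x1 - G x1 (x - x1)‖ ≤ ε * r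
  dens : ∀ ε : ℝ, 0 < ε → ∀ᶠ r in 𝓝[>] (0:ℝ), volume (closedBall x1 r \ A) ≤ ENNReal.ofReal (ε * r ^ Module.finrank ℝ E)
  leb : ∀ ε : ℝ, 0 < ε → ∀ᶠ r in 𝓝[>] (0:ℝ), ∫⁻ y in closedBall x1 r, ‖adjL (G y) - adjL (G x1)‖ₑ ≤ ENNReal.ofReal (ε * r ^ Module.finrank ℝ E)
  m0 : 0 ≤ m
  vol : ∀ a b : ℝ, 0 < a → a < b → ∀ ε : ℝ, 0 < ε → ∀ᶠ r in 𝓝[>] (0:ℝ),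
      volume (f '' (K ∩ (closedBall x1 (b * r) \ closedBall x1 (a * r)))) ≤
        ENNReal.ofReal ((m * (b ^ Module.finrank ℝ E - a ^ Module.finrank ℝ E) + ε) * r ^ Module.finrank ℝ E)

theorem exists_bp (h : GD D f G K) (hinj : InjOn f D) (x0 : E) (R : ℝ) (hR : 0 < R) (hD : closedBall x0 (4 * R) ⊆ D)
    (hK : closedBall x0 R ⊆ interior K) (hfd : ∀ᵐ x, x ∈ K → (G x).det = 0 → G x = 0) :
    ∃ x1 ∈ closedBall x0 R, ∃ A m, BP f G K x1 A m := by
  set P := {x | x ∈ closedBall x0 R ∧ (G x).det ≠ 0} with hP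
  have hPne : volume P ≠ 0 := by
    intro h0
    refine not_ae_zero h.toWD hinj h.dim x0 R hR (hK.trans (interior_subset.trans h.sub)) ?_
    have h1 : ∀ᵐ x, x ∉ P := measure_eq_zero_iff_ae_notMem.1 h0
    filter_upwards [h1, hfd] with x hx1 hx2 hx3
    by_contra hG
    exact hx1 ⟨hx3, fun hdet => hG (hx2 (interior_subset (hK hx3)) hdet)⟩
  have hPfin : volume P ≠ ⊤ := ((measure_mono (fun x hx => hx.1)).trans_lt (measure_closedBall_lt_top (x := x0) (r := R))).ne
  obtain ⟨A, hAsub, hAm, hAv, hAd⟩ := approx_diff h.toWD x0 R hR hD (volume P / 2) (by simpa using hPne)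
  have hPA : volume (P ∩ A) ≠ 0 := by
    intro h0
    have h1 : volume P ≤ volume (P ∩ A) + volume (closedBall x0 R \ A) := by
      refine (measure_mono (t := (P ∩ A) ∪ (closedBall x0 R \ A)) fun x hx => ?_).trans (measure_union_le _ _)
      by_cases hxA : x ∈ A
      · exact Or.inl ⟨hx, hxA⟩
      · exact Or.inr ⟨hx.1, hxA⟩
    rw [h0, zero_add] at h1
    exact absurd (h1.trans hAv) (not_le.2 (ENNReal.half_lt_self hPne hPfin))
  have hloc : LocallyIntegrable (K.indicator fun x => adjL (G x)) :=
    (ind_int (fun x => adjL (G x)) h.cpt.measurableSet h.adj_int).locallyIntegrable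
  have a1 := vol_ann h.cpt (h.cont.mono h.sub) (hinj.mono h.sub)
  obtain ⟨x1, hx1, ⟨m, hm0, hm⟩, h2, h3⟩ := Measure.exists_mem_of_measure_ne_zero_of_ae hPA
    (ae_restrict_of_ae (a1.and ((leb_pt _ hloc).and (dens_pt A hAm))))
  refine ⟨x1, hx1.1.1, A, m, hx1.1.2, hAm, fun ε hε => ?_, h3 hx1.2, fun ε hε => ?_, hm0, hm⟩
  · have := (hAd x1 hx1.2).isLittleO.def hε
    rw [eventually_iff, mem_nhdsWithin_iff] at this
    obtain ⟨ρ, hρ, hs⟩ := this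
    filter_upwards [Ioo_mem_nhdsGT hρ] with r hr x hx
    have hxr : ‖x - x1‖ ≤ r := by rw [← dist_eq_norm]; exact hx.2
    have := hs ⟨mem_ball.2 (by rw [dist_eq_norm]; exact hxr.trans_lt hr.2), hx.1⟩
    exact (show ‖f x - f x1 - G x1 (x - x1)‖ ≤ ε * ‖x - x1‖ from this).trans (by gcongr)
  · have hx1K : x1 ∈ interior K := hK hx1.1.1
    obtain ⟨ρ, hρ, hsK⟩ := Metric.isOpen_iff.1 isOpen_interior x1 hx1K
    filter_upwards [h2 ε hε, Ioo_mem_nhdsGT hρ] with r hr hr2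
    refine le_trans (le_of_eq ?_) hr
    refine setLIntegral_congr_fun measurableSet_closedBall fun y hy => ?_
    have hyK : y ∈ K := interior_subset (hsK (mem_ball.2 ((mem_closedBall.1 hy).trans_lt hr2.2)))
    have e1 : (K.indicator fun x => adjL (G x)) y = adjL (G y) := indicator_of_mem hyK _
    have e2 : (K.indicator fun x => adjL (G x)) x1 = adjL (G x1) := indicator_of_mem (interior_subset hx1K) _
    simp only [e1, e2]

/-- fixed scale estimate -/
theorem GD.fix_r (h : GD D f G K) (hinj : InjOn f D) (hop : ∀ U ⊆ D, IsOpen U → IsOpen (f '' U)) (C : ℝ≥0)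
    (hC : ∀ u : E → ℝ, ContDiff ℝ 1 u → HasCompactSupport u → ∀ A : Set E,
    ∫⁻ y in A, ‖u y‖ₑ ≤ C * (∫⁻ y, ‖fderiv ℝ u y‖ₑ) * volume A ^ (1 / (Module.finrank ℝ E : ℝ)))
    (c : ℕ → ℝ) (hc : Tendsto c atTop (𝓝 0)) (x1 : E) (s b b' : ℝ) (hbb : b < b') (hK : closedBall x1 b' ⊆ K) (hsb : s ≤ b')
    {Φ : E → ℝ} (hΦ : Tst K Φ) (hΦs : tsupport Φ ⊆ closedBall x1 b)
    (hck : ∀ᶠ k in atTop, ∀ z ∈ closedBall x1 s, UU f G Φ k (f z) = c k)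
    (ψ : E → ℝ) (hψ : ContDiff ℝ 1 ψ) (hψc : HasCompactSupport ψ) (L : ℝ) (hL0 : 0 ≤ L) (hL : ∀ y, ‖fderiv ℝ ψ y‖ ≤ L) (v : E) (hv : ‖v‖ = 1) :
    ENNReal.ofReal |∫ x in tsupport Φ, fderiv ℝ Φ x (adjL (G x) v) * ψ (f x)| ≤
      ENNReal.ofReal L * (C * (∫⁻ x in tsupport Φ, ‖fderiv ℝ Φ x‖ₑ * ‖adjL (G x)‖ₑ) *
        volume (f '' (K ∩ (closedBall x1 b' \ closedBall x1 s))) ^ (1 / (Module.finrank ℝ E : ℝ))) := by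
  set S := tsupport Φ with hS
  have hSK : S ⊆ K := hΦ.ts.trans interior_subset
  set I := ∫⁻ x in S, ‖fderiv ℝ Φ x‖ₑ * ‖adjL (G x)‖ₑ with hI
  set V := volume (f '' (K ∩ (closedBall x1 b' \ closedBall x1 s))) with hV
  set n := Module.finrank ℝ E with hn
  set V0 := volume (f '' closedBall x1 s) with hV0
  have hV0f : V0 ≠ ⊤ := (h.fcpt (isCompact_closedBall x1 s) ((closedBall_subset_closedBall hsb).trans hK)).measure_lt_top.ne
  have hlip : ∀ x y, |ψ x - ψ y| ≤ L * ‖x - y‖ := by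
    intro x y
    exact Convex.norm_image_sub_le_of_norm_fderiv_le (𝕜 := ℝ) (fun z _ => hψ.differentiable one_ne_zero z) (fun z _ => hL z) convex_univ
      (mem_univ y) (mem_univ x)
  have m3 : AEStronglyMeasurable (fun x => adjL (G x) v) (volume.restrict S) :=
    (ContinuousLinearMap.apply ℝ E v).continuous.comp_aestronglyMeasurable (h.adj_int.mono_set hSK).aestronglyMeasurable
  obtain ⟨Cd, hCd0, hCd⟩ := hΦ.dbound
  have i1 : IntegrableOn (fun x => fderiv ℝ Φ x (adjL (G x) v)) S := by
    refine ((h.adj_int.mono_set hSK).norm.const_mul (Cd * ‖v‖)).mono' ?_ (Eventually.of_forall fun x => ?_)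
    · have hcc : Continuous fun p : (E →L[ℝ] ℝ) × E => p.1 p.2 := by fun_prop
      exact hcc.comp_aestronglyMeasurable ((hΦ.cd.continuous_fderiv one_ne_zero).aestronglyMeasurable.prodMk m3)
    · calc _ ≤ ‖fderiv ℝ Φ x‖ * (‖adjL (G x)‖ * ‖v‖) := (ContinuousLinearMap.le_opNorm _ _).trans
            (by gcongr; exact ContinuousLinearMap.le_opNorm _ _)
        _ ≤ Cd * (‖adjL (G x)‖ * ‖v‖) := by gcongr; exact hCd x
        _ = _ := by ring
  set J := ∫ x in S, ‖fderiv ℝ Φ x (adjL (G x) v)‖ with hJ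
  obtain ⟨Mψ, hMψ⟩ := hψc.exists_bound_of_continuous hψ.continuous
  have i2 : IntegrableOn (fun x => fderiv ℝ Φ x (adjL (G x) v) * ψ (f x)) S := by
    refine Integrable.mul_bdd (c := Mψ) i1 ?_ (Eventually.of_forall fun x => hMψ _)
    exact hψ.continuous.comp_aestronglyMeasurable (h.fmeas hΦ.cs hSK)
  -- eventual inequality
  have hopen : IsOpen (f '' ball x1 b') := hop _ (ball_subset_closedBall.trans (hK.trans h.sub)) isOpen_ball
  have hsub : f '' S ⊆ f '' ball x1 b' := image_mono (hΦs.trans (closedBall_subset_ball hbb))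
  obtain ⟨δ, hδ, hthick⟩ := (h.fcpt hΦ.cs hSK).exists_cthickening_subset_open hopen hsub
  have hev : ∀ᶠ k : ℕ in atTop, ENNReal.ofReal |∫ x in S, fderiv ℝ Φ x (adjL (G x) v) * ψ (f x)| ≤
      ENNReal.ofReal L * (ENNReal.ofReal |c k| * V0 + C * I * V ^ (1 / (n:ℝ))) + ENNReal.ofReal (L * (1 / (k + 1)) * J) := by
    filter_upwards [hck, (tendsto_one_div_add_atTop_nhds_zero_nat (𝕜 := ℝ)).eventually_le_const hδ] with k hk hkδ
    have hp := h.pairing hΦ k ψ hψ hψc v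
    set X := ∫ x in S, fderiv ℝ Φ x (adjL (G x) v) * ψ (f x) with hX
    set Y := ∫ x in S, fderiv ℝ Φ x (adjL (G x) v) * ∫ y, eta k (y - f x) * ψ y with hY
    have hcv := fun w => eta_conv k ψ hψ hψc L hL0 hlip w
    have hYX : |Y - X| ≤ L * (1 / (k + 1)) * J := by
      have i3 : IntegrableOn (fun x => fderiv ℝ Φ x (adjL (G x) v) * ∫ y, eta k (y - f x) * ψ y) S := by
        refine Integrable.mul_bdd (c := Mψ + L * (1 / (k+1))) i1 ?_ (Eventually.of_forall fun x => ?_)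
        · have : Continuous fun w => ∫ y, eta k (y - w) * ψ y := by
            have e : (fun w => ∫ y, eta k (y - w) * ψ y) = fun w => ∫ t, eta k t * ψ (t + w) := by
              ext1 w
              rw [← integral_sub_right_eq_self (fun t => eta k t * ψ (t + w)) w]
              simp
            rw [e]
            have hlw : LipschitzWith (Real.toNNReal L) fun w => ∫ t, eta k t * ψ (t + w) := by
              have ii : ∀ w, Integrable fun t => eta k t * ψ (t + w) := fun w =>
                Continuous.integrable_of_hasCompactSupport ((eta_cd k).continuous.mul (hψ.continuous.comp (by fun_prop))) (eta_cs k).mul_right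
              refine LipschitzWith.of_dist_le_mul fun w w' => ?_
              rw [dist_eq_norm, ← integral_sub (ii w) (ii w'), Real.coe_toNNReal _ hL0]
              calc _ ≤ ∫ t, eta k t * (L * dist w w') := by
                    refine norm_integral_le_of_norm_le (((eta_cd k).continuous.integrable_of_hasCompactSupport (eta_cs k)).mul_const _)
                      (Eventually.of_forall fun t => ?_)
                    rw [← mul_sub, norm_mul, Real.norm_of_nonneg (eta_nn k _)]
                    refine mul_le_mul_of_nonneg_left ?_ (eta_nn k _)
                    refine (hlip _ _).trans ?_
                    rw [add_sub_add_left_eq_sub, dist_eq_norm]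
                _ = _ := by rw [integral_mul_const, eta_int, one_mul]
            exact hlw.continuous
          exact this.comp_aestronglyMeasurable (h.fmeas hΦ.cs hSK)
        · have h1 := hcv (f x)
          have h2 := hMψ (f x)
          rw [Real.norm_eq_abs] at *
          rw [div_eq_mul_one_div] at h1
          calc _ = |((∫ y, eta k (y - f x) * ψ y) - ψ (f x)) + ψ (f x)| := by rw [sub_add_cancel]
            _ ≤ _ := abs_add_le _ _
            _ ≤ _ := by linarith
      rw [hX, hY, ← integral_sub i3 i2, ← Real.norm_eq_abs, hJ, ← integral_const_mul]
      refine norm_integral_le_of_norm_le (i1.norm.const_mul _) (Eventually.of_forall fun x => ?_)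
      rw [← mul_sub, norm_mul, mul_comm]
      refine mul_le_mul_of_nonneg_right ?_ (norm_nonneg _)
      rw [Real.norm_eq_abs, ← div_eq_mul_one_div]
      exact hcv _
    have hXb : |X| ≤ |Y| + L * (1 / (k + 1)) * J := by
      have := abs_sub_abs_le_abs_sub X Y
      rw [abs_sub_comm X Y] at this
      linarith
    refine (ENNReal.ofReal_le_ofReal hXb).trans (ENNReal.ofReal_add_le.trans ?_)
    gcongr
    -- bound Y
    have hYe : |Y| = ‖∫ y, UU f G Φ k y * fderiv ℝ ψ y v‖ := by rw [hp, norm_neg, Real.norm_eq_abs]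
    rw [hYe, ofReal_norm]
    have huc := (h.uu_cd hΦ k).continuous
    have hzero : ∀ y ∉ f '' closedBall x1 b', UU f G Φ k y = 0 := by
      intro y hy
      refine h.uu_supp hΦ k y fun hy' => hy ?_
      exact image_mono ball_subset_closedBall (hthick (cthickening_mono hkδ _ hy'))
    have hcov : f '' closedBall x1 b' ⊆ f '' closedBall x1 s ∪ f '' (K ∩ (closedBall x1 b' \ closedBall x1 s)) := by
      rintro _ ⟨x, hx, rfl⟩
      by_cases hxs : x ∈ closedBall x1 s
      · exact Or.inl ⟨x, hxs, rfl⟩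
      · exact Or.inr ⟨x, ⟨hK hx, hx, hxs⟩, rfl⟩
    calc _ ≤ ∫⁻ y, ‖UU f G Φ k y * fderiv ℝ ψ y v‖ₑ := enorm_integral_le_lintegral_enorm _
      _ ≤ ∫⁻ y, ENNReal.ofReal L * ‖UU f G Φ k y‖ₑ := by
          refine lintegral_mono fun y => ?_
          rw [enorm_mul, mul_comm]
          gcongr
          rw [← ofReal_norm]
          refine ENNReal.ofReal_le_ofReal ((ContinuousLinearMap.le_opNorm _ _).trans ?_)
          rw [hv, mul_one]; exact hL y
      _ = ENNReal.ofReal L * ∫⁻ y, ‖UU f G Φ k y‖ₑ := lintegral_const_mul _ huc.enorm.measurable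
      _ ≤ _ := by
          gcongr
          have e : ∫⁻ y, ‖UU f G Φ k y‖ₑ = ∫⁻ y in f '' closedBall x1 b', ‖UU f G Φ k y‖ₑ := by
            rw [setLIntegral_eq_of_support_subset]
            intro y hy
            by_contra hcon
            exact hy (by simp [hzero y hcon])
          rw [e]
          refine (lintegral_mono_set hcov).trans ((lintegral_union_le _ _ _).trans ?_)
          gcongr
          · have hms : MeasurableSet (f '' closedBall x1 s) :=
              (h.fcpt (isCompact_closedBall x1 s) ((closedBall_subset_closedBall hsb).trans hK)).measurableSet
            rw [← setLIntegral_const]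
            refine setLIntegral_mono measurable_const ?_
            rintro _ ⟨z, hz, rfl⟩
            rw [hk z hz, ← ofReal_norm, Real.norm_eq_abs]
          · refine (hC _ (h.uu_cd hΦ k) (h.uu_cs hΦ k) _).trans ?_
            gcongr
            rw [h.uu_fd hΦ]
            exact h.grad_L1 hΦ k
  have t1 : Tendsto (fun k => ENNReal.ofReal |c k| * V0) atTop (𝓝 0) := by
    have : Tendsto (fun k => ENNReal.ofReal |c k|) atTop (𝓝 0) := by
      have := ENNReal.tendsto_ofReal hc.abs
      simpa using this
    have := ENNReal.Tendsto.mul_const (b := V0) this (Or.inr hV0f)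
    rwa [zero_mul] at this
  have t2 : Tendsto (fun k : ℕ => ENNReal.ofReal (L * (1 / (k + 1)) * J)) atTop (𝓝 0) := by
    have := ((tendsto_one_div_add_atTop_nhds_zero_nat (𝕜 := ℝ)).const_mul L).mul_const J
    have := ENNReal.tendsto_ofReal this
    simpa using this
  have t3 := (ENNReal.Tendsto.const_mul (a := ENNReal.ofReal L) (t1.add_const (C * I * V ^ (1 / (n:ℝ)))) (Or.inr ENNReal.ofReal_ne_top)).add t2
  rw [zero_add, add_zero] at t3
  exact ge_of_tendsto t3 hev

end M6b

section M6c
universe u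
variable {E : Type u} [NormedAddCommGroup E] [NormedSpace ℝ E] [FiniteDimensional ℝ E] [MeasureSpace E] [BorelSpace E]
  [(volume : Measure E).IsAddHaarMeasure]
variable {D : Set E} {f : E → E} {G : E → E →L[ℝ] E} {K : Set E}

theorem exact_lb (A : E →L[ℝ] E) (v x1 : E) (l : E →L[ℝ] ℝ) (hlv : l v = 1) {Φ : E → ℝ} (hΦ : ContDiff ℝ 1 Φ)
    (hc : HasCompactSupport Φ) (h0 : ∀ z, 0 ≤ Φ z) (r : ℝ) (hr : 0 < r) (h1 : ∀ z ∈ closedBall x1 r, Φ z = 1) :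
    |A.det| * (volume.real (closedBall (0:E) 1) * r ^ Module.finrank ℝ E) ≤
      |∫ x, fderiv ℝ Φ x (adjL A v) * l (A (x - x1))| := by
  set w := adjL A v with hw
  have hlA : ∀ x, HasFDerivAt (fun x => l (A (x - x1))) (l.comp A) x := fun x => by
    have h1 := (l.comp A).hasFDerivAt (x := x - x1)
    have h2 := h1.comp x ((hasFDerivAt_id x).sub_const x1)
    rwa [ContinuousLinearMap.comp_id] at h2
  have hfd : ∀ x, fderiv ℝ (fun x => l (A (x - x1))) x w = A.det := fun x => by
    rw [(hlA x).fderiv, ContinuousLinearMap.comp_apply, hw, comp_adjL, map_smul, hlv]; simp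
  have c1 : Continuous fun x => l (A (x - x1)) := by fun_prop
  have c2 : Continuous fun x => fderiv ℝ Φ x w := (hΦ.continuous_fderiv one_ne_zero).clm_apply continuous_const
  have s2 : HasCompactSupport fun x => fderiv ℝ Φ x w :=
    (hc.fderiv ℝ).comp_left (g := fun L : E →L[ℝ] ℝ => L w) rfl
  have iΦ : Integrable Φ := hΦ.continuous.integrable_of_hasCompactSupport hc
  have key := integral_mul_fderiv_eq_neg_fderiv_mul_of_integrable (μ := (volume : Measure E)) (f := fun x => l (A (x - x1))) (g := Φ) (v := w)
    (by simp only [hfd]; exact iΦ.const_mul _)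
    ((c1.mul c2).integrable_of_hasCompactSupport s2.mul_left)
    ((c1.mul hΦ.continuous).integrable_of_hasCompactSupport hc.mul_left)
    (fun x _ => (hlA x).differentiableAt) (fun x _ => hΦ.differentiable one_ne_zero x)
  simp only [hfd] at key
  rw [integral_const_mul] at key
  have e : ∫ x, fderiv ℝ Φ x w * l (A (x - x1)) = -(A.det * ∫ x, Φ x) := by
    rw [← key]; exact integral_congr_ae (Eventually.of_forall fun x => mul_comm _ _)
  rw [e, abs_neg, abs_mul]
  refine mul_le_mul_of_nonneg_left ?_ (abs_nonneg _)
  refine le_trans ?_ (le_abs_self _)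
  have hv : volume.real (closedBall x1 r) = r ^ Module.finrank ℝ E * volume.real (closedBall (0:E) 1) :=
    Measure.addHaar_real_closedBall' _ x1 hr.le
  calc _ = volume.real (closedBall x1 r) := by rw [hv, mul_comm]
    _ = ∫ x in closedBall x1 r, Φ x := by
        rw [setIntegral_congr_fun measurableSet_closedBall h1]; simp
    _ ≤ ∫ x, Φ x := setIntegral_le_integral iΦ (Eventually.of_forall h0)

theorem exists_psi (y1 : E) (l : E →L[ℝ] ℝ) (hl : ‖l‖ ≤ 1) (M : ℝ) (hM : 0 < M) :
    ∃ ψ : E → ℝ, ContDiff ℝ 1 ψ ∧ HasCompactSupport ψ ∧ (∀ y, ‖fderiv ℝ ψ y‖ ≤ 5) ∧ (∀ y, |ψ y| ≤ 2 * M) ∧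
      ∀ y ∈ closedBall y1 M, ψ y = l (y - y1) := by
  obtain ⟨χ, hχ, hχ1, hχe, hχs, hχd⟩ := exists_cutoff y1 M (2 * M) hM.le (by linarith)
  have hcs : HasCompactSupport χ := (isCompact_closedBall y1 (2*M)).of_isClosed_subset (isClosed_tsupport χ) hχs
  have hln : ∀ z ∈ tsupport χ, |l (z - y1)| ≤ 2 * M := fun z hz => by
    have h1 : ‖z - y1‖ ≤ 2 * M := by rw [← dist_eq_norm]; exact hχs hz
    calc |l (z - y1)| ≤ ‖l‖ * ‖z - y1‖ := l.le_opNorm _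
      _ ≤ 1 * (2 * M) := by gcongr
      _ = _ := one_mul _
  have hlc : ContDiff ℝ 1 fun y => l (y - y1) := l.contDiff.comp (contDiff_id.sub contDiff_const)
  refine ⟨fun y => l (y - y1) * χ y, hlc.mul hχ, hcs.mul_left, fun y => ?_, fun y => ?_, fun y hy => ?_⟩
  · have hd1 : HasFDerivAt (fun y => l (y - y1)) l y := l.hasFDerivAt.comp y ((hasFDerivAt_id y).sub_const y1)
    have hd2 := (hχ.differentiable one_ne_zero y).hasFDerivAt
    rw [show (fun y => l (y - y1) * χ y) = ((fun y => l (y - y1)) * χ) from rfl, (hd1.mul hd2).fderiv]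
    by_cases hy : y ∈ tsupport χ
    · refine (norm_add_le _ _).trans ?_
      rw [norm_smul, norm_smul]
      have a1 : ‖l (y - y1)‖ * ‖fderiv ℝ χ y‖ ≤ (2 * M) * (2 / (2 * M - M)) := by
        gcongr
        · exact hln y hy
        · exact hχd y
      have a2 : ‖χ y‖ * ‖l‖ ≤ 1 * 1 := by
        gcongr
        rw [Real.norm_of_nonneg (hχ1 y).1]; exact (hχ1 y).2
      have a3 : (2 * M) * (2 / (2 * M - M)) = 4 := by
        rw [show 2 * M - M = M by ring]; field_simp; norm_num
      linarith
    · have e1 : fderiv ℝ χ y = 0 := image_eq_zero_of_notMem_tsupport fun h' => hy (tsupport_fderiv_subset ℝ h')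
      have e2 : χ y = 0 := image_eq_zero_of_notMem_tsupport hy
      rw [e1, e2]; simp
  · by_cases hy : y ∈ tsupport χ
    · rw [abs_mul]
      calc _ ≤ 2 * M * 1 := by
            gcongr
            · exact hln y hy
            · rw [abs_of_nonneg (hχ1 y).1]; exact (hχ1 y).2
        _ = _ := mul_one _
    · have e2 : χ y = 0 := image_eq_zero_of_notMem_tsupport hy
      simp only [e2, mul_zero, abs_zero]; linarith
  · simp only [hχe y hy, mul_one]

end M6c

section M6d
universe u
variable {E : Type u} [NormedAddCommGroup E] [NormedSpace ℝ E] [FiniteDimensional ℝ E] [MeasureSpace E] [BorelSpace E]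
  [(volume : Measure E).IsAddHaarMeasure]
variable {D : Set E} {f : E → E} {G : E → E →L[ℝ] E} {K : Set E}

theorem GD.err_bound (h : GD D f G K) (x1 : E) (A : Set E) (hA : MeasurableSet A) (ε r M δ : ℝ) (hε : 0 < ε) (hr : 0 < r)
    (hδ : 0 ≤ δ) (hM : 0 < M)
    (hder : ∀ x ∈ A ∩ closedBall x1 (2 * r), ‖f x - f x1 - G x1 (x - x1)‖ ≤ ε * (2 * r))
    (hdens : volume (closedBall x1 (2 * r) \ A) ≤ ENNReal.ofReal (ε * (2 * r) ^ Module.finrank ℝ E))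
    (hleb : ∫⁻ y in closedBall x1 (2 * r), ‖adjL (G y) - adjL (G x1)‖ₑ ≤ ENNReal.ofReal (ε * (2 * r) ^ Module.finrank ℝ E))
    (hK : closedBall x1 (2 * r) ⊆ K)
    {Φ : E → ℝ} (hΦ : ContDiff ℝ 1 Φ) (hΦd : ∀ z, ‖fderiv ℝ Φ z‖ ≤ δ / r) (l : E →L[ℝ] ℝ)
    (hMA : 2 * ‖G x1‖ ≤ M)
    (ψ : E → ℝ) (hψ : ContDiff ℝ 1 ψ) (hψd : ∀ y, ‖fderiv ℝ ψ y‖ ≤ 5) (hψM : ∀ y, |ψ y| ≤ 2 * (M * r))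
    (hψl : ∀ y ∈ closedBall (f x1) (M * r), ψ y = l (y - f x1)) (v : E) (hv : ‖v‖ = 1) :
    |(∫ x in closedBall x1 (2 * r), fderiv ℝ Φ x (adjL (G x) v) * ψ (f x)) -
      ∫ x in closedBall x1 (2 * r), fderiv ℝ Φ x (adjL (G x1) v) * l (G x1 (x - x1))| ≤
      ε * (δ * 2 ^ Module.finrank ℝ E * (2 * M + ‖adjL (G x1)‖ * (10 * volume.real (closedBall (0:E) 1) + 4 * M))) *
        r ^ Module.finrank ℝ E := by
  set n := Module.finrank ℝ E with hn
  set S := closedBall x1 (2 * r) with hS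
  set B := adjL (G x1) with hB
  have hlip : ∀ x y, |ψ x - ψ y| ≤ 5 * ‖x - y‖ := by
    intro x y
    exact Convex.norm_image_sub_le_of_norm_fderiv_le (𝕜 := ℝ) (fun z _ => hψ.differentiable one_ne_zero z) (fun z _ => hψd z) convex_univ
      (mem_univ y) (mem_univ x)
  have hSc : IsCompact S := isCompact_closedBall _ _
  have fm : AEStronglyMeasurable f (volume.restrict S) := h.fmeas hSc hK
  have iadj := h.adj_int.mono_set hK
  have m3 : AEStronglyMeasurable (fun x => adjL (G x) v) (volume.restrict S) :=
    (ContinuousLinearMap.apply ℝ E v).continuous.comp_aestronglyMeasurable iadj.aestronglyMeasurable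
  have i1 : IntegrableOn (fun x => fderiv ℝ Φ x (adjL (G x) v)) S := by
    refine (iadj.norm.const_mul (δ / r * ‖v‖)).mono' ?_ (Eventually.of_forall fun x => ?_)
    · have hcc : Continuous fun p : (E →L[ℝ] ℝ) × E => p.1 p.2 := by fun_prop
      exact hcc.comp_aestronglyMeasurable ((hΦ.continuous_fderiv one_ne_zero).aestronglyMeasurable.prodMk m3)
    · calc _ ≤ ‖fderiv ℝ Φ x‖ * (‖adjL (G x)‖ * ‖v‖) := (ContinuousLinearMap.le_opNorm _ _).trans
            (by gcongr; exact ContinuousLinearMap.le_opNorm _ _)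
        _ ≤ δ / r * (‖adjL (G x)‖ * ‖v‖) := by gcongr; exact hΦd x
        _ = _ := by ring
  have i2 : IntegrableOn (fun x => fderiv ℝ Φ x (adjL (G x) v) * ψ (f x)) S :=
    Integrable.mul_bdd (c := 2 * (M * r)) i1 (hψ.continuous.comp_aestronglyMeasurable fm) (Eventually.of_forall fun x => hψM _)
  have i3 : IntegrableOn (fun x => fderiv ℝ Φ x (B v) * l (G x1 (x - x1))) S := by
    refine ContinuousOn.integrableOn_compact hSc (Continuous.continuousOn ?_)
    exact ((hΦ.continuous_fderiv one_ne_zero).clm_apply continuous_const).mul (by fun_prop)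
  have i4 : IntegrableOn (fun x => ‖adjL (G x) - B‖) S := (iadj.sub (integrableOn_const hSc.measure_lt_top.ne)).norm
  have i5 : IntegrableOn (fun x => Aᶜ.indicator (fun _ => 4 * (M * r)) x) S :=
    Integrable.indicator (integrableOn_const hSc.measure_lt_top.ne) hA.compl
  have i6 : IntegrableOn (fun _ : E => 5 * (ε * (2 * r))) S := integrableOn_const hSc.measure_lt_top.ne
  have hpt : ∀ x ∈ S, ‖fderiv ℝ Φ x (adjL (G x) v) * ψ (f x) - fderiv ℝ Φ x (B v) * l (G x1 (x - x1))‖ ≤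
      δ / r * (2 * (M * r) * ‖adjL (G x) - B‖ + ‖B‖ * (5 * (ε * (2 * r)) + Aᶜ.indicator (fun _ => 4 * (M * r)) x)) := by
    intro x hx
    have hxn : ‖x - x1‖ ≤ 2 * r := by rw [← dist_eq_norm]; exact hx
    have hl : l (G x1 (x - x1)) = ψ (f x1 + G x1 (x - x1)) := by
      rw [hψl, add_sub_cancel_left]
      rw [mem_closedBall, dist_eq_norm, add_sub_cancel_left]
      calc _ ≤ ‖G x1‖ * ‖x - x1‖ := (G x1).le_opNorm _
        _ ≤ ‖G x1‖ * (2 * r) := by gcongr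
        _ ≤ _ := by nlinarith
    have e : fderiv ℝ Φ x (adjL (G x) v) * ψ (f x) - fderiv ℝ Φ x (B v) * l (G x1 (x - x1)) =
        fderiv ℝ Φ x ((adjL (G x) - B) v) * ψ (f x) + fderiv ℝ Φ x (B v) * (ψ (f x) - ψ (f x1 + G x1 (x - x1))) := by
      have e' : fderiv ℝ Φ x ((adjL (G x) - B) v) = fderiv ℝ Φ x (adjL (G x) v) - fderiv ℝ Φ x (B v) := by
        rw [← map_sub]; rfl
      rw [hl, e']; ring
    have b1 : ‖fderiv ℝ Φ x ((adjL (G x) - B) v)‖ ≤ δ / r * ‖adjL (G x) - B‖ := by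
      calc _ ≤ ‖fderiv ℝ Φ x‖ * (‖adjL (G x) - B‖ * ‖v‖) := (ContinuousLinearMap.le_opNorm _ _).trans
            (by gcongr; exact ContinuousLinearMap.le_opNorm _ _)
        _ ≤ _ := by rw [hv, mul_one]; gcongr; exact hΦd x
    have b2 : ‖fderiv ℝ Φ x (B v)‖ ≤ δ / r * ‖B‖ := by
      calc _ ≤ ‖fderiv ℝ Φ x‖ * (‖B‖ * ‖v‖) := (ContinuousLinearMap.le_opNorm _ _).trans
            (by gcongr; exact ContinuousLinearMap.le_opNorm _ _)
        _ ≤ _ := by rw [hv, mul_one]; gcongr; exact hΦd x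
    have b3 : |ψ (f x) - ψ (f x1 + G x1 (x - x1))| ≤ 5 * (ε * (2 * r)) + Aᶜ.indicator (fun _ => 4 * (M * r)) x := by
      by_cases hxA : x ∈ A
      · rw [indicator_of_notMem (by simpa using hxA), add_zero]
        refine (hlip _ _).trans ?_
        rw [← sub_sub]
        gcongr
        exact hder x ⟨hxA, hx⟩
      · rw [indicator_of_mem (by simpa using hxA)]
        have h1 := hψM (f x)
        have h2 := hψM (f x1 + G x1 (x - x1))
        have h3 := abs_sub (ψ (f x)) (ψ (f x1 + G x1 (x - x1)))
        have : 0 < 5 * (ε * (2 * r)) := by positivity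
        linarith
    rw [e]
    refine (norm_add_le _ _).trans ?_
    rw [norm_mul, norm_mul, mul_add]
    refine add_le_add ?_ ?_
    · calc _ ≤ (δ / r * ‖adjL (G x) - B‖) * (2 * (M * r)) := by
            gcongr
            exact hψM _
        _ = _ := by ring
    · calc _ ≤ (δ / r * ‖B‖) * (5 * (ε * (2 * r)) + Aᶜ.indicator (fun _ => 4 * (M * r)) x) := by
            gcongr
            exact b3
        _ = _ := by ring
  rw [← integral_sub i2 i3, ← Real.norm_eq_abs]
  have i56 : IntegrableOn (fun x => 5 * (ε * (2 * r)) + Aᶜ.indicator (fun _ => 4 * (M * r)) x) S := Integrable.add i6 i5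
  refine (norm_integral_le_of_norm_le (g := fun x => δ / r * (2 * (M * r) * ‖adjL (G x) - B‖ + ‖B‖ * (5 * (ε * (2 * r)) + Aᶜ.indicator (fun _ => 4 * (M * r)) x)))
    (((i4.const_mul _).add (i56.const_mul _)).const_mul _) ((ae_restrict_iff' measurableSet_closedBall).2 (Eventually.of_forall hpt))).trans ?_
  rw [integral_const_mul, integral_add (i4.const_mul _) (i56.const_mul _), integral_const_mul, integral_const_mul, integral_add i6 i5,
    setIntegral_const, setIntegral_indicator hA.compl, setIntegral_const]
  have v1 : ∫ x in S, ‖adjL (G x) - B‖ ≤ ε * (2 * r) ^ n := by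
    rw [integral_norm_eq_lintegral_enorm (f := fun x => adjL (G x) - B) (iadj.sub (integrableOn_const hSc.measure_lt_top.ne)).aestronglyMeasurable]
    exact ENNReal.toReal_le_of_le_ofReal (by positivity) hleb
  have v2 : volume.real (S ∩ Aᶜ) ≤ ε * (2 * r) ^ n :=
    ENNReal.toReal_le_of_le_ofReal (by positivity) (by rwa [← sdiff_eq])
  have v3 : volume.real S = (2 * r) ^ n * volume.real (closedBall (0:E) 1) := Measure.addHaar_real_closedBall' _ x1 (by positivity)
  rw [v3]
  simp only [smul_eq_mul]
  set ω := volume.real (closedBall (0:E) 1)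
  calc _ ≤ δ / r * (2 * (M * r) * (ε * (2 * r) ^ n) + ‖B‖ * ((2 * r) ^ n * ω * (5 * (ε * (2 * r))) + (ε * (2 * r) ^ n) * (4 * (M * r)))) := by
        gcongr
    _ = _ := by
        rw [mul_pow]; field_simp; ring

theorem enorm_tri {F : Type*} [NormedAddCommGroup F] (a b : F) : ‖a‖ₑ ≤ ‖a - b‖ₑ + ‖b‖ₑ := by
  calc ‖a‖ₑ = ‖(a - b) + b‖ₑ := by rw [sub_add_cancel]
    _ ≤ _ := enorm_add_le _ _

theorem GD.upper_I (h : GD D f G K) (x1 : E) (ε r τ δ : ℝ) (hε : 0 < ε) (hr : 0 < r) (hτ : 0 < τ) (hτ1 : τ ≤ 1) (hδ : 0 ≤ δ)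
    (hleb : ∫⁻ y in closedBall x1 (2 * r), ‖adjL (G y) - adjL (G x1)‖ₑ ≤ ENNReal.ofReal (ε * (2 * r) ^ Module.finrank ℝ E))
    (hK : closedBall x1 (2 * r) ⊆ K)
    {Φ : E → ℝ} (hΦd : ∀ z, ‖fderiv ℝ Φ z‖ ≤ δ / r) (hΦ1 : ∀ z ∈ closedBall x1 r, Φ z = 1)
    (hΦs : tsupport Φ ⊆ closedBall x1 ((1 + τ) * r)) :
    ∫⁻ x in tsupport Φ, ‖fderiv ℝ Φ x‖ₑ * ‖adjL (G x)‖ₑ ≤ ENNReal.ofReal (δ / r * ((ε * 2 ^ Module.finrank ℝ E +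
      ‖adjL (G x1)‖ * (volume.real (closedBall (0:E) 1) * ((1 + τ) ^ Module.finrank ℝ E - 1))) * r ^ Module.finrank ℝ E)) := by
  set n := Module.finrank ℝ E with hn
  set B := adjL (G x1) with hB
  set ω := volume.real (closedBall (0:E) 1) with hω
  have hsub2 : closedBall x1 ((1 + τ) * r) ⊆ closedBall x1 (2 * r) := closedBall_subset_closedBall (by nlinarith)
  have hz : ∀ x ∈ ball x1 r, fderiv ℝ Φ x = 0 := fun x hx => by
    have : Φ =ᶠ[𝓝 x] fun _ => 1 := by
      filter_upwards [isOpen_ball.mem_nhds hx] with z hz' using hΦ1 z (ball_subset_closedBall hz')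
    rw [this.fderiv_eq]; simp
  have hvol : volume (closedBall x1 ((1 + τ) * r) \ ball x1 r) = ENNReal.ofReal (ω * ((1 + τ) ^ n - 1) * r ^ n) := by
    haveI : Nontrivial E := Module.nontrivial_of_finrank_pos (R := ℝ) (lt_of_lt_of_le two_pos h.dim)
    rw [measure_sdiff (ball_subset_closedBall.trans (closedBall_subset_closedBall (by nlinarith))) measurableSet_ball.nullMeasurableSet
      measure_ball_lt_top.ne, Measure.addHaar_closedBall' _ x1 (by positivity), ← Measure.addHaar_closedBall_eq_addHaar_ball,
      Measure.addHaar_closedBall' _ x1 hr.le]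
    have : volume (closedBall (0:E) 1) = ENNReal.ofReal ω := by
      rw [hω, Measure.real, ENNReal.ofReal_toReal measure_closedBall_lt_top.ne]
    rw [this, ← ENNReal.ofReal_mul (by positivity), ← ENNReal.ofReal_mul (by positivity), ← ENNReal.ofReal_sub _ (by positivity)]
    congr 1; rw [mul_pow]; ring
  have h1τ : 0 ≤ (1 + τ) ^ n - 1 := sub_nonneg.2 (one_le_pow₀ (by linarith))
  have hpt : ∀ x ∈ tsupport Φ, ‖fderiv ℝ Φ x‖ₑ * ‖adjL (G x)‖ₑ ≤ ENNReal.ofReal (δ / r) *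
      (‖adjL (G x) - B‖ₑ + (closedBall x1 ((1 + τ) * r) \ ball x1 r).indicator (fun _ => ‖B‖ₑ) x) := by
    intro x hx
    by_cases hxb : x ∈ ball x1 r
    · rw [← ofReal_norm, hz x hxb, norm_zero, ENNReal.ofReal_zero, zero_mul]; exact zero_le
    · rw [indicator_of_mem (s := closedBall x1 ((1 + τ) * r) \ ball x1 r) (a := x) ⟨hΦs hx, hxb⟩]
      gcongr
      · rw [← ofReal_norm]; exact ENNReal.ofReal_le_ofReal (hΦd x)
      · exact enorm_tri _ _
  calc _ ≤ ∫⁻ x in tsupport Φ, ENNReal.ofReal (δ / r) *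
      (‖adjL (G x) - B‖ₑ + (closedBall x1 ((1 + τ) * r) \ ball x1 r).indicator (fun _ => ‖B‖ₑ) x) :=
        setLIntegral_mono' (isClosed_tsupport _).measurableSet hpt
    _ ≤ ∫⁻ x in closedBall x1 (2 * r), ENNReal.ofReal (δ / r) *
      (‖adjL (G x) - B‖ₑ + (closedBall x1 ((1 + τ) * r) \ ball x1 r).indicator (fun _ => ‖B‖ₑ) x) :=
        lintegral_mono_set (hΦs.trans hsub2)
    _ = ENNReal.ofReal (δ / r) * ((∫⁻ x in closedBall x1 (2 * r), ‖adjL (G x) - B‖ₑ) +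
          ∫⁻ x in closedBall x1 (2 * r), (closedBall x1 ((1 + τ) * r) \ ball x1 r).indicator (fun _ => ‖B‖ₑ) x) := by
        rw [lintegral_const_mul' _ _ ENNReal.ofReal_ne_top, lintegral_add_right]
        exact measurable_const.indicator (measurableSet_closedBall.diff measurableSet_ball)
    _ ≤ ENNReal.ofReal (δ / r) * (ENNReal.ofReal (ε * (2 * r) ^ n) + ENNReal.ofReal (‖B‖ * (ω * ((1 + τ) ^ n - 1) * r ^ n))) := by
        gcongr
        refine (setLIntegral_le_lintegral _ _).trans ?_
        rw [lintegral_indicator (measurableSet_closedBall.diff measurableSet_ball), setLIntegral_const, hvol, ← ofReal_norm,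
          ← ENNReal.ofReal_mul (norm_nonneg _)]
    _ = _ := by
        rw [← ENNReal.ofReal_add (by positivity) (by positivity), ← ENNReal.ofReal_mul (by positivity)]
        congr 1; rw [mul_pow]; ring

end M6d

section M6e
universe u
variable {E : Type u} [NormedAddCommGroup E] [NormedSpace ℝ E] [FiniteDimensional ℝ E] [MeasureSpace E] [BorelSpace E]
  [(volume : Measure E).IsAddHaarMeasure]
variable {D : Set E} {f : E → E} {G : E → E →L[ℝ] E} {K : Set E}

theorem GD.scale (h : GD D f G K) (hinj : InjOn f D) (hop : ∀ U ⊆ D, IsOpen U → IsOpen (f '' U)) (C : ℝ≥0)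
    (hC : ∀ u : E → ℝ, ContDiff ℝ 1 u → HasCompactSupport u → ∀ A : Set E,
    ∫⁻ y in A, ‖u y‖ₑ ≤ C * (∫⁻ y, ‖fderiv ℝ u y‖ₑ) * volume A ^ (1 / (Module.finrank ℝ E : ℝ)))
    (c : ℕ → ℝ) (hc : Tendsto c atTop (𝓝 0)) (x1 : E) (hx1 : x1 ∈ interior K) (A : Set E) (m : ℝ) (bp : BP f G K x1 A m)
    (hloc : ∀ᶠ r in 𝓝[>] (0:ℝ), ∀ Φ, Tst K Φ → (∀ z ∈ ball x1 r, Φ z = 1) → ∀ s < r, 0 < s →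
      ∀ᶠ k in atTop, ∀ z ∈ closedBall x1 s, UU f G Φ k (f z) = c k) (M : ℝ) (hM : 0 < M) (hMA : 2 * ‖G x1‖ ≤ M)
    (τ : ℝ) (hτ : 0 < τ) (hτ1 : τ < 1 / 2) (ε : ℝ) (hε : 0 < ε) :
    |(G x1).det| * volume.real (closedBall (0:E) 1) ≤
      ε * (2 / τ * 2 ^ Module.finrank ℝ E * (2 * M + ‖adjL (G x1)‖ * (10 * volume.real (closedBall (0:E) 1) + 4 * M))) +
      5 * (C * (2 / τ * (ε * 2 ^ Module.finrank ℝ E +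
      ‖adjL (G x1)‖ * (volume.real (closedBall (0:E) 1) * ((1 + τ) ^ Module.finrank ℝ E - 1)))) *
      (m * ((1 + 2 * τ) ^ Module.finrank ℝ E - (1 - τ) ^ Module.finrank ℝ E) + ε) ^ (1 / (Module.finrank ℝ E : ℝ))) := by
  set n := Module.finrank ℝ E with hn
  have hn0 : 0 < n := lt_of_lt_of_le two_pos h.dim
  have : Nontrivial E := Module.nontrivial_of_finrank_pos (R := ℝ) hn0
  set ω := volume.real (closedBall (0:E) 1) with hω
  set B := adjL (G x1) with hB
  have ht2 : Tendsto (fun r : ℝ => 2 * r) (𝓝[>] 0) (𝓝[>] 0) := by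
    refine tendsto_nhdsWithin_iff.2 ⟨?_, ?_⟩
    · have : Tendsto (fun r : ℝ => 2 * r) (𝓝 0) (𝓝 (2 * 0)) := (continuous_const.mul continuous_id).tendsto 0
      rw [mul_zero] at this
      exact this.mono_left nhdsWithin_le_nhds
    · filter_upwards [self_mem_nhdsWithin] with r hr
      have : 0 < r := hr
      exact mem_Ioi.2 (by linarith)
  obtain ⟨ρ, hρ, hρK⟩ := Metric.isOpen_iff.1 isOpen_interior x1 hx1
  have hKe : ∀ᶠ r in 𝓝[>] (0:ℝ), closedBall x1 (2 * r) ⊆ interior K := by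
    filter_upwards [ht2.eventually (Ioo_mem_nhdsGT hρ)] with r hr
    exact (closedBall_subset_ball hr.2).trans hρK
  obtain ⟨v, hv⟩ : ∃ v : E, ‖v‖ = 1 := by
    obtain ⟨w, hw⟩ := exists_ne (0:E)
    exact ⟨‖w‖⁻¹ • w, by rw [norm_smul, norm_inv, norm_norm, inv_mul_cancel₀ (norm_ne_zero_iff.2 hw)]⟩
  obtain ⟨l, hl1, hlv⟩ := exists_dual_vector ℝ v (by rw [hv]; exact one_ne_zero)
  have hlv1 : l v = 1 := by rw [hlv, hv]; simp
  obtain ⟨r, hr, hr1, hr2, hr3, hr4, hr5, hr6⟩ := ((show ∀ᶠ r in 𝓝[>] (0:ℝ), 0 < r from self_mem_nhdsWithin).and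
    ((ht2.eventually (bp.der ε hε)).and ((ht2.eventually (bp.dens ε hε)).and ((ht2.eventually (bp.leb ε hε)).and
    ((bp.vol (1 - τ) (1 + 2 * τ) (by linarith) (by linarith) ε hε).and (hKe.and hloc)))))).exists
  obtain ⟨Φ, hΦ, hΦ01, hΦ1, hΦs, hΦd⟩ := exists_cutoff x1 r ((1 + τ) * r) hr.le (by nlinarith)
  have e1 : 2 / ((1 + τ) * r - r) = 2 / τ / r := by
    rw [div_div]; congr 1; ring
  rw [e1] at hΦd
  have hbs : closedBall x1 ((1 + τ) * r) ⊆ closedBall x1 (2 * r) := closedBall_subset_closedBall (by nlinarith)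
  have hcs : HasCompactSupport Φ := (isCompact_closedBall x1 ((1 + τ) * r)).of_isClosed_subset (isClosed_tsupport Φ) hΦs
  have hT : Tst K Φ := ⟨hΦ, hcs, hΦs.trans (hbs.trans hr5)⟩
  obtain ⟨ψ, hψ, hψc, hψd, hψM, hψl⟩ := exists_psi (f x1) l hl1.le (M * r) (by positivity)
  have hfix := h.fix_r hinj hop C hC c hc x1 ((1 - τ) * r) ((1 + τ) * r) ((1 + 2 * τ) * r) (by nlinarith)
    ((closedBall_subset_closedBall (by nlinarith)).trans (hr5.trans interior_subset)) (by nlinarith) hT hΦs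
    (hr6 Φ hT (fun z hz => hΦ1 z (ball_subset_closedBall hz)) _ (by nlinarith) (by nlinarith)) ψ hψ hψc 5 (by norm_num) hψd v hv
  have herr := h.err_bound x1 A bp.am ε r M (2 / τ) hε hr (by positivity) hM hr1 hr2 hr3 (hr5.trans interior_subset) hΦ hΦd l hMA ψ hψ hψd hψM hψl v hv
  have hI := h.upper_I x1 ε r τ (2 / τ) hε hr hτ (by linarith) (by positivity) hr3 (hr5.trans interior_subset) hΦd hΦ1 hΦs
  have hlb := exact_lb (G x1) v x1 l hlv1 hΦ hcs (fun z => (hΦ01 z).1) r hr hΦ1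
  have hfd0 : ∀ x ∉ tsupport Φ, fderiv ℝ Φ x = 0 := fun x hx =>
    image_eq_zero_of_notMem_tsupport fun h' => hx (tsupport_fderiv_subset ℝ h')
  have eX0 : ∫ x in closedBall x1 (2 * r), fderiv ℝ Φ x (B v) * l (G x1 (x - x1)) = ∫ x, fderiv ℝ Φ x (B v) * l (G x1 (x - x1)) :=
    setIntegral_eq_integral_of_forall_compl_eq_zero fun x hx => by
      rw [hfd0 x fun h' => hx (hbs (hΦs h'))]; simp
  have eX : ∫ x in closedBall x1 (2 * r), fderiv ℝ Φ x (adjL (G x) v) * ψ (f x) = ∫ x in tsupport Φ, fderiv ℝ Φ x (adjL (G x) v) * ψ (f x) :=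
    setIntegral_eq_of_subset_of_forall_sdiff_eq_zero measurableSet_closedBall (hΦs.trans hbs) fun x hx => by
      rw [hfd0 x hx.2]; simp
  rw [eX0, eX] at herr
  set X0 := ∫ x, fderiv ℝ Φ x (B v) * l (G x1 (x - x1))
  set X := ∫ x in tsupport Φ, fderiv ℝ Φ x (adjL (G x) v) * ψ (f x)
  set i0 := ε * 2 ^ n + ‖B‖ * (ω * ((1 + τ) ^ n - 1)) with hi0
  set v0 := m * ((1 + 2 * τ) ^ n - (1 - τ) ^ n) + ε with hv0
  have h1τ : 0 ≤ (1 + τ) ^ n - 1 := sub_nonneg.2 (one_le_pow₀ (by linarith))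
  have hi00 : 0 ≤ i0 := by positivity
  have hm0 := bp.m0
  have h2τ : 0 ≤ (1 + 2 * τ) ^ n - (1 - τ) ^ n := sub_nonneg.2 (pow_le_pow_left₀ (by linarith) (by linarith) _)
  have hv00 : 0 ≤ v0 := by positivity
  have hup : |X| ≤ 5 * (C * (2 / τ * i0) * v0 ^ (1 / (n:ℝ))) * r ^ n := by
    have hV : volume (f '' (K ∩ (closedBall x1 ((1 + 2 * τ) * r) \ closedBall x1 ((1 - τ) * r)))) ^ (1 / (n:ℝ)) ≤
        ENNReal.ofReal (v0 ^ (1 / (n:ℝ)) * r) := by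
      calc _ ≤ ENNReal.ofReal (v0 * r ^ n) ^ (1 / (n:ℝ)) := by gcongr
        _ = ENNReal.ofReal ((v0 * r ^ n) ^ (1 / (n:ℝ))) := ENNReal.ofReal_rpow_of_nonneg (by positivity) (by positivity)
        _ = _ := by
          rw [Real.mul_rpow hv00 (by positivity), one_div, Real.pow_rpow_inv_natCast hr.le hn0.ne']
    have := hfix.trans (mul_le_mul_right (mul_le_mul' (mul_le_mul_right hI _) hV) _)
    rw [← ENNReal.ofReal_coe_nnreal, ← ENNReal.ofReal_mul C.coe_nonneg, ← ENNReal.ofReal_mul (by positivity), ← ENNReal.ofReal_mul (by positivity)] at this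
    rw [ENNReal.ofReal_le_ofReal_iff (by positivity)] at this
    refine this.trans (le_of_eq ?_)
    rw [← hn]
    field_simp
  have hrn : 0 < r ^ n := by positivity
  refine le_of_mul_le_mul_right ?_ hrn
  have h3 : |X0| ≤ |X| + |X - X0| := by
    have := abs_sub_abs_le_abs_sub X0 X
    rw [abs_sub_comm X0 X] at this; linarith
  calc _ = |(G x1).det| * (ω * r ^ n) := by ring
    _ ≤ _ := hlb.trans (h3.trans (add_le_add hup herr))
    _ = _ := by ring

theorem GD.nonvan (h : GD D f G K) (hinj : InjOn f D) (hop : ∀ U ⊆ D, IsOpen U → IsOpen (f '' U)) (x0 : E) (R : ℝ) (hR : 0 < R)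
    (hK : closedBall x0 (4 * R) ⊆ interior K) (hfd : ∀ᵐ x, x ∈ K → (G x).det = 0 → G x = 0) {Φ0 : E → ℝ} (hΦ0 : Tst K Φ0)
    (h1 : ∀ z ∈ ball x0 (3 * R), Φ0 z = 1) : ¬ Tendsto (fun k => UU f G Φ0 k (f x0)) atTop (𝓝 0) := by
  intro hc
  have hKR : ∀ a ≤ 4 * R, closedBall x0 a ⊆ interior K := fun a ha => (closedBall_subset_closedBall ha).trans hK
  obtain ⟨x1, hx1, A, m, bp⟩ := exists_bp h hinj x0 R hR (hK.trans (interior_subset.trans h.sub)) (hKR R (by linarith)) hfd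
  obtain ⟨C, hC⟩ := gns1 (E := E) h.dim
  have hcon := h.uu_const hinj hop hΦ0 x0 (3 * R) (2 * R) (by linarith) (by linarith) ((hKR _ (by linarith)).trans interior_subset) h1
  have hx1' : dist x1 x0 ≤ R := hx1
  have hloc : ∀ᶠ r in 𝓝[>] (0:ℝ), ∀ Φ, Tst K Φ → (∀ z ∈ ball x1 r, Φ z = 1) → ∀ s < r, 0 < s →
      ∀ᶠ k in atTop, ∀ z ∈ closedBall x1 s, UU f G Φ k (f z) = UU f G Φ0 k (f x0) := by
    filter_upwards [Ioo_mem_nhdsGT hR] with r hr Φ hΦ hΦ1 s hs hs0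
    have hb : ∀ z, dist z x1 < R → z ∈ ball x0 (2 * R) := fun z hz => by
      rw [mem_ball]; have := dist_triangle z x1 x0; linarith
    have hl := h.uu_loc hinj hΦ hΦ0 x1 r s hs
      (fun z hz => interior_subset (hKR _ (by linarith) (ball_subset_closedBall (hb z ((mem_closedBall.1 hz).trans_lt (hs.trans hr.2))))))
      (fun z hz => by
        rw [hΦ1 z hz, h1 z (ball_subset_ball (by linarith) (hb z ((mem_ball.1 hz).trans hr.2)))])
    filter_upwards [hl, hcon] with k hk1 hk2 z hz
    rw [hk1 z hz, hk2 z (hb z ((mem_closedBall.1 hz).trans_lt (hs.trans hr.2)))]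
  have hsc := h.scale hinj hop C hC _ hc x1 (hKR R (by linarith) hx1) A m bp hloc (2 * ‖G x1‖ + 1) (by positivity) (by linarith)
  set n := Module.finrank ℝ E with hn
  have hn0 : 0 < n := lt_of_lt_of_le two_pos h.dim
  have hnR : 0 < 1 / (n:ℝ) := by positivity
  set M := 2 * ‖G x1‖ + 1
  set ω := volume.real (closedBall (0:E) 1) with hω
  set B := adjL (G x1) with hB
  have step1 : ∀ τ, 0 < τ → τ < 1 / 2 → |(G x1).det| * ω ≤ 5 * (C * (2 * (‖B‖ * (ω * ∑ i ∈ Finset.range n, (1 + τ) ^ i))) *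
      (m * ((1 + 2 * τ) ^ n - (1 - τ) ^ n)) ^ (1 / (n:ℝ))) := by
    intro τ hτ hτ1
    have hcont : Continuous fun ε : ℝ => ε * (2 / τ * 2 ^ n * (2 * M + ‖B‖ * (10 * ω + 4 * M))) +
      5 * (C * (2 / τ * (ε * 2 ^ n + ‖B‖ * (ω * ((1 + τ) ^ n - 1)))) *
      (m * ((1 + 2 * τ) ^ n - (1 - τ) ^ n) + ε) ^ (1 / (n : ℝ))) := by
      have : Continuous fun ε : ℝ => (m * ((1 + 2 * τ) ^ n - (1 - τ) ^ n) + ε) ^ (1 / (n : ℝ)) :=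
        (continuous_const.add continuous_id).rpow_const fun _ => Or.inr hnR.le
      fun_prop
    have ht := (hcont.tendsto 0).mono_left (nhdsWithin_le_nhds (s := Ioi 0))
    have := ge_of_tendsto ht (by filter_upwards [self_mem_nhdsWithin] with ε hε using hsc τ hτ hτ1 ε hε)
    refine this.trans (le_of_eq ?_)
    have hg : (1 + τ) ^ n - 1 = (∑ i ∈ Finset.range n, (1 + τ) ^ i) * τ := by
      rw [← geom_sum_mul]; ring
    rw [hg]; simp only [zero_mul, zero_add, add_zero]
    congr 3
    field_simp
  have hcont : Continuous fun τ : ℝ => 5 * (C * (2 * (‖B‖ * (ω * ∑ i ∈ Finset.range n, (1 + τ) ^ i))) *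
      (m * ((1 + 2 * τ) ^ n - (1 - τ) ^ n)) ^ (1 / (n:ℝ))) := by
    have : Continuous fun τ : ℝ => (m * ((1 + 2 * τ) ^ n - (1 - τ) ^ n)) ^ (1 / (n:ℝ)) :=
      Continuous.rpow_const (by fun_prop) fun _ => Or.inr hnR.le
    fun_prop
  have ht := (hcont.tendsto 0).mono_left (nhdsWithin_le_nhds (s := Ioi 0))
  have hfin := ge_of_tendsto ht (by
    filter_upwards [Ioo_mem_nhdsGT (show (0:ℝ) < 1 / 2 by norm_num)] with τ hτ using step1 τ hτ.1 hτ.2)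
  rw [show (m * ((1 + 2 * (0:ℝ)) ^ n - (1 - 0) ^ n)) ^ (1 / (n:ℝ)) = 0 by
    rw [mul_zero, add_zero, sub_zero, sub_self, mul_zero, Real.zero_rpow hnR.ne'], mul_zero, mul_zero] at hfin
  have hω0 : 0 < ω := ENNReal.toReal_pos (measure_closedBall_pos _ _ one_pos).ne' measure_closedBall_lt_top.ne
  have : 0 < |(G x1).det| * ω := mul_pos (abs_pos.2 bp.det) hω0
  linarith

end M6e

section M7a
universe u
variable {E : Type u} [NormedAddCommGroup E] [NormedSpace ℝ E] [FiniteDimensional ℝ E] [MeasureSpace E] [BorelSpace E]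
  [(volume : Measure E).IsAddHaarMeasure]

theorem jens {A : Set E} {g : E → ℝ≥0∞} (hg : AEMeasurable g (volume.restrict A)) (q : ℝ) (hq : 1 < q) (Z : ℝ≥0∞)
    (h : ∫⁻ x in A, g x ^ q ≤ Z ^ q * volume A) : ∫⁻ x in A, g x ≤ Z * volume A := by
  have hq0 : 0 < q := by linarith
  have h1q : 0 ≤ 1 - 1 / q := by rw [sub_nonneg, div_le_one hq0]; exact hq.le
  have key := ENNReal.lintegral_mul_norm_pow_le (μ := volume.restrict A) (f := fun x => g x ^ q) (g := fun _ => 1) (hg.pow_const q) aemeasurable_const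
    (p := 1 / q) (q := 1 - 1 / q) (by positivity) h1q (by ring)
  simp only [ENNReal.one_rpow, mul_one, ← ENNReal.rpow_mul, mul_one_div_cancel hq0.ne', ENNReal.rpow_one, lintegral_const,
    Measure.restrict_apply_univ, one_mul] at key
  refine key.trans ?_
  calc _ ≤ (Z ^ q * volume A) ^ (1 / q) * volume A ^ (1 - 1 / q) := by gcongr
    _ = Z * (volume A ^ (1 / q) * volume A ^ (1 - 1 / q)) := by
        rw [ENNReal.mul_rpow_of_nonneg _ _ (by positivity), ← ENNReal.rpow_mul, mul_one_div_cancel hq0.ne', ENNReal.rpow_one, mul_assoc]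
    _ = _ := by
        rw [← ENNReal.rpow_add_of_nonneg _ _ (by positivity) h1q, add_sub_cancel, ENNReal.rpow_one]

theorem lint_rpow (β : ℝ) (hβ : β < 1) : ∫⁻ s in Ioc (0:ℝ) 1, ENNReal.ofReal (s ^ (-β)) = ENNReal.ofReal (1 / (1 - β)) := by
  have hi : IntervalIntegrable (fun s : ℝ => s ^ (-β)) volume 0 1 := intervalIntegral.intervalIntegrable_rpow' (by linarith)
  rw [← ofReal_integral_eq_lintegral_ofReal ((intervalIntegrable_iff_integrableOn_Ioc_of_le zero_le_one).1 hi)]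
  · rw [← intervalIntegral.integral_of_le zero_le_one, integral_rpow (Or.inl (by linarith))]
    rw [Real.zero_rpow (by linarith), Real.one_rpow, neg_add_eq_sub, sub_zero]
  · refine (ae_restrict_iff' measurableSet_Ioc).2 (Eventually.of_forall fun s hs => ?_)
    exact Real.rpow_nonneg hs.1.le _

theorem proj_len {S : Set E} (hS : IsPreconnected S) (y0 y1 : E) (h0 : y0 ∈ S) (h1 : y1 ∈ S) (w : Set E) (r : E → ℝ) (hw : w.Countable)
    (hr : ∀ a ∈ w, 0 < r a) (hc : S ⊆ ⋃ a ∈ w, closedBall a (5 * r a)) :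
    ENNReal.ofReal ‖y1 - y0‖ ≤ 10 * ∑' a : w, ENNReal.ofReal (r a) := by
  by_cases hne : ‖y1 - y0‖ = 0
  · rw [hne]; simp
  obtain ⟨l, hl1, hlv⟩ := exists_dual_vector ℝ (y1 - y0) hne
  have hd : l y1 - l y0 = ‖y1 - y0‖ := by rw [← map_sub, hlv]; simp
  have hsub : Icc (l y0) (l y1) ⊆ ⋃ a ∈ w, closedBall (l a) (5 * r a) := by
    refine ((hS.image l l.continuous.continuousOn).Icc_subset ⟨y0, h0, rfl⟩ ⟨y1, h1, rfl⟩).trans ?_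
    rintro _ ⟨y, hy, rfl⟩
    obtain ⟨a, ha, hya⟩ := mem_iUnion₂.1 (hc hy)
    refine mem_iUnion₂.2 ⟨a, ha, ?_⟩
    rw [mem_closedBall, dist_eq_norm, ← map_sub] at *
    calc ‖l (y - a)‖ ≤ ‖l‖ * ‖y - a‖ := l.le_opNorm _
      _ ≤ _ := by rw [hl1, one_mul]; exact hya
  calc ENNReal.ofReal ‖y1 - y0‖ = volume (Icc (l y0) (l y1)) := by rw [Real.volume_Icc, hd]
    _ ≤ _ := measure_mono hsub
    _ ≤ ∑' a : w, volume (closedBall (l a) (5 * r a)) := measure_biUnion_le _ hw _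
    _ = ∑' a : w, 10 * ENNReal.ofReal (r a) := by
        refine tsum_congr fun a => ?_
        rw [Real.volume_closedBall, ← mul_assoc, ENNReal.ofReal_mul (by norm_num)]
        norm_num
    _ = _ := ENNReal.tsum_mul_left

/-- the density measure -/
noncomputable def nuM (u : E → ℝ) (q s a b : ℝ) : Measure E :=
  volume.withDensity fun x => ENNReal.ofReal a * ‖fderiv ℝ u x‖ₑ ^ q + ENNReal.ofReal b * ‖u x‖ₑ ^ s

theorem content_pt (hd : 1 ≤ Module.finrank ℝ E) {u : E → ℝ} (hu : ContDiff ℝ 1 u) (q s : ℝ) (hq1 : 1 < q) (hs1 : 1 < s)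
    (hq : (Module.finrank ℝ E : ℝ) - 1 < q)
    (c0 : ℝ) (hc0 : 0 < c0) (ρ : ℝ) (hρ : 0 < ρ) (y : E) (hy : c0 ≤ |u y|) :
    ∃ t, 0 < t ∧ t ≤ ρ ∧ ENNReal.ofReal t ≤ nuM u q s
      ((3 / (c0 * (1 - ((Module.finrank ℝ E : ℝ) - 1) / q))) ^ q / volume.real (closedBall (0:E) 1) * ρ ^ (q + 1 - Module.finrank ℝ E))
      ((3 / c0) ^ s / volume.real (closedBall (0:E) 1) * ρ ^ (1 - (Module.finrank ℝ E : ℝ))) (closedBall y t) := by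
  set n := Module.finrank ℝ E with hn
  set ω := volume.real (closedBall (0:E) 1) with hω
  set β := ((n:ℝ) - 1) / q with hβ
  have hq0 : 0 < q := by linarith
  have hβ1 : β < 1 := by rw [hβ, div_lt_one hq0]; exact hq
  have hω0 : 0 < ω := ENNReal.toReal_pos (measure_closedBall_pos _ _ one_pos).ne' measure_closedBall_lt_top.ne
  have hωe : volume (closedBall (0:E) 1) = ENNReal.ofReal ω := by
    rw [hω, Measure.real, ENNReal.ofReal_toReal measure_closedBall_lt_top.ne]
  have h1β : 0 < 1 - β := by linarith
  set a := (3 / (c0 * (1 - β))) ^ q / ω * ρ ^ (q + 1 - (n:ℝ)) with ha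
  set b := (3 / c0) ^ s / ω * ρ ^ (1 - (n : ℝ)) with hb
  have ha0 : 0 < a := by positivity
  have hb0 : 0 < b := by positivity
  have hvol : ∀ t, 0 < t → volume (closedBall y t) = ENNReal.ofReal (ω * t ^ n) := fun t ht => by
    rw [Measure.addHaar_closedBall' _ y ht.le, hωe, ← ENNReal.ofReal_mul (by positivity), mul_comm]
  have m1 : Measurable fun x => ‖fderiv ℝ u x‖ₑ := (hu.continuous_fderiv one_ne_zero).enorm.measurable
  have m2 : Measurable fun x => ‖u x‖ₑ := hu.continuous.enorm.measurable
  by_contra! hcon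
  have hc1 : ∀ t, 0 < t → t ≤ ρ → ENNReal.ofReal a * (∫⁻ x in closedBall y t, ‖fderiv ℝ u x‖ₑ ^ q) +
      ENNReal.ofReal b * (∫⁻ x in closedBall y t, ‖u x‖ₑ ^ s) ≤ ENNReal.ofReal t := fun t ht htρ => by
    have := (hcon t ht htρ).le
    rw [nuM, withDensity_apply _ measurableSet_closedBall, lintegral_add_right _ ((m2.pow_const s).const_mul _),
      lintegral_const_mul' _ _ ENNReal.ofReal_ne_top, lintegral_const_mul' _ _ ENNReal.ofReal_ne_top] at this
    exact this
  have hdivl : ∀ (a X t : ℝ) (I : ℝ≥0∞), 0 < a → ENNReal.ofReal a * I ≤ ENNReal.ofReal t → t = a * X → I ≤ ENNReal.ofReal X := by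
    intro a X t I ha h hX
    rw [hX, ENNReal.ofReal_mul ha.le] at h
    exact (ENNReal.mul_le_mul_iff_right (by simpa using ha) ENNReal.ofReal_ne_top).1 h
  -- gradient
  have hG : ∀ σ ∈ Ioc (0:ℝ) 1, (ENNReal.ofReal (σ ^ n))⁻¹ * ∫⁻ w in closedBall y (σ * ρ), ‖fderiv ℝ u w‖ₑ ≤
      ENNReal.ofReal (c0 * (1 - β) / 3 * ρ⁻¹ * (ω * ρ ^ n)) * ENNReal.ofReal (σ ^ (-β)) := by
    intro σ hσ
    have hσ0 : 0 < σ := hσ.1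
    have hσρ : 0 < σ * ρ := by positivity
    set Z := c0 * (1 - β) / 3 * ρ⁻¹ * σ ^ (-β) with hZ
    have hZ0 : 0 < Z := by positivity
    have hI : ∫⁻ w in closedBall y (σ * ρ), ‖fderiv ℝ u w‖ₑ ^ q ≤ ENNReal.ofReal (Z ^ q * (ω * (σ * ρ) ^ n)) := by
      refine hdivl a _ (σ * ρ) _ ha0 (le_self_add.trans (hc1 (σ * ρ) hσρ (by nlinarith [hσ.2]))) ?_
      have e1 : Z ^ q = (c0 * (1 - β) / 3) ^ q * ρ ^ (-q) * σ ^ (-((n:ℝ) - 1)) := by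
        rw [hZ, Real.mul_rpow (by positivity) (by positivity), Real.mul_rpow (by positivity) (by positivity),
          Real.inv_rpow hρ.le, Real.rpow_neg hρ.le, ← Real.rpow_mul hσ0.le, hβ]
        congr 2; field_simp
      have e2 : (3 / (c0 * (1 - β))) ^ q * (c0 * (1 - β) / 3) ^ q = 1 := by
        rw [← Real.mul_rpow (by positivity) (by positivity)]
        rw [show 3 / (c0 * (1 - β)) * (c0 * (1 - β) / 3) = 1 by field_simp, Real.one_rpow]
      have e3 : ρ ^ (q + 1 - (n:ℝ)) * ρ ^ (-q) * ρ ^ n = ρ := by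
        rw [← Real.rpow_natCast ρ n, ← Real.rpow_add hρ, ← Real.rpow_add hρ]
        rw [show q + 1 - (n:ℝ) + -q + n = 1 by ring, Real.rpow_one]
      have e4 : σ ^ (-((n:ℝ) - 1)) * σ ^ n = σ := by
        rw [← Real.rpow_natCast σ n, ← Real.rpow_add hσ0]
        rw [show -((n:ℝ) - 1) + n = 1 by ring, Real.rpow_one]
      rw [e1, ha, mul_pow]
      calc σ * ρ = ((3 / (c0 * (1 - β))) ^ q * (c0 * (1 - β) / 3) ^ q) * (σ ^ (-((n:ℝ) - 1)) * σ ^ n) *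
            (ρ ^ (q + 1 - (n:ℝ)) * ρ ^ (-q) * ρ ^ n) := by rw [e2, e3, e4, one_mul]
        _ = _ := by field_simp
    have hJ := jens (A := closedBall y (σ * ρ)) (g := fun x => ‖fderiv ℝ u x‖ₑ) m1.aemeasurable q hq1 (ENNReal.ofReal Z) (by
      rw [hvol _ hσρ, ENNReal.ofReal_rpow_of_pos hZ0, ← ENNReal.ofReal_mul (by positivity)]; exact hI)
    rw [hvol _ hσρ, ← ENNReal.ofReal_mul hZ0.le] at hJ
    rw [← ENNReal.ofReal_inv_of_pos (by positivity), ← ENNReal.ofReal_mul (by positivity)]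
    refine (mul_le_mul_right hJ _).trans (le_of_eq ?_)
    rw [← ENNReal.ofReal_mul (by positivity)]
    congr 1
    rw [hZ, mul_pow]; field_simp
  have hGT : ∫⁻ z in closedBall y ρ, ‖u z - u y‖ₑ ≤ ENNReal.ofReal (c0 / 3 * (ω * ρ ^ n)) := by
    refine (dilation u hu y ρ hρ).trans ?_
    refine (mul_le_mul_right (setLIntegral_mono' measurableSet_Ioc hG) _).trans (le_of_eq ?_)
    rw [lintegral_const_mul' _ _ ENNReal.ofReal_ne_top, lint_rpow β hβ1, ← ENNReal.ofReal_mul (by positivity), ← ENNReal.ofReal_mul (by positivity)]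
    congr 1; field_simp
  have hU : ∫⁻ z in closedBall y ρ, ‖u z‖ₑ ≤ ENNReal.ofReal (c0 / 3 * (ω * ρ ^ n)) := by
    have hI : ∫⁻ w in closedBall y ρ, ‖u w‖ₑ ^ s ≤ ENNReal.ofReal ((c0 / 3) ^ s * (ω * ρ ^ n)) := by
      refine hdivl b _ ρ _ hb0 (le_add_self.trans (hc1 ρ hρ le_rfl)) ?_
      have e2 : (3 / c0) ^ s * (c0 / 3) ^ s = 1 := by
        rw [← Real.mul_rpow (by positivity) (by positivity)]
        rw [show 3 / c0 * (c0 / 3) = 1 by field_simp, Real.one_rpow]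
      have e3 : ρ ^ (1 - (n:ℝ)) * ρ ^ n = ρ := by
        rw [← Real.rpow_natCast ρ n, ← Real.rpow_add hρ, sub_add_cancel, Real.rpow_one]
      calc ρ = ((3 / c0) ^ s * (c0 / 3) ^ s) * (ρ ^ (1 - (n:ℝ)) * ρ ^ n) := by rw [e2, e3, one_mul]
        _ = _ := by rw [hb]; field_simp
    have hJ := jens (A := closedBall y ρ) (g := fun x => ‖u x‖ₑ) m2.aemeasurable s hs1 (ENNReal.ofReal (c0 / 3)) (by
      rw [hvol _ hρ, ENNReal.ofReal_rpow_of_pos (by positivity), ← ENNReal.ofReal_mul (by positivity)]; exact hI)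
    rwa [hvol _ hρ, ← ENNReal.ofReal_mul (by positivity)] at hJ
  have hlow : ENNReal.ofReal (c0 * (ω * ρ ^ n)) ≤ ENNReal.ofReal (c0 / 3 * (ω * ρ ^ n) + c0 / 3 * (ω * ρ ^ n)) := by
    calc _ = ∫⁻ z in closedBall y ρ, ENNReal.ofReal c0 := by
          rw [setLIntegral_const, hvol _ hρ, ENNReal.ofReal_mul hc0.le]
      _ ≤ ∫⁻ z in closedBall y ρ, (‖u z - u y‖ₑ + ‖u z‖ₑ) := by
          refine lintegral_mono fun z => ?_
          have h1 := enorm_tri (u y) (u z)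
          rw [enorm_sub_rev, ← ofReal_norm (u y), Real.norm_eq_abs] at h1
          exact (ENNReal.ofReal_le_ofReal hy).trans h1
      _ = _ := lintegral_add_right _ m2
      _ ≤ _ := by
          rw [ENNReal.ofReal_add (by positivity) (by positivity)]
          exact add_le_add hGT hU
  rw [ENNReal.ofReal_le_ofReal_iff (by positivity)] at hlow
  have : 0 < c0 * (ω * ρ ^ n) := by positivity
  linarith

end M7a

section M7b
universe u
variable {E : Type u} [NormedAddCommGroup E] [NormedSpace ℝ E] [FiniteDimensional ℝ E] [MeasureSpace E] [BorelSpace E]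
  [(volume : Measure E).IsAddHaarMeasure]

variable (E) in
theorem gnsq (hd : 2 ≤ Module.finrank ℝ E) (q : ℝ) (hq1 : 1 < q) (hqn : q < Module.finrank ℝ E) :
    ∃ C : ℝ, 0 ≤ C ∧ ∀ u : E → ℝ, ContDiff ℝ 1 u → HasCompactSupport u →
      ∫⁻ x, ‖u x‖ₑ ^ (Module.finrank ℝ E * q / (Module.finrank ℝ E - q)) ≤
        ENNReal.ofReal C * (∫⁻ x, ‖fderiv ℝ u x‖ₑ ^ q) ^ ((Module.finrank ℝ E : ℝ) / (Module.finrank ℝ E - q)) := by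
  set n := Module.finrank ℝ E with hn
  have hn0 : (0:ℝ) < n := by positivity
  have hq0 : 0 < q := by linarith
  have hnq : 0 < (n:ℝ) - q := by linarith
  set s : ℝ := n * q / (n - q) with hs
  have hs0 : 0 < s := by positivity
  lift q to ℝ≥0 using hq0.le
  lift s to ℝ≥0 using hs0.le with s' hs'
  set c := eLpNormLESNormFDerivOfEqInnerConst (volume : Measure E) (q:ℝ) with hc
  refine ⟨(c:ℝ) ^ (s':ℝ), by positivity, fun u hu hcs => ?_⟩
  have key := eLpNorm_le_eLpNorm_fderiv_of_eq_inner (volume : Measure E) hu hcs (p := q) (p' := s') (by exact_mod_cast hq1.le) (by omega)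
    (by rw [hs, ← hn, NNReal.coe_inv]; field_simp)
  rw [eLpNorm_nnreal_eq_lintegral (by exact_mod_cast hs0.ne'), eLpNorm_nnreal_eq_lintegral (by exact_mod_cast hq0.ne')] at key
  have k2 := ENNReal.rpow_le_rpow key hs0.le
  rw [← ENNReal.rpow_mul, one_div, inv_mul_cancel₀ hs0.ne', ENNReal.rpow_one, ENNReal.mul_rpow_of_nonneg _ _ hs0.le, ← ENNReal.rpow_mul] at k2
  refine k2.trans (le_of_eq ?_)
  congr 1
  · rw [← ENNReal.ofReal_rpow_of_nonneg c.coe_nonneg hs0.le, ENNReal.ofReal_coe_nnreal]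
  · congr 1
    rw [hs]; field_simp

theorem diam_bd (hd : 2 ≤ Module.finrank ℝ E) (q : ℝ) (hq1 : 1 < q) (hq : (Module.finrank ℝ E : ℝ) - 1 < q) (hqn : q < Module.finrank ℝ E)
    (c0 : ℝ) (hc0 : 0 < c0) (Λ : ℝ) (hΛ : 0 ≤ Λ) : ∃ C : ℝ, 0 ≤ C ∧ ∀ (ρ : ℝ) (u : E → ℝ) (S : Set E) (y0 y1 : E), 0 < ρ →
      ContDiff ℝ 1 u → HasCompactSupport u → (∫⁻ x, ‖fderiv ℝ u x‖ₑ ^ q) ≤ ENNReal.ofReal (Λ * ρ ^ ((Module.finrank ℝ E : ℝ) - q)) →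
      IsPreconnected S → (∀ y ∈ S, c0 ≤ |u y|) → y0 ∈ S → y1 ∈ S → ‖y1 - y0‖ ≤ C * ρ := by
  obtain ⟨Cg, hCg, hg⟩ := gnsq E hd q hq1 hqn
  set n := Module.finrank ℝ E with hn
  have hn0 : (0:ℝ) < n := by positivity
  have hn1 : (1:ℝ) < n := by exact_mod_cast hd
  have hq0 : 0 < q := by linarith
  have hnq : 0 < (n:ℝ) - q := by linarith
  set s : ℝ := n * q / (n - q) with hs
  have hs1 : 1 < s := by rw [hs, lt_div_iff₀ hnq]; nlinarith
  set ω := volume.real (closedBall (0:E) 1) with hω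
  set a0 := (3 / (c0 * (1 - ((n : ℝ) - 1) / q))) ^ q / ω with ha0
  set b0 := (3 / c0) ^ s / ω with hb0
  have hω0 : 0 ≤ ω := measureReal_nonneg
  have hβ1 : 0 < 1 - ((n : ℝ) - 1) / q := by rw [sub_pos, div_lt_one hq0]; exact hq
  have ha00 : 0 ≤ a0 := by positivity
  have hb00 : 0 ≤ b0 := by positivity
  refine ⟨10 * (a0 * Λ + b0 * (Cg * Λ ^ ((n:ℝ) / (n - q)))), by positivity, ?_⟩
  intro ρ u S y0 y1 hρ hu hcs hen hS hSc h0 h1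
  have m1 : Measurable fun x => ‖fderiv ℝ u x‖ₑ := (hu.continuous_fderiv one_ne_zero).enorm.measurable
  have m2 : Measurable fun x => ‖u x‖ₑ := hu.continuous.enorm.measurable
  obtain ⟨w, r, -, hwc, hwr, hcov, hsum⟩ := vitaliV S (nuM u q s (a0 * ρ ^ (q + 1 - (n:ℝ))) (b0 * ρ ^ (1 - (n:ℝ)))) ENNReal.ofReal ρ
    (fun y hy => content_pt (by omega) hu q s hq1 hs1 hq c0 hc0 ρ hρ y (hSc y hy))
  have hU : ∫⁻ x, ‖u x‖ₑ ^ s ≤ ENNReal.ofReal (Cg * Λ ^ ((n:ℝ) / (n - q)) * ρ ^ (n:ℝ)) := by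
    refine (hg u hu hcs).trans ?_
    refine (mul_le_mul_right (ENNReal.rpow_le_rpow hen (by positivity)) _).trans (le_of_eq ?_)
    rw [ENNReal.ofReal_rpow_of_nonneg (by positivity) (by positivity), ← ENNReal.ofReal_mul hCg, Real.mul_rpow hΛ (by positivity),
      ← Real.rpow_mul hρ.le, mul_div_cancel₀ _ hnq.ne', mul_assoc]
  have hν : nuM u q s (a0 * ρ ^ (q + 1 - (n:ℝ))) (b0 * ρ ^ (1 - (n:ℝ))) univ ≤
      ENNReal.ofReal ((a0 * Λ + b0 * (Cg * Λ ^ ((n:ℝ) / (n - q)))) * ρ) := by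
    rw [nuM, withDensity_apply _ MeasurableSet.univ, setLIntegral_univ, lintegral_add_right _ ((m2.pow_const s).const_mul _),
      lintegral_const_mul' _ _ ENNReal.ofReal_ne_top, lintegral_const_mul' _ _ ENNReal.ofReal_ne_top]
    refine (add_le_add (mul_le_mul_right hen _) (mul_le_mul_right hU _)).trans (le_of_eq ?_)
    rw [← ENNReal.ofReal_mul (by positivity), ← ENNReal.ofReal_mul (by positivity), ← ENNReal.ofReal_add (by positivity) (by positivity)]
    congr 1
    have e1 : ρ ^ (q + 1 - (n:ℝ)) * ρ ^ ((n:ℝ) - q) = ρ := by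
      rw [← Real.rpow_add hρ, show q + 1 - (n:ℝ) + (n - q) = 1 by ring, Real.rpow_one]
    have e2 : ρ ^ (1 - (n:ℝ)) * ρ ^ (n:ℝ) = ρ := by
      rw [← Real.rpow_add hρ, sub_add_cancel, Real.rpow_one]
    calc _ = a0 * Λ * (ρ ^ (q + 1 - (n:ℝ)) * ρ ^ ((n:ℝ) - q)) + b0 * (Cg * Λ ^ ((n:ℝ) / (n - q))) * (ρ ^ (1 - (n:ℝ)) * ρ ^ (n:ℝ)) := by ring
      _ = _ := by rw [e1, e2]; ring
  have := (proj_len hS y0 y1 h0 h1 w r hwc (fun a ha => (hwr a ha).1) hcov).trans (mul_le_mul_right (hsum.trans hν) 10)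
  rw [show (10:ℝ≥0∞) = ENNReal.ofReal 10 by norm_num, ← ENNReal.ofReal_mul (by norm_num), ENNReal.ofReal_le_ofReal_iff (by positivity)] at this
  linarith

end M7b

section M7c
universe u
variable {E : Type u} [NormedAddCommGroup E] [NormedSpace ℝ E] [FiniteDimensional ℝ E] [MeasureSpace E] [BorelSpace E]
  [(volume : Measure E).IsAddHaarMeasure]
variable {D : Set E} {f : E → E} {G : E → E →L[ℝ] E} {K : Set E}

theorem WD.det_meas (h : WD D f G) {B : Set E} (hB : IsCompact B) (hBD : B ⊆ D) :
    AEMeasurable (fun x => ENNReal.ofReal |(G x).det|) (volume.restrict B) := by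
  have m := (h.intOn hB hBD).aestronglyMeasurable
  have : Continuous fun A : E →L[ℝ] E => |A.det| := ContinuousLinearMap.continuous_det.abs
  exact (this.comp_aestronglyMeasurable m).aemeasurable.ennreal_ofReal

theorem WD.Gint (h : WD D f G) (hinj : InjOn f D) (x0 : E) (R : ℝ) (hR : 0 < R) (hD : closedBall x0 (4 * R) ⊆ D)
    (q : ℝ) (hq : 1 < q) (Q : E → ℝ≥0∞) (hQm : AEMeasurable Q (volume.restrict (closedBall x0 R)))
    (hQ : ∀ᵐ x ∂volume.restrict (closedBall x0 R), ‖G x‖ₑ ^ (Module.finrank ℝ E - 1) ≤ Q x ^ (1 / q) * ENNReal.ofReal |(G x).det| ^ (1 - 1 / q))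
    (hQf : ∫⁻ x in closedBall x0 R, Q x ≠ ⊤) :
    IntegrableOn (fun x => ‖G x‖ ^ (Module.finrank ℝ E - 1)) (closedBall x0 R) := by
  have hBc : IsCompact (closedBall x0 R) := isCompact_closedBall _ _
  have hBD : closedBall x0 R ⊆ D := (closedBall_subset_closedBall (by linarith)).trans hD
  have hq0 : 0 < q := by linarith
  have h1q : 0 ≤ 1 - 1 / q := by rw [sub_nonneg, div_le_one hq0]; exact hq.le
  have hJ : ∫⁻ x in closedBall x0 R, ENNReal.ofReal |(G x).det| ≠ ⊤ := by
    have hc : IsCompact (f '' closedBall x0 R) := hBc.image_of_continuousOn (h.cont.mono hBD)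
    have := area_ineq h hinj x0 R hR hD ((f '' closedBall x0 R).indicator 1)
    rw [lintegral_indicator_one hc.measurableSet] at this
    refine ne_top_of_le_ne_top hc.measure_lt_top.ne (le_trans (le_of_eq ?_) this)
    refine setLIntegral_congr_fun measurableSet_closedBall fun x hx => ?_
    rw [indicator_of_mem (mem_image_of_mem _ hx), Pi.one_apply, mul_one]
  have key := ENNReal.lintegral_mul_norm_pow_le hQm (h.det_meas hBc hBD) (p := 1 / q) (q := 1 - 1 / q) (by positivity) h1q (by ring)
  refine ⟨((h.intOn hBc hBD).aestronglyMeasurable.norm.pow _), ?_⟩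
  rw [hasFiniteIntegral_iff_enorm]
  refine lt_of_le_of_lt (lintegral_mono_ae ?_) (lt_of_le_of_lt key ?_)
  · filter_upwards [hQ] with x hx
    rw [enorm_pow, enorm_norm]; exact hx
  · exact ENNReal.mul_lt_top (ENNReal.rpow_lt_top_of_nonneg (by positivity) hQf) (ENNReal.rpow_lt_top_of_nonneg h1q hJ)

theorem GD.energy (h : GD D f G K) (hinj : InjOn f D) (x0 : E) (R : ℝ) (hR : 0 < R) (hD : closedBall x0 (4 * R) ⊆ D)
    (hK : closedBall x0 R ⊆ K)
    (q : ℝ) (hq : 1 < q) (Q : E → ℝ≥0∞) (hQm : AEMeasurable Q (volume.restrict (closedBall x0 R)))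
    (hQ : ∀ᵐ x ∂volume.restrict (closedBall x0 R), ‖G x‖ₑ ^ (Module.finrank ℝ E - 1) ≤ Q x ^ (1 / q) * ENNReal.ofReal |(G x).det| ^ (1 - 1 / q))
    (C : ℝ) (hC0 : 0 ≤ C) (hC : ∀ A : E →L[ℝ] E, ‖adjL A‖ ≤ C * ‖A‖ ^ (Module.finrank ℝ E - 1))
    {Φ : E → ℝ} (hΦ : Tst K Φ) (hts : tsupport Φ ⊆ closedBall x0 R) (M : ℝ) (hM0 : 0 ≤ M) (hM : ∀ z, ‖fderiv ℝ Φ z‖ ≤ M) (k : ℕ) :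
    ∫⁻ y, ‖fderiv ℝ (UU f G Φ k) y‖ₑ ^ q ≤ ENNReal.ofReal (M * C) ^ q * ∫⁻ x in closedBall x0 R, Q x := by
  have hBc : IsCompact (closedBall x0 R) := isCompact_closedBall _ _
  have hBD : closedBall x0 R ⊆ D := (closedBall_subset_closedBall (by linarith)).trans hD
  have hq0 : 0 < q := by linarith
  have h1q : 0 ≤ 1 - 1 / q := by rw [sub_nonneg, div_le_one hq0]; exact hq.le
  have m1 := h.fmeas hBc hK
  have mJ := h.toWD.det_meas hBc hBD
  have mw : ∀ y, AEMeasurable (fun x => ENNReal.ofReal (eta k (y - f x))) (volume.restrict (closedBall x0 R)) := fun y =>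
    ((eta_cd k).continuous.comp_aestronglyMeasurable (aestronglyMeasurable_const.sub m1)).aemeasurable.ennreal_ofReal
  have hpt : ∀ y, ‖UD f G Φ (eta k) y‖ₑ ^ q ≤ ENNReal.ofReal (M * C) ^ q *
      ∫⁻ x in closedBall x0 R, ENNReal.ofReal (eta k (y - f x)) * Q x := by
    intro y
    have h1 : ‖UD f G Φ (eta k) y‖ₑ ≤ ENNReal.ofReal (M * C) *
        (∫⁻ x in closedBall x0 R, ENNReal.ofReal (eta k (y - f x)) * Q x) ^ (1 / q) := by
      rw [UD_eq_set f G Φ _ y hts]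
      have e1 : ∀ᵐ x ∂volume.restrict (closedBall x0 R), ‖UDi f G Φ (eta k) y x‖ₑ ≤ ENNReal.ofReal (M * C) *
          ((ENNReal.ofReal (eta k (y - f x)) * Q x) ^ (1 / q) * (ENNReal.ofReal (eta k (y - f x)) * ENNReal.ofReal |(G x).det|) ^ (1 - 1 / q)) := by
        filter_upwards [hQ] with x hx
        have b1 := UDi_norm_le f G Φ (eta k) y x
        rw [abs_of_nonneg (eta_nn k _)] at b1
        have b2 : ‖UDi f G Φ (eta k) y x‖ ≤ (M * C) * (eta k (y - f x) * ‖G x‖ ^ (Module.finrank ℝ E - 1)) := by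
          refine b1.trans ?_
          have := mul_le_mul (hM x) (hC (G x)) (norm_nonneg _) hM0
          refine (mul_le_mul_of_nonneg_left this (eta_nn k _)).trans (le_of_eq (by ring))
        have b3 := ENNReal.ofReal_le_ofReal b2
        rw [ofReal_norm, ENNReal.ofReal_mul (by positivity), ENNReal.ofReal_mul (eta_nn k _), ENNReal.ofReal_pow (norm_nonneg _), ofReal_norm] at b3
        refine b3.trans (mul_le_mul_right ?_ _)
        refine (mul_le_mul_right hx _).trans (le_of_eq ?_)
        rw [ENNReal.mul_rpow_of_nonneg _ _ (by positivity), ENNReal.mul_rpow_of_nonneg _ _ h1q]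
        have : ENNReal.ofReal (eta k (y - f x)) = ENNReal.ofReal (eta k (y - f x)) ^ (1 / q) * ENNReal.ofReal (eta k (y - f x)) ^ (1 - 1 / q) := by
          rw [← ENNReal.rpow_add_of_nonneg _ _ (by positivity) h1q, add_sub_cancel, ENNReal.rpow_one]
        conv_lhs => rw [this]
        ring
      refine (enorm_integral_le_lintegral_enorm _).trans ((lintegral_mono_ae e1).trans ?_)
      rw [lintegral_const_mul' _ _ ENNReal.ofReal_ne_top]
      refine mul_le_mul_right ?_ _
      refine (ENNReal.lintegral_mul_norm_pow_le ((mw y).mul hQm) ((mw y).mul mJ) (by positivity) h1q (by ring)).trans ?_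
      have hA := area_ineq h.toWD hinj x0 R hR hD (fun z => ENNReal.ofReal (eta k (y - z)))
      have e2 : ∫⁻ z, ENNReal.ofReal (eta (E := E) k (y - z)) = 1 := by
        rw [lintegral_sub_left_eq_self (fun x => ENNReal.ofReal (eta (E := E) k x)) y]
        simpa using eta_lint (E := E) k 0
      rw [e2] at hA
      have hA' : ∫⁻ x in closedBall x0 R, ENNReal.ofReal (eta k (y - f x)) * ENNReal.ofReal |(G x).det| ≤ 1 := by
        simpa only [mul_comm] using hA
      refine (mul_le_mul_right (ENNReal.rpow_le_one hA' h1q) _).trans ?_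
      rw [mul_one]
      rfl
    have h2 := ENNReal.rpow_le_rpow h1 hq0.le
    rwa [ENNReal.mul_rpow_of_nonneg _ _ hq0.le, ← ENNReal.rpow_mul, one_div, inv_mul_cancel₀ hq0.ne', ENNReal.rpow_one] at h2
  rw [h.uu_fd hΦ]
  refine (lintegral_mono hpt).trans ?_
  rw [lintegral_const_mul' _ _ (ENNReal.rpow_ne_top_of_nonneg hq0.le ENNReal.ofReal_ne_top)]
  refine mul_le_mul_right (le_of_eq ?_) _
  calc _ = ∫⁻ x in closedBall x0 R, ∫⁻ y, ENNReal.ofReal (eta k (y - f x)) * Q x := by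
        refine lintegral_lintegral_swap (f := fun y x => ENNReal.ofReal (eta k (y - f x)) * Q x) ?_
        refine AEMeasurable.mul ?_ hQm.comp_snd
        have : AEStronglyMeasurable (fun p : E × E => p.1 - f p.2) (volume.prod (volume.restrict (closedBall x0 R))) :=
          continuous_fst.aestronglyMeasurable.sub m1.comp_snd
        exact ((eta_cd k).continuous.comp_aestronglyMeasurable this).aemeasurable.ennreal_ofReal
    _ = _ := by
        refine lintegral_congr fun x => ?_
        have hm : Measurable fun y => ENNReal.ofReal (eta k (y - f x)) :=
          ((eta_cd k).continuous.comp (continuous_id.sub continuous_const)).measurable.ennreal_ofReal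
        rw [lintegral_mul_const _ hm, eta_lint, one_mul]

end M7c

section M7d
universe u
variable {E : Type u} [NormedAddCommGroup E] [NormedSpace ℝ E] [FiniteDimensional ℝ E] [MeasureSpace E] [BorelSpace E]
  [(volume : Measure E).IsAddHaarMeasure]
variable {D : Set E} {f : E → E} {G : E → E →L[ℝ] E} {K : Set E}

theorem WD.lip (h : WD D f G) (hd : 2 ≤ Module.finrank ℝ E) (hinj : InjOn f D) (hop : ∀ U ⊆ D, IsOpen U → IsOpen (f '' U))
    (q : ℝ) (hq1 : 1 < q) (hq : (Module.finrank ℝ E : ℝ) - 1 < q) (hqn : q < Module.finrank ℝ E)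
    (Q : E → ℝ≥0∞) (hQm : AEMeasurable Q (volume.restrict D))
    (hQ : ∀ᵐ x ∂volume.restrict D, ‖G x‖ₑ ^ (Module.finrank ℝ E - 1) ≤ Q x ^ (1 / q) * ENNReal.ofReal |(G x).det| ^ (1 - 1 / q))
    (hfd : ∀ᵐ x ∂volume.restrict D, (G x).det = 0 → G x = 0) (x0 : E) (hx0 : x0 ∈ D) (C1 ε0 : ℝ) (hC1 : 0 ≤ C1) (hε0 : 0 < ε0)
    (hbd : ∀ ε, 0 < ε → ε < ε0 → ∫⁻ x in closedBall x0 ε, Q x ≤ ENNReal.ofReal (C1 * ε ^ Module.finrank ℝ E)) :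
    ∃ C r : ℝ, 0 ≤ C ∧ 0 < r ∧ ∀ x, ‖x - x0‖ < r → ‖f x - f x0‖ ≤ C * ‖x - x0‖ := by
  obtain ⟨T0, hT0, hT0D⟩ := Metric.nhds_basis_closedBall.mem_iff.1 (h.op.mem_nhds hx0)
  set T := min (T0 / 4) (ε0 / 2) with hT
  have hTp : 0 < T := by positivity
  have hTε : T < ε0 := (min_le_right _ _).trans_lt (by linarith)
  have hTD : closedBall x0 (4 * T) ⊆ D := (closedBall_subset_closedBall (by linarith [min_le_left (T0 / 4) (ε0 / 2)])).trans hT0D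
  have hle : ∀ r, r ≤ T → closedBall x0 r ⊆ D := fun r hr => (closedBall_subset_closedBall (by linarith)).trans hTD
  have hres : ∀ r, r ≤ T → volume.restrict (closedBall x0 r) ≤ volume.restrict D := fun r hr => Measure.restrict_mono (hle r hr) le_rfl
  have hKD := hle T le_rfl
  have hG : GD D f G (closedBall x0 T) :=
    { toWD := h, dim := hd, cpt := isCompact_closedBall _ _, sub := hKD
      int := h.Gint hinj x0 T hTp hTD q hq1 Q (hQm.mono_measure (hres T le_rfl)) ((ae_mono (hres T le_rfl)) hQ)
        (ne_top_of_le_ne_top ENNReal.ofReal_ne_top (hbd T hTp hTε)) }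
  set R := T / 8 with hR
  have hRp : 0 < R := by positivity
  have hint : ∀ r, r < T → closedBall x0 r ⊆ interior (closedBall x0 T) := fun r hr =>
    (closedBall_subset_ball hr).trans (interior_maximal ball_subset_closedBall isOpen_ball)
  obtain ⟨Φ0, c1, -, c3, c4, -⟩ := exists_cutoff x0 (3 * R) (4 * R) (by positivity) (by linarith)
  have hΦ0 : Tst (closedBall x0 T) Φ0 := ⟨c1, (isCompact_closedBall x0 (4 * R)).of_isClosed_subset (isClosed_tsupport _) c4,
    c4.trans (hint _ (by linarith))⟩
  have hfd' : ∀ᵐ x, x ∈ closedBall x0 T → (G x).det = 0 → G x = 0 :=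
    (ae_restrict_iff' measurableSet_closedBall).1 ((ae_mono (hres T le_rfl)) hfd)
  have hnv := hG.nonvan hinj hop x0 R hRp (hint _ (by linarith)) hfd' hΦ0 (fun z hz => c3 z (ball_subset_closedBall hz))
  have hc0 : ∃ c0 > 0, ∃ᶠ k in atTop, c0 ≤ |UU f G Φ0 k (f x0)| := by
    by_contra! hcon
    refine hnv (Metric.tendsto_nhds.2 fun ε hε => ?_)
    have := hcon ε hε
    filter_upwards [this] with k hk
    simpa [Real.dist_eq] using hk
  obtain ⟨c0, hc0, hfr⟩ := hc0
  obtain ⟨Ca, hCa0, hCa⟩ := exists_adjL_bound E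
  set n := Module.finrank ℝ E with hn
  obtain ⟨Cd, hCd0, hCd⟩ := diam_bd hd q hq1 hq hqn c0 hc0 ((2 * Ca) ^ q * C1 * 2 ^ n) (by positivity)
  have hcc := hG.uu_const hinj hop hΦ0 x0 (3 * R) R (by linarith) hRp (closedBall_subset_closedBall (by linarith))
    (fun z hz => c3 z (ball_subset_closedBall hz))
  refine ⟨Cd * 2, R / 2, by positivity, by positivity, fun x hx => ?_⟩
  by_cases hxx : x = x0
  · subst hxx; simp
  set ε := 2 * ‖x - x0‖ with hε
  have hεp : 0 < ε := by
    have : 0 < ‖x - x0‖ := norm_pos_iff.2 (sub_ne_zero.2 hxx)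
    positivity
  have hεR : ε < R := by linarith
  obtain ⟨Φ, d1, -, d3, d4, d5⟩ := exists_cutoff x0 ε (2 * ε) hεp.le (by linarith)
  have hΦ : Tst (closedBall x0 T) Φ := ⟨d1, (isCompact_closedBall x0 (2 * ε)).of_isClosed_subset (isClosed_tsupport _) d4,
    d4.trans (hint _ (by linarith))⟩
  have hloc := hG.uu_loc hinj hΦ hΦ0 x0 ε (ε / 2) (by linarith) (closedBall_subset_closedBall (by linarith)) (fun z hz => by
    rw [d3 z (ball_subset_closedBall hz), c3 z (closedBall_subset_closedBall (by linarith) (ball_subset_closedBall hz))])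
  obtain ⟨k, hk1, hk2, hk3⟩ := (hfr.and_eventually (hcc.and hloc)).exists
  have hen := hG.energy hinj x0 (2 * ε) (by positivity) ((closedBall_subset_closedBall (by linarith)).trans hTD)
    (closedBall_subset_closedBall (by linarith)) q hq1 Q (hQm.mono_measure (hres _ (by linarith))) ((ae_mono (hres _ (by linarith))) hQ)
    Ca hCa0 hCa hΦ d4 (2 / (2 * ε - ε)) (by rw [two_mul, add_sub_cancel_right]; positivity) d5 k
  have hen2 : ∫⁻ y, ‖fderiv ℝ (UU f G Φ k) y‖ₑ ^ q ≤ ENNReal.ofReal ((2 * Ca) ^ q * C1 * 2 ^ n * ε ^ ((n:ℝ) - q)) := by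
    refine hen.trans ((mul_le_mul_right (hbd (2 * ε) (by positivity) (by linarith)) _).trans (le_of_eq ?_))
    rw [show 2 / (2 * ε - ε) * Ca = (2 * Ca) / ε by rw [two_mul ε, add_sub_cancel_right]; ring]
    rw [ENNReal.ofReal_rpow_of_nonneg (by positivity) (by linarith), ← ENNReal.ofReal_mul (by positivity),
      Real.div_rpow (by positivity) hεp.le, Real.rpow_sub hεp, Real.rpow_natCast]
    congr 1
    rw [mul_pow]; ring
  have hS : IsPreconnected (f '' closedBall x0 (ε / 2)) :=
    ((convex_closedBall x0 (ε / 2)).isPreconnected).image f (h.cont.mono (hle _ (by linarith)))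
  have := hCd ε (UU f G Φ k) (f '' closedBall x0 (ε / 2)) (f x0) (f x) hεp (hG.uu_cd hΦ k) (hG.uu_cs hΦ k) hen2 hS (by
      rintro _ ⟨z, hz, rfl⟩
      rw [hk3 z hz, hk2 z (closedBall_subset_ball (by linarith) hz)]
      exact hk1) (mem_image_of_mem _ (mem_closedBall_self (by positivity)))
    (mem_image_of_mem _ (by rw [mem_closedBall, dist_eq_norm]; linarith))
  rw [mul_assoc, ← hε]; exact this

end M7d

theorem kp_meas {n : ℕ} (p : ℝ) (Df : Eucl n → Eucl n →L[ℝ] Eucl n) (D : Set (Eucl n))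
    (h : AEMeasurable Df (volume.restrict D)) : AEMeasurable (distortionKp p Df) (volume.restrict D) := by
  have hdet : Measurable fun A : Eucl n →L[ℝ] Eucl n => A.det := ContinuousLinearMap.continuous_det.measurable
  have hF : Measurable fun A : Eucl n →L[ℝ] Eucl n => if A.det ≠ 0 then ENNReal.ofReal (‖A‖ ^ p / A.det)
      else if A = 0 then (1:ℝ≥0∞) else ⊤ := by
    refine Measurable.ite ?_ ?_ (Measurable.ite ?_ measurable_const measurable_const)
    · exact (hdet (measurableSet_singleton 0)).compl
    · exact ((measurable_norm.pow_const p).div hdet).ennreal_ofReal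
    · exact measurableSet_singleton 0
  exact hF.comp_aemeasurable h

theorem kp_pt {n : ℕ} (hn : 3 ≤ n) (p : ℝ) (hp : (n:ℝ) < p) (A : Eucl n →L[ℝ] Eucl n) (Df : Eucl n → Eucl n →L[ℝ] Eucl n) (x : Eucl n)
    (hA : Df x = A) (h0 : 0 ≤ A.det) (h1 : A.det = 0 → A = 0) :
    ‖A‖ₑ ^ (n - 1) ≤ (distortionKp p Df x ^ (((n:ℝ)-1)/(p-(n:ℝ)+1))) ^ (1 / (p / (p - n + 1))) *
      ENNReal.ofReal |A.det| ^ (1 - 1 / (p / (p - n + 1))) := by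
  by_cases hd : A.det = 0
  · rw [h1 hd, ← ofReal_norm, norm_zero, ENNReal.ofReal_zero, zero_pow (by omega)]; exact zero_le
  have hdp : 0 < A.det := lt_of_le_of_ne h0 (Ne.symm hd)
  have hn0 : (3:ℝ) ≤ n := by exact_mod_cast hn
  have hp0 : 0 < p := by linarith
  have hpn : 0 < p - n + 1 := by linarith
  have e0 : 0 ≤ ((n:ℝ) - 1) / p := div_nonneg (by linarith) hp0.le
  have e1 : ((n:ℝ)-1)/(p-(n:ℝ)+1) * (1 / (p / (p - n + 1))) = ((n:ℝ) - 1) / p := by field_simp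
  have e2 : 1 - 1 / (p / (p - n + 1)) = ((n:ℝ) - 1) / p := by field_simp; ring
  unfold distortionKp
  rw [hA, if_pos hd, ← ENNReal.rpow_mul, e1, e2, abs_of_pos hdp, ← ENNReal.mul_rpow_of_nonneg _ _ e0, ← ENNReal.ofReal_mul (by positivity),
    div_mul_cancel₀ _ hd, ENNReal.ofReal_rpow_of_nonneg (by positivity) e0, ← Real.rpow_mul (norm_nonneg _), mul_div_cancel₀ _ hp0.ne',
    ← ofReal_norm, ← ENNReal.ofReal_pow (norm_nonneg _), ← Real.rpow_natCast, Nat.cast_sub (by omega), Nat.cast_one]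

/-- if `f : D → D'` is a homeomorphism of finite distortion of class
`W^{1,φ}_loc` (with the Calderón-type condition on `φ`) and for some `p ∈ (n, n+1/(n-2))`
the means of `K_p(·,f)^{(n-1)/(p-n+1)}` over small balls have finite limsup at every point
of `D`, then `f` is finitely Lipschitz. -/
theorem stmt_9 (n : ℕ) (hn : 3 ≤ n) (D D' : Set (Eucl n))
    (hDopen : IsOpen D) (hDconn : IsConnected D)
    (hD'open : IsOpen D') (hD'conn : IsConnected D')
    (φ : ℝ → ℝ) (hφ : NondecPos φ) (hcal : CalderonCond n φ)
    (f : Eucl n → Eucl n) (Df : Eucl n → Eucl n →L[ℝ] Eucl n)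
    (hf : IsHomeoOn f D D')
    (hsob : MemOrliczSobolevOn φ D f Df)
    (hfd : HasFiniteDistortionOn D Df)
    (p : ℝ) (hp : p ∈ Ioo (n : ℝ) ((n : ℝ) + 1 / ((n : ℝ) - 2)))
    (hk : ∀ x₀ ∈ D,
      limsup (fun ε : ℝ =>
          (∫⁻ x in ball x₀ ε, distortionKp p Df x ^ (((n:ℝ)-1)/(p-(n:ℝ)+1))) /
            volume (ball x₀ ε)) (𝓝[>] (0:ℝ)) < ⊤) :
    ∀ x ∈ D, LAt f x < ⊤ := by
  intro x0 hx0
  obtain ⟨⟨_, hli, hwk⟩, _⟩ := hsob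
  have hrank : Module.finrank ℝ (Eucl n) = n := finrank_euclideanSpace_fin
  have hW : WD D f Df := ⟨hDopen, hf.continuousOn, hli, hwk⟩
  have hn0 : (3:ℝ) ≤ n := by exact_mod_cast hn
  have hp1 := hp.1
  have hp2 : p * (n - 2) < ((n:ℝ) - 1) ^ 2 := by
    have h2 : (0:ℝ) < n - 2 := by linarith
    have := mul_lt_mul_of_pos_right hp.2 h2
    rw [add_mul, one_div, inv_mul_cancel₀ h2.ne'] at this
    nlinarith
  have hpn : 0 < p - n + 1 := by linarith
  set q := p / (p - n + 1) with hq
  have hqa : (n:ℝ) - 1 < q := by rw [hq, lt_div_iff₀ hpn]; nlinarith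
  have hqb : q < n := by rw [hq, div_lt_iff₀ hpn]; nlinarith
  obtain ⟨Kf, -, hKf⟩ := hfd
  have hdet : ∀ᵐ x ∂volume.restrict D, 0 ≤ (Df x).det ∧ ((Df x).det = 0 → Df x = 0) := by
    filter_upwards [hKf] with x hx
    have h1 : 0 ≤ Kf x * (Df x).det := (by positivity : (0:ℝ) ≤ ‖Df x‖ ^ n).trans hx.2
    refine ⟨by by_contra! hc; nlinarith [hx.1], fun h0 => ?_⟩
    have h2 := hx.2
    rw [h0, mul_zero] at h2
    have h3 : ‖Df x‖ ^ n = 0 := le_antisymm h2 (by positivity)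
    exact norm_eq_zero.1 (pow_eq_zero_iff (by omega) |>.1 h3)
  set Q : Eucl n → ℝ≥0∞ := fun x => distortionKp p Df x ^ (((n:ℝ)-1)/(p-(n:ℝ)+1)) with hQdef
  have hDfm : AEMeasurable Df (volume.restrict D) := hli.aestronglyMeasurable.aemeasurable
  have hQm : AEMeasurable Q (volume.restrict D) := (kp_meas p Df D hDfm).pow_const _
  have hb : ∃ C1 ε0 : ℝ, 0 ≤ C1 ∧ 0 < ε0 ∧ ∀ ε, 0 < ε → ε < ε0 → ∫⁻ x in closedBall x0 ε, Q x ≤ ENNReal.ofReal (C1 * ε ^ n) := by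
    obtain ⟨M, hM1, hM2⟩ := exists_between (hk x0 hx0)
    have hev := eventually_lt_of_limsup_lt hM1
    obtain ⟨t, ht, hsub⟩ := mem_nhdsGT_iff_exists_Ioo_subset.1 hev
    have hv : volume (ball (0 : Eucl n) 1) ≠ ⊤ := measure_ball_lt_top.ne
    refine ⟨(M * volume (ball (0 : Eucl n) 1)).toReal * 2 ^ n, t / 2, by positivity, half_pos ht, fun ε h1 h2 => ?_⟩
    have h3 : (∫⁻ x in ball x0 (2 * ε), Q x) / volume (ball x0 (2 * ε)) < M := hsub (⟨by linarith, by linarith⟩ : 2 * ε ∈ Ioo 0 t)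
    have hv1 : volume (ball x0 (2 * ε)) ≠ 0 := (measure_ball_pos _ _ (by linarith)).ne'
    rw [ENNReal.div_lt_iff (Or.inl hv1) (Or.inl measure_ball_lt_top.ne)] at h3
    refine (lintegral_mono_set (closedBall_subset_ball (by linarith))).trans (h3.le.trans (le_of_eq ?_))
    rw [Measure.addHaar_ball_of_pos _ _ (by linarith), hrank, mul_assoc, ENNReal.ofReal_mul ENNReal.toReal_nonneg,
      ENNReal.ofReal_toReal (ENNReal.mul_ne_top hM2.ne hv)]
    rw [mul_pow, ENNReal.ofReal_mul (by positivity)]; ring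
  obtain ⟨C1, ε0, hC1, hε0, hbd⟩ := hb
  obtain ⟨C, r, hC, hr, hL⟩ := hW.lip (by omega) hf.injOn hf.isOpenMapOn q (by linarith) (by rw [hrank]; exact hqa) (by rw [hrank]; exact hqb)
    Q hQm (by
      rw [hrank]
      filter_upwards [hdet] with x hx
      exact kp_pt hn p hp1 (Df x) Df x rfl hx.1 hx.2) (hdet.mono fun x hx => hx.2) x0 hx0 C1 ε0 hC1 hε0 (by rw [hrank]; exact hbd)
  unfold LAt
  refine lt_of_le_of_lt (limsup_le_of_le (a := ENNReal.ofReal C) (by isBoundedDefault) ?_) ENNReal.ofReal_lt_top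
  filter_upwards [self_mem_nhdsWithin, mem_nhdsWithin_of_mem_nhds (ball_mem_nhds x0 hr)] with x hx hxr
  have hx1 : edist x x0 ≠ 0 := by rw [Ne, edist_eq_zero]; exact hx
  rw [ENNReal.div_le_iff hx1 (edist_ne_top _ _), edist_dist, edist_dist, ← ENNReal.ofReal_mul hC, dist_eq_norm, dist_eq_norm]
  refine ENNReal.ofReal_le_ofReal (hL x ?_)
  rwa [← dist_eq_norm]
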